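/- arXiv:2508.10443 — 3 statements merged into one kernel-verified Lean document; each statement's English description precedes it below -/
import Mathlib

section
/- If T is a finite tree with at least two vertices that does not contain a copy of T_{3,3}, then capt_1(T, V(T), ℓ(T)) holds; in particular the 1-localization capture time satisfies lcapt_1(T) ≤ ℓ(T). -/
/-- The closed neighborhood `N[S]` of a set `S` of vertices. -/
def closedNbhd {V : Type*} (G : SimpleGraph V) (S : Set V) : Set V :=
  {v | v ∈ S ∨ ∃ s ∈ S, G.Adj s v}

/-- `capt G k t S`: the candidate-set relation of the localization game with `k` cops:
`capt G k 1 S` holds iff there is a set `P` of at most `k` vertices whose distance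
vector map is injective on `S`, and `capt G k (t+1) S` holds iff there is such a `P`
for which every fiber `C` of the distance vector map on `S` is a singleton or
satisfies `capt G k t N[C]`.  (`capt G k 0 S` is `False`.) -/
def capt {V : Type*} (G : SimpleGraph V) (k : ℕ) : ℕ → Set V → Prop
  | 0, _ => False
  | t + 1, S => ∃ P : Finset V, P.card ≤ k ∧ ∀ v ∈ S,
      {u ∈ S | ∀ p ∈ P, G.dist u p = G.dist v p}.Subsingleton ∨
        capt G k t (closedNbhd G {u ∈ S | ∀ p ∈ P, G.dist u p = G.dist v p})

/-- The `k`-localization capture time: the least `t` such that `capt G k t V(G)` holds. -/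
noncomputable def lcaptK {V : Type*} (G : SimpleGraph V) (k : ℕ) : ℕ :=
  sInf {t | capt G k t Set.univ}

/-- The localization number: the least `k` for which some `t` with `capt G k t V(G)` exists. -/
noncomputable def zeta {V : Type*} (G : SimpleGraph V) : ℕ :=
  sInf {k | ∃ t, capt G k t Set.univ}

/-- The localization capture time `lcapt G = lcapt_{ζ(G)}(G)`. -/
noncomputable def lcapt {V : Type*} (G : SimpleGraph V) : ℕ := lcaptK G (zeta G)

/-- The number of leaves (vertices of degree 1) of a graph. -/
noncomputable def numLeaves {V : Type*} (G : SimpleGraph V) : ℕ :=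
  {v : V | (G.neighborSet v).ncard = 1}.ncard

/-- The tree `T_{3,3}`: a root (vertex 0) with three children (1,2,3), each of which
has exactly two children (4,5 ; 6,7 ; 8,9). -/
def T33 : SimpleGraph (Fin 10) :=
  SimpleGraph.fromEdgeSet
    {s(0, 1), s(0, 2), s(0, 3), s(1, 4), s(1, 5), s(2, 6), s(2, 7), s(3, 8), s(3, 9)}

/-- `G` contains a copy of `T_{3,3}`, i.e. a subgraph isomorphic to `T_{3,3}`. -/
def ContainsCopyT33 {V : Type*} (G : SimpleGraph V) : Prop :=
  ∃ f : Fin 10 → V, Function.Injective f ∧ ∀ a b : Fin 10, T33.Adj a b → G.Adj (f a) (f b)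

namespace LocalizationTree

open Finset
open scoped Classical

section Capture

variable {V : Type*} {T : SimpleGraph V}

/-- Candidate sets that one cop wins within `n` further rounds, the robber moving first. -/
def Win (T : SimpleGraph V) (n : ℕ) (C : Set V) : Prop :=
  C.Subsingleton ∨ capt T 1 n (closedNbhd T C)

theorem closedNbhd_mono {C C' : Set V} (h : C ⊆ C') : closedNbhd T C ⊆ closedNbhd T C' := by
  rintro v (hv | ⟨s, hs, hv⟩)
  · exact Or.inl (h hv)
  · exact Or.inr ⟨s, h hs, hv⟩

theorem capt_anti {k n : ℕ} : ∀ {S S' : Set V}, S ⊆ S' → capt T k n S' → capt T k n S := by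
  induction n with
  | zero => intro S S' _ h; exact h
  | succ n ih =>
    rintro S S' hS ⟨P, hP, h⟩
    refine ⟨P, hP, fun v hv => ?_⟩
    have hsub : {u ∈ S | ∀ p ∈ P, T.dist u p = T.dist v p} ⊆
        {u ∈ S' | ∀ p ∈ P, T.dist u p = T.dist v p} := fun u hu => ⟨hS hu.1, hu.2⟩
    rcases h v (hS hv) with h | h
    · exact Or.inl (h.anti hsub)
    · exact Or.inr (ih (closedNbhd_mono hsub) h)

theorem capt_succ {k n : ℕ} : ∀ {S : Set V}, capt T k n S → capt T k (n + 1) S := by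
  induction n with
  | zero => intro S h; exact h.elim
  | succ n ih =>
    rintro S ⟨P, hP, h⟩
    exact ⟨P, hP, fun v hv => (h v hv).imp id ih⟩

theorem Win.anti {n : ℕ} {C C' : Set V} (hC : C ⊆ C') (h : Win T n C') : Win T n C :=
  h.imp (fun h => h.anti hC) (capt_anti (closedNbhd_mono hC))

theorem Win.mono {m n : ℕ} {C : Set V} (hmn : m ≤ n) (h : Win T m C) : Win T n C := by
  induction hmn with
  | refl => exact h
  | step _ ih => exact ih.imp id capt_succ

theorem Win.of_subsingleton {n : ℕ} {C : Set V} (h : C.Subsingleton) : Win T n C := Or.inl h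

theorem Win.singleton {n : ℕ} (v : V) : Win T n {v} := Or.inl Set.subsingleton_singleton

theorem capt_of_probe {n : ℕ} {S : Set V} (p : V)
    (h : ∀ k, ∃ F, Win T n F ∧ ∀ y ∈ S, T.dist p y = k → y ∈ F) : capt T 1 (n + 1) S := by
  refine ⟨{p}, by simp, fun v _ => ?_⟩
  obtain ⟨F, hF, hsub⟩ := h (T.dist p v)
  refine hF.anti fun u hu => hsub u hu.1 ?_
  rw [T.dist_comm (u := p), T.dist_comm (u := p)]
  exact hu.2 p (Finset.mem_singleton_self p)

/-- Winning by probing `p`: it suffices to win from a superset of every fiber. -/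
theorem Win.probe {n : ℕ} {C : Set V} (p : V)
    (h : ∀ k, ∃ F, Win T n F ∧ ∀ y ∈ closedNbhd T C, T.dist p y = k → y ∈ F) :
    Win T (n + 1) C :=
  Or.inr (capt_of_probe p h)

end Capture

section Branch

variable {V : Type*} {T : SimpleGraph V}

/-- For adjacent `u` and `c` in a tree: the vertices on the side of `c`. -/
def branch (T : SimpleGraph V) (u c : V) : Set V := {y | T.dist c y < T.dist u y}

theorem mem_branch_iff (hT : T.IsTree) {u c y : V} (h : T.Adj u c) :
    y ∈ branch T u c ↔ T.dist u y = T.dist c y + 1 := by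
  have := hT.dist_eq_dist_add_one_of_adj y h
  rw [T.dist_comm (u := y), T.dist_comm (u := y)] at this
  simp only [branch, Set.mem_ofPred_eq]
  omega

theorem notMem_branch_iff (hT : T.IsTree) {u c y : V} (h : T.Adj u c) :
    y ∉ branch T u c ↔ T.dist c y = T.dist u y + 1 := by
  have := hT.dist_eq_dist_add_one_of_adj y h
  rw [T.dist_comm (u := y), T.dist_comm (u := y)] at this
  simp only [branch, Set.mem_ofPred_eq]
  omega

theorem notMem_branch_symm (hT : T.IsTree) {u c y : V} (h : T.Adj u c) :
    y ∉ branch T u c ↔ y ∈ branch T c u := by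
  rw [notMem_branch_iff hT h, mem_branch_iff hT h.symm]

theorem exists_mem_branch (hT : T.IsTree) {u y : V} (h : y ≠ u) :
    ∃ c, T.Adj u c ∧ y ∈ branch T u c := by
  obtain ⟨p, hp⟩ := hT.connected.exists_walk_length_eq_dist u y
  cases p with
  | nil => exact absurd rfl h
  | cons hadj q =>
    refine ⟨_, hadj, ?_⟩
    have := T.dist_le q
    simp only [SimpleGraph.Walk.length_cons] at hp
    simp only [branch, Set.mem_ofPred_eq]
    omega

theorem branch_unique (hT : T.IsTree) {u y c e : V} (hc : T.Adj u c) (he : T.Adj u e)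
    (hyc : y ∈ branch T u c) (hye : y ∈ branch T u e) : c = e := by
  rw [mem_branch_iff hT hc] at hyc
  rw [mem_branch_iff hT he] at hye
  obtain ⟨p, hp⟩ := hT.connected.exists_walk_length_eq_dist c y
  obtain ⟨q, hq⟩ := hT.connected.exists_walk_length_eq_dist e y
  have hp' : (SimpleGraph.Walk.cons hc p).IsPath :=
    SimpleGraph.Walk.isPath_of_length_eq_dist _ (by simp [hp, hyc])
  have hq' : (SimpleGraph.Walk.cons he q).IsPath :=
    SimpleGraph.Walk.isPath_of_length_eq_dist _ (by simp [hq, hye])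
  have := (hT.isAcyclic.subsingleton_path u y).elim ⟨_, hp'⟩ ⟨_, hq'⟩
  simp only [Subtype.mk.injEq, SimpleGraph.Walk.cons.injEq] at this
  exact this.1

theorem self_mem_branch (hT : T.IsTree) {u c : V} (h : T.Adj u c) : c ∈ branch T u c := by
  rw [mem_branch_iff hT h, SimpleGraph.dist_self, SimpleGraph.dist_eq_one_iff_adj.2 h]

theorem self_notMem_branch (u c : V) : u ∉ branch T u c := by
  simp [branch]

/-- The only edge leaving a branch is the one it hangs on. -/
theorem eq_of_adj_of_mem_branch (hT : T.IsTree) {u c a b : V} (h : T.Adj u c)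
    (ha : a ∈ branch T u c) (hb : b ∉ branch T u c) (hab : T.Adj a b) : a = c ∧ b = u := by
  have hb' := (notMem_branch_iff hT h).1 hb
  have ha' := (mem_branch_iff hT h).1 ha
  have h1 := hT.dist_eq_dist_add_one_of_adj u hab
  have h2 := hT.dist_eq_dist_add_one_of_adj c hab
  have hac : a = c := by
    by_contra hne
    obtain ⟨a', haa', hca'⟩ := exists_mem_branch hT (Ne.symm hne)
    have e1 := (mem_branch_iff hT haa').1 hca'
    have h3 := hT.dist_eq_dist_add_one_of_adj u haa'
    have h4 : T.dist u a' ≤ T.dist u c + T.dist c a' := hT.connected.dist_triangle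
    rw [SimpleGraph.dist_eq_one_iff_adj.2 h] at h4
    rw [T.dist_comm (u := a), T.dist_comm (u := a')] at e1
    have m1 : u ∈ branch T a a' := by
      rw [mem_branch_iff hT haa', T.dist_comm (u := a), T.dist_comm (u := a')]; omega
    have m2 : u ∈ branch T a b := by
      rw [mem_branch_iff hT hab, T.dist_comm (u := a), T.dist_comm (u := b)]; omega
    have := branch_unique hT haa' hab m1 m2
    subst this
    omega
  subst hac
  rw [SimpleGraph.dist_self] at ha'
  rw [SimpleGraph.dist_eq_one_iff_adj.2 hab] at hb'
  refine ⟨rfl, ?_⟩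
  have : T.dist u b = 0 := by omega
  exact ((hT.connected.dist_eq_zero_iff).1 this).symm

theorem dist_of_separated (hT : T.IsTree) {u c y z : V} (h : T.Adj u c)
    (hz : z ∈ branch T u c) (hy : y ∉ branch T u c) :
    T.dist z y = T.dist u z + T.dist u y := by
  apply le_antisymm
  · rw [T.dist_comm (u := u) (v := z)]; exact hT.connected.dist_triangle
  obtain ⟨p, hp⟩ := hT.connected.exists_walk_length_eq_dist z y
  rw [← hp]
  clear hp
  have key : ∀ (z y : V) (p : T.Walk z y), z ∈ branch T u c → y ∉ branch T u c →
      T.dist u z + T.dist u y ≤ p.length := by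
    intro z y p
    induction p with
    | nil => exact fun hz hy => absurd hz hy
    | @cons a b _ hab q ih =>
      intro ha hy
      rw [SimpleGraph.Walk.length_cons]
      by_cases hb : b ∈ branch T u c
      · have := ih hb hy
        have := hT.dist_eq_dist_add_one_of_adj u hab
        omega
      · obtain ⟨rfl, rfl⟩ := eq_of_adj_of_mem_branch hT h ha hb hab
        have := T.dist_le q
        rw [SimpleGraph.dist_eq_one_iff_adj.2 h]
        omega
  exact key z y p hz hy

theorem branch_subset (hT : T.IsTree) {u c e : V} (huc : T.Adj u c) (hce : T.Adj c e)
    (hne : e ≠ u) : branch T c e ⊆ branch T u c := by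
  intro y hy
  by_contra h
  rw [notMem_branch_symm hT huc] at h
  exact hne (branch_unique hT hce huc.symm hy h)

theorem exists_child_of_mem_branch (hT : T.IsTree) {u c y : V} (huc : T.Adj u c)
    (hy : y ∈ branch T u c) (hne : y ≠ c) : ∃ e, T.Adj c e ∧ e ≠ u ∧ y ∈ branch T c e := by
  obtain ⟨e, he, hye⟩ := exists_mem_branch hT hne
  refine ⟨e, he, ?_, hye⟩
  rintro rfl
  exact (notMem_branch_symm hT he.symm).2 hye hy

end Branch

section Leaves

variable {V : Type*} [Fintype V] {T : SimpleGraph V}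

/-- The finset of neighbors of a vertex. -/
noncomputable def nb (T : SimpleGraph V) (u : V) : Finset V := univ.filter (T.Adj u)

@[simp] theorem mem_nb {u v : V} : v ∈ nb T u ↔ T.Adj u v := by simp [nb]

/-- The number of leaves on the side of `c` of the edge `uc`. -/
noncomputable def branchLeaves (T : SimpleGraph V) (u c : V) : ℕ :=
  (univ.filter fun y => y ∈ branch T u c ∧ (nb T y).card = 1).card

theorem branch_induction (hT : T.IsTree) {P : V → V → Prop}
    (h : ∀ u c, T.Adj u c → (∀ e, T.Adj c e → e ≠ u → P c e) → P u c) :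
    ∀ u c, T.Adj u c → P u c := by
  have key : ∀ n : ℕ, ∀ u c, T.Adj u c → (branch T u c).ncard ≤ n → P u c := by
    intro n
    induction n with
    | zero =>
      intro u c huc hn
      rw [Nat.le_zero, Set.ncard_eq_zero (Set.toFinite _)] at hn
      exact absurd (self_mem_branch hT huc) (by simp [hn])
    | succ n ih =>
      intro u c huc hn
      refine h u c huc fun e hce hne => ih c e hce ?_
      have : (branch T c e).ncard < (branch T u c).ncard :=
        Set.ncard_lt_ncard ((branch_subset hT huc hce hne).ssubset_of_mem_notMem
          (self_mem_branch hT huc) (self_notMem_branch c e)) (Set.toFinite _)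
      omega
  exact fun u c huc => key _ u c huc le_rfl

theorem eq_of_mem_branch_of_leaf (hT : T.IsTree) {u c y : V} (h : T.Adj u c)
    (hc : (nb T c).card = 1) (hy : y ∈ branch T u c) : y = c := by
  by_contra hne
  obtain ⟨e, hce, heu, -⟩ := exists_child_of_mem_branch hT h hy hne
  obtain ⟨a, ha⟩ := Finset.card_eq_one.1 hc
  have h1 : e ∈ nb T c := mem_nb.2 hce
  have h2 : u ∈ nb T c := mem_nb.2 h.symm
  rw [ha, mem_singleton] at h1 h2
  exact heu (h1.trans h2.symm)

theorem branchLeaves_of_leaf (hT : T.IsTree) {u c : V} (h : T.Adj u c)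
    (hc : (nb T c).card = 1) : branchLeaves T u c = 1 := by
  rw [branchLeaves, Finset.card_eq_one]
  refine ⟨c, Finset.ext fun y => ?_⟩
  simp only [mem_filter, mem_univ, true_and, mem_singleton]
  exact ⟨fun hy => eq_of_mem_branch_of_leaf hT h hc hy.1,
    by rintro rfl; exact ⟨self_mem_branch hT h, hc⟩⟩

theorem branchLeaves_eq_sum (hT : T.IsTree) {u c : V} (h : T.Adj u c)
    (hc : (nb T c).card ≠ 1) :
    branchLeaves T u c = ∑ e ∈ (nb T c).erase u, branchLeaves T c e := by
  simp only [branchLeaves]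
  rw [← Finset.card_biUnion]
  · congr 1
    ext y
    simp only [mem_filter, mem_univ, true_and, mem_biUnion, mem_erase, mem_nb]
    constructor
    · rintro ⟨hy, hl⟩
      obtain ⟨e, hce, heu, hye⟩ := exists_child_of_mem_branch hT h hy (by rintro rfl; exact hc hl)
      exact ⟨e, ⟨heu, hce⟩, hye, hl⟩
    · rintro ⟨e, ⟨heu, hce⟩, hye, hl⟩
      exact ⟨branch_subset hT h hce heu hye, hl⟩
  · intro e he e' he' hne
    refine Finset.disjoint_left.2 fun y hy hy' => hne ?_
    simp only [mem_coe, mem_erase, mem_nb] at he he'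
    simp only [mem_filter, mem_univ, true_and] at hy hy'
    exact branch_unique hT he.2 he'.2 hy.1 hy'.1

theorem branchLeaves_pos (hT : T.IsTree) {u c : V} (h : T.Adj u c) :
    1 ≤ branchLeaves T u c := by
  refine branch_induction hT (P := fun u c => 1 ≤ branchLeaves T u c) ?_ u c h
  intro u c huc ih
  by_cases hc : (nb T c).card = 1
  · rw [branchLeaves_of_leaf hT huc hc]
  rw [branchLeaves_eq_sum hT huc hc]
  have hu : u ∈ nb T c := mem_nb.2 huc.symm
  have hpos : 0 < (nb T c).card := Finset.card_pos.2 ⟨u, hu⟩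
  have : 0 < ((nb T c).erase u).card := by rw [Finset.card_erase_of_mem hu]; omega
  obtain ⟨e, he⟩ := Finset.card_pos.1 this
  have he' := he
  rw [mem_erase, mem_nb] at he'
  exact (ih e he'.2 he'.1).trans
    (Finset.single_le_sum (f := fun e => branchLeaves T c e) (fun _ _ => Nat.zero_le _) he)

theorem card_le_sum_branchLeaves (hT : T.IsTree) {u : V} {M : Finset V} (hM : M ⊆ nb T u) :
    M.card ≤ ∑ c ∈ M, branchLeaves T u c := by
  rw [Finset.card_eq_sum_ones]
  exact Finset.sum_le_sum fun c hc => branchLeaves_pos hT (mem_nb.1 (hM hc))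

theorem two_le_branchLeaves (hT : T.IsTree) {u c : V} (h : T.Adj u c)
    (hc : 3 ≤ (nb T c).card) : 2 ≤ branchLeaves T u c := by
  rw [branchLeaves_eq_sum hT h (by omega)]
  refine le_trans ?_ (card_le_sum_branchLeaves hT (Finset.erase_subset _ _))
  rw [Finset.card_erase_of_mem (mem_nb.2 h.symm)]
  omega

theorem numLeaves_eq (hT : T.IsTree) {r s : V} (hr : nb T r = {s}) :
    numLeaves T = branchLeaves T r s + 1 := by
  have hrs : T.Adj r s := by rw [← mem_nb, hr]; simp
  have hcard : ∀ v, (T.neighborSet v).ncard = (nb T v).card := by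
    intro v
    rw [← Set.ncard_coe_finset]
    congr 1
    ext w
    simp
  rw [numLeaves, branchLeaves, ← Finset.card_insert_of_notMem (a := r), ← Set.ncard_coe_finset]
  · congr 1
    ext v
    simp only [hcard, Set.mem_ofPred_eq, coe_insert, Set.mem_insert_iff, mem_coe, mem_filter,
      mem_univ, true_and]
    constructor
    · intro hv
      by_cases hvr : v = r
      · exact Or.inl hvr
      obtain ⟨c, hc, hvc⟩ := exists_mem_branch hT hvr
      rw [← mem_nb, hr, mem_singleton] at hc
      exact Or.inr ⟨hc ▸ hvc, hv⟩
    · rintro (rfl | h)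
      · simp [hr]
      · exact h.2
  · simp [self_notMem_branch]

theorem exists_nb_eq_singleton (hT : T.IsTree) (hcard : 2 ≤ Fintype.card V) :
    ∃ r s, nb T r = {s} := by
  have : Nontrivial V := Fintype.one_lt_card_iff_nontrivial.1 hcard
  obtain ⟨r, hr⟩ := hT.exists_vert_degree_one_of_nontrivial
  obtain ⟨s, hs⟩ := Finset.card_eq_one.1 hr
  refine ⟨r, s, Finset.ext fun v => ?_⟩
  rw [← hs, mem_nb, SimpleGraph.mem_neighborFinset]

theorem card_le_two_of_not_containsCopyT33 (hT : T.IsTree) (hfree : ¬ ContainsCopyT33 T) (u : V) :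
    ((nb T u).filter fun c => 3 ≤ (nb T c).card).card ≤ 2 := by
  by_contra! hlt
  obtain ⟨a, ha, b, hb, c, hc, hab, hac, hbc⟩ := Finset.two_lt_card.1 hlt
  simp only [mem_filter, mem_nb] at ha hb hc
  have child : ∀ x, T.Adj u x → 3 ≤ (nb T x).card → ∃ y z, T.Adj x y ∧ T.Adj x z ∧ y ≠ z ∧
      y ∈ branch T u x ∧ z ∈ branch T u x ∧ y ≠ x ∧ z ≠ x := by
    intro x hux hx
    have : 1 < ((nb T x).erase u).card := by
      rw [Finset.card_erase_of_mem (mem_nb.2 hux.symm)]; omega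
    obtain ⟨y, hy, z, hz, hyz⟩ := Finset.one_lt_card.1 this
    rw [mem_erase, mem_nb] at hy hz
    exact ⟨y, z, hy.2, hz.2, hyz, branch_subset hT hux hy.2 hy.1 (self_mem_branch hT hy.2),
      branch_subset hT hux hz.2 hz.1 (self_mem_branch hT hz.2), hy.2.ne', hz.2.ne'⟩
  obtain ⟨a1, a2, ha1, ha2, ha12, ma1, ma2, na1, na2⟩ := child a ha.1 ha.2
  obtain ⟨b1, b2, hb1, hb2, hb12, mb1, mb2, nb1, nb2⟩ := child b hb.1 hb.2
  obtain ⟨c1, c2, hc1, hc2, hc12, mc1, mc2, nc1, nc2⟩ := child c hc.1 hc.2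
  have sep : ∀ {x y v w}, T.Adj u x → T.Adj u y → x ≠ y → v ∈ branch T u x →
      w ∈ branch T u y → v ≠ w := fun hx hy hxy hv hw hvw =>
    hxy (branch_unique hT hx hy hv (hvw ▸ hw))
  have ma := self_mem_branch hT ha.1
  have mb := self_mem_branch hT hb.1
  have mc := self_mem_branch hT hc.1
  have ne : ∀ {x v}, v ∈ branch T u x → u ≠ v := by
    rintro x v hv rfl
    exact self_notMem_branch u x hv
  refine hfree ⟨![u, a, b, c, a1, a2, b1, b2, c1, c2], ?_, ?_⟩
  · rw [← List.nodup_ofFn]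
    have sab := fun {v w} => sep (v := v) (w := w) ha.1 hb.1 hab
    have sac := fun {v w} => sep (v := v) (w := w) ha.1 hc.1 hac
    have sbc := fun {v w} => sep (v := v) (w := w) hb.1 hc.1 hbc
    have sba := fun {v w} => sep (v := v) (w := w) hb.1 ha.1 hab.symm
    have sca := fun {v w} => sep (v := v) (w := w) hc.1 ha.1 hac.symm
    have scb := fun {v w} => sep (v := v) (w := w) hc.1 hb.1 hbc.symm
    simp [ne ma, ne ma1, ne ma2, ne mb, ne mb1, ne mb2, ne mc, ne mc1, ne mc2,
      hab, hac, hbc, ha12, hb12, hc12, na1.symm, na2.symm, nb1.symm, nb2.symm, nc1.symm, nc2.symm,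
      sab ma mb1, sab ma mb2, sac ma mc1, sac ma mc2, sba mb ma1, sba mb ma2, sbc mb mc1,
      sbc mb mc2, sca mc ma1, sca mc ma2, scb mc mb1, scb mc mb2,
      sab ma1 mb1, sab ma1 mb2, sab ma2 mb1, sab ma2 mb2,
      sac ma1 mc1, sac ma1 mc2, sac ma2 mc1, sac ma2 mc2,
      sbc mb1 mc1, sbc mb1 mc2, sbc mb2 mc1, sbc mb2 mc2]
  · intro x y hxy
    simp only [T33, SimpleGraph.fromEdgeSet_adj, Set.mem_insert_iff, Set.mem_singleton_iff,
      Sym2.eq_iff] at hxy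
    obtain ⟨hxy, -⟩ := hxy
    rcases hxy with h | h | h | h | h | h | h | h | h <;> rcases h with ⟨rfl, rfl⟩ | ⟨rfl, rfl⟩ <;>
      first
      | exact ha.1 | exact hb.1 | exact hc.1 | exact ha.1.symm | exact hb.1.symm | exact hc.1.symm
      | exact ha1 | exact ha2 | exact hb1 | exact hb2 | exact hc1 | exact hc2
      | exact ha1.symm | exact ha2.symm | exact hb1.symm | exact hb2.symm | exact hc1.symm
      | exact hc2.symm

/-- The path that starts with the edge `uc` runs through vertices of degree two and reaches
its first other vertex `t` after `q` steps, through the edge `st`. -/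
structure Chain (T : SimpleGraph V) (u c : V) (q : ℕ) (s t : V) : Prop where
  pos : 1 ≤ q
  adj : T.Adj s t
  dist_pred : T.dist u s + 1 = q
  mem_pred : s = u ∨ s ∈ branch T u c
  subset : branch T s t ⊆ branch T u c
  card_ne : (nb T t).card ≠ 2
  leaves : branchLeaves T s t = branchLeaves T u c
  eq_of_one : q = 1 → s = u ∧ t = c
  card_of_two : 2 ≤ q → (nb T c).card = 2 ∧ (nb T s).card = 2
  near : ∀ y ∈ branch T u c, y ∉ branch T s t → T.dist u y < q ∧ T.dist t y + T.dist u y = q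
  far : ∀ y ∈ branch T s t, T.dist u y = q + T.dist t y
  uniq : ∀ y ∈ branch T u c, ∀ y' ∈ branch T u c, T.dist u y = T.dist u y' → T.dist u y ≤ q →
    y = y'

theorem exists_chain (hT : T.IsTree) {u c : V} (h : T.Adj u c) :
    ∃ q s t, Chain T u c q s t := by
  refine branch_induction hT (P := fun u c => ∃ q s t, Chain T u c q s t) ?_ u c h
  intro u c huc ih
  by_cases hc : (nb T c).card = 2
  · have hu : u ∈ nb T c := mem_nb.2 huc.symm
    have : ((nb T c).erase u).card = 1 := by rw [Finset.card_erase_of_mem hu]; omega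
    obtain ⟨e, he⟩ := Finset.card_eq_one.1 this
    have hmem : ∀ x, T.Adj c x → x ≠ u → x = e := fun x hx hxu => by
      have : x ∈ (nb T c).erase u := by simp [hx, hxu]
      simpa [he] using this
    have hce : e ≠ u ∧ T.Adj c e := by
      have : e ∈ (nb T c).erase u := by simp [he]
      simpa using this
    obtain ⟨q, s, t, H⟩ := ih e hce.2 hce.1
    have hsub := branch_subset hT huc hce.2 hce.1
    have hcs : s ∈ branch T u c := by
      rcases H.mem_pred with rfl | h
      · exact self_mem_branch hT huc
      · exact hsub h
    have d : ∀ y ∈ branch T u c, T.dist u y = T.dist c y + 1 := fun y =>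
      (mem_branch_iff hT huc).1
    have split : ∀ y ∈ branch T u c, y = c ∨ y ∈ branch T c e := by
      intro y hy
      by_cases hyc : y = c
      · exact Or.inl hyc
      obtain ⟨x, hx, hxu, hyx⟩ := exists_child_of_mem_branch hT huc hy hyc
      exact Or.inr (hmem x hx hxu ▸ hyx)
    refine ⟨q + 1, s, t, by omega, H.adj, ?_, Or.inr hcs, H.subset.trans hsub, H.card_ne, ?_, ?_,
      ?_, ?_, ?_, ?_⟩
    · rw [d s hcs, H.dist_pred]
    · rw [H.leaves, branchLeaves_eq_sum hT huc (by omega), he, Finset.sum_singleton]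
    · intro hq
      have := H.pos
      omega
    · intro _
      refine ⟨hc, ?_⟩
      by_cases hq : q = 1
      · rw [(H.eq_of_one hq).1, hc]
      · exact (H.card_of_two (by have := H.pos; omega)).2
    · intro y hy hyt
      have hd := d y hy
      rcases split y hy with rfl | hye
      · have := H.far t (self_mem_branch hT H.adj)
        rw [SimpleGraph.dist_self] at hd this
        rw [T.dist_comm (u := t), this, hd]
        have := H.pos
        omega
      · have := H.near y hye hyt
        omega
    · intro y hy
      rw [d y (hsub (H.subset hy)), H.far y hy]
      omega
    · intro y hy y' hy' hdd hle
      have h1 := d y hy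
      have h2 := d y' hy'
      have h0 : ∀ z ∈ branch T c e, T.dist c z ≠ 0 := fun z hz h0 => by
        rw [hT.connected.dist_eq_zero_iff] at h0
        subst h0
        exact self_notMem_branch c e hz
      rcases split y hy with rfl | hye <;> rcases split y' hy' with rfl | hye'
      · rfl
      · rw [SimpleGraph.dist_self] at h1
        have := h0 y' hye'
        omega
      · rw [SimpleGraph.dist_self] at h2
        have := h0 y hye
        omega
      · exact H.uniq y hye y' hye' (by omega) (by omega)
  · refine ⟨1, u, c, le_rfl, huc, by simp, Or.inl rfl, subset_rfl, hc, rfl, fun _ => ⟨rfl, rfl⟩,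
      by omega, fun y hy hy' => absurd hy hy', ?_, ?_⟩
    · intro y hy
      rw [(mem_branch_iff hT huc).1 hy, add_comm]
    · intro y hy y' hy' hdd hle
      rw [mem_branch_iff hT huc] at hy hy'
      have h1 : T.dist c y = 0 := by omega
      have h2 : T.dist c y' = 0 := by omega
      rw [hT.connected.dist_eq_zero_iff] at h1 h2
      exact h1.symm.trans h2

end Leaves

section Spheres

variable {V : Type*} {T : SimpleGraph V}

/-- The vertices at distance `D` from `u` that lie in a branch at `u` towards a member of `M`. -/
def sph (T : SimpleGraph V) (u : V) (M : Finset V) (D : ℕ) : Set V :=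
  {y | T.dist u y = D ∧ ∃ c ∈ M, y ∈ branch T u c}

theorem sph_empty (u : V) (D : ℕ) : sph T u ∅ D = ∅ := by
  ext y
  simp [sph]

theorem one_le_dist (u : V) {c y : V} (hy : y ∈ branch T u c) : 1 ≤ T.dist u y := by
  simp only [branch, Set.mem_ofPred_eq] at hy
  omega

theorem dist_of_branches (hT : T.IsTree) {u c c' y z : V} (h : T.Adj u c) (h' : T.Adj u c')
    (hne : c ≠ c') (hz : z ∈ branch T u c) (hy : y ∈ branch T u c') :
    T.dist z y = T.dist u z + T.dist u y :=
  dist_of_separated hT h hz fun hy' => hne (branch_unique hT h h' hy' hy)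

theorem dist_of_adj_branch (hT : T.IsTree) {u c c' y : V} (h : T.Adj u c) (h' : T.Adj u c')
    (hne : c ≠ c') (hy : y ∈ branch T u c') : T.dist c y = T.dist u y + 1 := by
  rw [dist_of_branches hT h h' hne (self_mem_branch hT h) hy, SimpleGraph.dist_eq_one_iff_adj.2 h,
    add_comm]

theorem eq_of_mem_branch_of_dist_le_one (hT : T.IsTree) {u c y : V} (h : T.Adj u c)
    (hy : y ∈ branch T u c) (hd : T.dist u y ≤ 1) : y = c := by
  rw [mem_branch_iff hT h] at hy
  have : T.dist c y = 0 := by omega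
  exact ((hT.connected.dist_eq_zero_iff).1 this).symm

theorem dist_near (hT : T.IsTree) {x y : V} (u : V) (hxy : x = y ∨ T.Adj x y) :
    T.dist u x ≤ T.dist u y + 1 ∧ T.dist u y ≤ T.dist u x + 1 := by
  rcases hxy with rfl | hxy
  · omega
  · have := hT.dist_eq_dist_add_one_of_adj u hxy
    omega

theorem mem_closedNbhd {C : Set V} {y : V} :
    y ∈ closedNbhd T C ↔ ∃ x ∈ C, x = y ∨ T.Adj x y := by
  constructor
  · rintro (hy | ⟨x, hx, hxy⟩)
    · exact ⟨y, hy, Or.inl rfl⟩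
    · exact ⟨x, hx, Or.inr hxy⟩
  · rintro ⟨x, hx, rfl | hxy⟩
    · exact Or.inl hx
    · exact Or.inr ⟨x, hx, hxy⟩

theorem mem_closedNbhd_union {A B : Set V} {y : V} :
    y ∈ closedNbhd T (A ∪ B) ↔ y ∈ closedNbhd T A ∨ y ∈ closedNbhd T B := by
  simp only [mem_closedNbhd, Set.mem_union, or_and_right, exists_or]

end Spheres

section Strategies

variable {V : Type*} [Fintype V] {T : SimpleGraph V}

theorem mem_closedNbhd_branches (hT : T.IsTree) {u : V} {M : Finset V} (hM : M ⊆ nb T u)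
    {x y : V} (hx : ∃ c ∈ M, x ∈ branch T u c) (hxy : x = y ∨ T.Adj x y) :
    (y = u ∧ T.dist u x = 1) ∨ (∃ c ∈ M, x ∈ branch T u c ∧ y ∈ branch T u c) := by
  obtain ⟨c, hc, hxc⟩ := hx
  rcases hxy with rfl | hxy
  · exact Or.inr ⟨c, hc, hxc, hxc⟩
  by_cases hyc : y ∈ branch T u c
  · exact Or.inr ⟨c, hc, hxc, hyc⟩
  obtain ⟨rfl, rfl⟩ := eq_of_adj_of_mem_branch hT (mem_nb.1 (hM hc)) hxc hyc hxy
  exact Or.inl ⟨rfl, SimpleGraph.dist_eq_one_iff_adj.2 (mem_nb.1 (hM hc))⟩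

theorem mem_closedNbhd_sph (hT : T.IsTree) {u : V} {M : Finset V} (hM : M ⊆ nb T u) {D : ℕ}
    {y : V} (hy : y ∈ closedNbhd T (sph T u M D)) :
    (y = u ∧ D = 1) ∨
      (∃ c ∈ M, y ∈ branch T u c ∧ D ≤ T.dist u y + 1 ∧ T.dist u y ≤ D + 1) := by
  obtain ⟨x, ⟨hx, hxM⟩, hxy⟩ := mem_closedNbhd.1 hy
  rcases mem_closedNbhd_branches hT hM hxM hxy with ⟨h1, h2⟩ | ⟨c, hc, hxc, hyc⟩
  · exact Or.inl ⟨h1, by omega⟩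
  · have := dist_near hT u hxy
    exact Or.inr ⟨c, hc, hyc, by omega, by omega⟩

theorem coe_subset_sph (hT : T.IsTree) {u : V} {M : Finset V} (hM : M ⊆ nb T u) :
    (M : Set V) ⊆ sph T u M 1 := fun c hc =>
  ⟨SimpleGraph.dist_eq_one_iff_adj.2 (mem_nb.1 (hM hc)), c, hc,
    self_mem_branch hT (mem_nb.1 (hM hc))⟩

/-- A neighbor `s` of degree at most two, added to a set of neighbors of `t`, costs one round. -/
theorem Win.insert_low (hT : T.IsTree) {t s : V} (hts : T.Adj t s) (hs : (nb T s).card ≤ 2)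
    {R : Finset V} (hR : R ⊆ nb T t) (hsR : s ∉ R) {n : ℕ} (h1 : Win T n (sph T t R 1))
    (h2 : Win T n (sph T t R 2)) : Win T (n + 1) ({s} ∪ (R : Set V)) := by
  have hmem : ∀ y ∈ closedNbhd T ({s} ∪ (R : Set V)), y = s ∨ T.Adj s y ∨
      (y ∈ sph T t R 1 ∨ y ∈ sph T t R 2) := by
    intro y hy
    obtain ⟨x, rfl | hx, hxy⟩ := mem_closedNbhd.1 hy
    · exact hxy.elim (fun h => Or.inl h.symm) fun h => Or.inr (Or.inl h)
    obtain ⟨hx1, hxR⟩ := coe_subset_sph hT hR hx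
    have hn := dist_near hT t hxy
    rcases mem_closedNbhd_branches hT hR hxR hxy with ⟨rfl, -⟩ | ⟨c, hc, -, hyc⟩
    · exact Or.inr (Or.inl hts.symm)
    have := one_le_dist t hyc
    obtain h | h : T.dist t y = 1 ∨ T.dist t y = 2 := by omega
    · exact Or.inr (Or.inr (Or.inl ⟨h, c, hc, hyc⟩))
    · exact Or.inr (Or.inr (Or.inr ⟨h, c, hc, hyc⟩))
  have hdist : ∀ z ∈ branch T t s, ∀ k, ∀ y ∈ sph T t R k, T.dist z y = T.dist t z + k := by
    rintro z hz k y ⟨rfl, c, hc, hyc⟩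
    exact dist_of_branches hT hts (mem_nb.1 (hR hc)) (by rintro rfl; exact hsR hc) hz hyc
  have htn : t ∈ nb T s := mem_nb.2 hts.symm
  have hd1 := SimpleGraph.dist_eq_one_iff_adj.2 hts
  by_cases hleaf : ∀ x, T.Adj s x → x = t
  · refine Win.probe s fun k => ?_
    have hds := hdist s (self_mem_branch hT hts)
    rcases k with _ | _ | _ | k
    · refine ⟨{s}, Win.singleton s, fun y hy hk => ?_⟩
      exact ((hT.connected.dist_eq_zero_iff).1 hk).symm
    · refine ⟨{t}, Win.singleton t, fun y hy hk => ?_⟩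
      exact hleaf y (SimpleGraph.dist_eq_one_iff_adj.1 hk)
    · refine ⟨_, h1, fun y hy hk => ?_⟩
      rcases hmem y hy with rfl | h | h | h
      · simp at hk
      · rw [SimpleGraph.dist_eq_one_iff_adj.2 h] at hk; omega
      · exact h
      · have := hds _ y h; omega
    · refine ⟨_, h2, fun y hy hk => ?_⟩
      rcases hmem y hy with rfl | h | h | h
      · simp at hk
      · rw [SimpleGraph.dist_eq_one_iff_adj.2 h] at hk; omega
      · have := hds _ y h; omega
      · exact h
  · push Not at hleaf
    obtain ⟨s', hs', hne⟩ := hleaf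
    have hnb : ∀ x, T.Adj s x → x = t ∨ x = s' := by
      intro x hx
      by_contra! hcon
      have : ({t, s', x} : Finset V) ⊆ nb T s := by
        intro z hz
        simp only [mem_insert, mem_singleton] at hz
        rcases hz with rfl | rfl | rfl <;> simp_all
      have h3 := Finset.card_le_card this
      rw [Finset.card_eq_three.2 ⟨t, s', x, hne.symm, hcon.1.symm, hcon.2.symm, rfl⟩] at h3
      omega
    have hmb : s' ∈ branch T t s := branch_subset hT hts hs' hne (self_mem_branch hT hs')
    have hdt : T.dist t s' = 2 := by
      rw [(mem_branch_iff hT hts).1 hmb, SimpleGraph.dist_eq_one_iff_adj.2 hs']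
    have hds := hdist s' hmb
    have hcases : ∀ y ∈ closedNbhd T ({s} ∪ (R : Set V)),
        (y = s ∧ T.dist s' y = 1) ∨ (y = t ∧ T.dist s' y = 2) ∨ (y = s' ∧ T.dist s' y = 0) ∨
        (y ∈ sph T t R 1 ∧ T.dist s' y = 3) ∨ (y ∈ sph T t R 2 ∧ T.dist s' y = 4) := by
      intro y hy
      rcases hmem y hy with rfl | h | h | h
      · exact Or.inl ⟨rfl, SimpleGraph.dist_eq_one_iff_adj.2 hs'.symm⟩
      · rcases hnb y h with rfl | rfl
        · exact Or.inr (Or.inl ⟨rfl, by rw [T.dist_comm, hdt]⟩)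
        · exact Or.inr (Or.inr (Or.inl ⟨rfl, by simp⟩))
      · exact Or.inr (Or.inr (Or.inr (Or.inl ⟨h, by rw [hds _ y h, hdt]⟩)))
      · exact Or.inr (Or.inr (Or.inr (Or.inr ⟨h, by rw [hds _ y h, hdt]⟩)))
    refine Win.probe s' fun k => ?_
    rcases k with _ | _ | _ | _ | k
    · refine ⟨{s'}, Win.singleton _, fun y hy hk => ?_⟩
      have := hcases y hy
      simp only [Set.mem_singleton_iff]
      grind
    · refine ⟨{s}, Win.singleton _, fun y hy hk => ?_⟩
      have := hcases y hy
      simp only [Set.mem_singleton_iff]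
      grind
    · refine ⟨{t}, Win.singleton _, fun y hy hk => ?_⟩
      have := hcases y hy
      simp only [Set.mem_singleton_iff]
      grind
    · refine ⟨_, h1, fun y hy hk => ?_⟩
      have := hcases y hy
      grind
    · refine ⟨_, h2, fun y hy hk => ?_⟩
      have := hcases y hy
      grind

theorem Chain.end_mem (hT : T.IsTree) {u c s t : V} {q : ℕ} (H : Chain T u c q s t) :
    t ∈ branch T u c ∧ T.dist u t = q := by
  have := H.far t (self_mem_branch hT H.adj)
  rw [SimpleGraph.dist_self] at this
  exact ⟨H.subset (self_mem_branch hT H.adj), this⟩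

theorem Chain.dist_off (hT : T.IsTree) {u c s t y : V} {q : ℕ} (H : Chain T u c q s t)
    (h : T.Adj u c) (hy : y ∉ branch T u c) : T.dist t y = q + T.dist u y := by
  have := H.end_mem hT
  rw [dist_of_separated hT h this.1 hy, this.2]

theorem Chain.dist_of_leaf (hT : T.IsTree) {u c s t y : V} {q : ℕ} (H : Chain T u c q s t)
    (ht : (nb T t).card = 1) (hy : y ∈ branch T u c) : T.dist t y + T.dist u y = q := by
  by_cases hyt : y ∈ branch T s t
  · obtain rfl := eq_of_mem_branch_of_leaf hT H.adj ht hyt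
    rw [SimpleGraph.dist_self, (H.end_mem hT).2, zero_add]
  · exact (H.near y hy hyt).2

theorem Chain.subsingleton {u c s t : V} {q D : ℕ} (H : Chain T u c q s t) (hD : D ≤ q) :
    (sph T u {c} D).Subsingleton := by
  rintro y ⟨hy, c1, hc1, hyc⟩ y' ⟨hy', c2, hc2, hyc'⟩
  rw [mem_singleton] at hc1 hc2
  subst hc1 hc2
  exact H.uniq y hyc y' hyc' (by omega) (by omega)

theorem Win.of_chain (hT : T.IsTree) {u c s t : V} {q D n : ℕ} {M : Finset V}
    (h : T.Adj u c) (H : Chain T u c q s t) (hM : M ⊆ nb T u) (hc : c ∈ M)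
    (hq : 2 ≤ q ∨ (nb T t).card = 1) (hD : D ≠ q ∨ (nb T t).card = 1)
    (hoff : ∀ D', Win T n (sph T u (M.erase c) D'))
    (hon : ∀ D' ≤ D + 1, Win T n (sph T u {c} D')) : Win T (n + 1) (sph T u M D) := by
  have hpos := H.pos
  have hmem : ∀ y ∈ closedNbhd T (sph T u M D),
      (y = u ∧ D = 1 ∧ T.dist t y = q) ∨
      (y ∈ sph T u (M.erase c) (T.dist u y) ∧ D ≤ T.dist u y + 1 ∧ T.dist u y ≤ D + 1 ∧
        1 ≤ T.dist u y ∧ T.dist t y = q + T.dist u y) ∨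
      (y ∈ sph T u {c} (T.dist u y) ∧ D ≤ T.dist u y + 1 ∧ T.dist u y ≤ D + 1 ∧
        1 ≤ T.dist u y ∧ ((T.dist u y < q ∧ T.dist t y + T.dist u y = q) ∨
          T.dist u y = q + T.dist t y)) ∧ ((nb T t).card = 1 → T.dist t y + T.dist u y = q) := by
    intro y hy
    rcases mem_closedNbhd_sph hT hM hy with ⟨rfl, h1⟩ | ⟨e, he, hye, h1, h2⟩
    · refine Or.inl ⟨rfl, h1, ?_⟩
      rw [T.dist_comm, (H.end_mem hT).2]
    have h3 := one_le_dist u hye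
    by_cases hec : e = c
    · subst hec
      refine Or.inr (Or.inr ⟨⟨⟨rfl, e, mem_singleton_self e, hye⟩, h1, h2, h3, ?_⟩,
        fun ht => H.dist_of_leaf hT ht hye⟩)
      by_cases hyt : y ∈ branch T s t
      · exact Or.inr (H.far y hyt)
      · exact Or.inl (H.near y hye hyt)
    · refine Or.inr (Or.inl ⟨⟨rfl, e, mem_erase.2 ⟨hec, he⟩, hye⟩, h1, h2, h3, ?_⟩)
      exact H.dist_off hT h fun hyc => hec (branch_unique hT (mem_nb.1 (hM he)) h hye hyc)
  refine Win.probe t fun k => ?_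
  by_cases hk1 : q + 1 ≤ k ∧ q + D ≤ k + 1
  · refine ⟨_, hoff (k - q), fun y hy hk => ?_⟩
    rcases hmem y hy with h | h | h
    · omega
    · have : T.dist u y = k - q := by omega
      exact this ▸ h.1
    · omega
  by_cases hk2 : k = q ∧ D = 1
  · refine ⟨_, Win.singleton u, fun y hy hk => ?_⟩
    rcases hmem y hy with h | h | h
    · exact h.1
    · omega
    · omega
  by_cases hDq : D < q ∨ (nb T t).card = 1
  · by_cases hb : q - k ≤ D + 1
    · refine ⟨_, hon (q - k) hb, fun y hy hk => ?_⟩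
      rcases hmem y hy with h | h | h
      · omega
      · omega
      · have : T.dist u y = q - k := by omega
        exact this ▸ h.1.1
    · refine ⟨_, Win.of_subsingleton Set.subsingleton_empty, fun y hy hk => ?_⟩
      rcases hmem y hy with h | h | h <;> omega
  · by_cases hb : q + k ≤ D + 1
    · refine ⟨_, hon (q + k) hb, fun y hy hk => ?_⟩
      rcases hmem y hy with h | h | h
      · omega
      · omega
      · have : T.dist u y = q + k := by omega
        exact this ▸ h.1.1
    · refine ⟨_, Win.of_subsingleton Set.subsingleton_empty, fun y hy hk => ?_⟩
      rcases hmem y hy with h | h | h <;> omega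

/-- A vertex `w` together with candidates that are near `w` or off the branch of `c`: probe `c`. -/
theorem Win.insert_center (hT : T.IsTree) {w c s : V} (hwc : T.Adj w c) (hws : T.Adj w s)
    (hsc : s ≠ c) (hs : (nb T s).card ≤ 2) {n : ℕ} {X : Set V}
    (hR : ∀ D, Win T n (sph T w (((nb T w).erase s).erase c) D))
    (hX : ∀ x ∈ closedNbhd T X, x = w ∨ T.Adj w x ∨ (x ∉ branch T w c ∧ 2 ≤ T.dist w x))
    (hwin : ∀ k, 2 ≤ k → Win T (n + 1) {x ∈ closedNbhd T X | x ∉ branch T w c ∧ T.dist w x = k}) :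
    Win T (n + 2) ({w} ∪ X) := by
  have hmem : ∀ y ∈ closedNbhd T ({w} ∪ X), (y = c ∧ T.dist c y = 0) ∨ (y = w ∧ T.dist c y = 1) ∨
      (y ∈ ({s} ∪ (((nb T w).erase s).erase c : Finset V) : Set V) ∧ T.dist c y = 2) ∨
      ∃ k, 2 ≤ k ∧ y ∈ {x ∈ closedNbhd T X | x ∉ branch T w c ∧ T.dist w x = k} ∧
        T.dist c y = k + 1 := by
    have hadj : ∀ y, T.Adj w y → (y = c ∧ T.dist c y = 0) ∨
        (y ∈ ({s} ∪ (((nb T w).erase s).erase c : Finset V) : Set V) ∧ T.dist c y = 2) := by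
      intro y hy
      by_cases hyc : y = c
      · subst hyc
        exact Or.inl ⟨rfl, SimpleGraph.dist_self⟩
      refine Or.inr ⟨?_, ?_⟩
      · by_cases hys : y = s
        · exact Or.inl hys
        · exact Or.inr (by simp [hyc, hys, hy])
      · rw [dist_of_adj_branch hT hwc hy (Ne.symm hyc) (self_mem_branch hT hy),
          SimpleGraph.dist_eq_one_iff_adj.2 hy]
    intro y hy
    have hw : ∀ z, z = w → z = w ∧ T.dist c z = 1 := by
      rintro z rfl
      exact ⟨rfl, SimpleGraph.dist_eq_one_iff_adj.2 hwc.symm⟩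
    rcases mem_closedNbhd_union.1 hy with hy | hy
    · obtain ⟨x, rfl, rfl | hxy⟩ := mem_closedNbhd.1 hy
      · exact Or.inr (Or.inl (hw _ rfl))
      · exact (hadj y hxy).imp id fun h => Or.inr (Or.inl h)
    · rcases hX y hy with h | h | h
      · exact Or.inr (Or.inl (hw _ h))
      · exact (hadj y h).imp id fun h => Or.inr (Or.inl h)
      · exact Or.inr (Or.inr (Or.inr ⟨_, h.2, ⟨hy, h.1, rfl⟩, (notMem_branch_iff hT hwc).1 h.1⟩))
  refine Win.probe c fun k => ?_
  rcases k with _ | _ | _ | k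
  · refine ⟨_, Win.singleton c, fun y hy hk => ?_⟩
    rcases hmem y hy with h | h | h | ⟨m, h⟩
    · exact h.1
    all_goals omega
  · refine ⟨_, Win.singleton w, fun y hy hk => ?_⟩
    rcases hmem y hy with h | h | h | ⟨m, h⟩
    · omega
    · exact h.1
    all_goals omega
  · refine ⟨_, Win.insert_low hT hws hs ((erase_subset _ _).trans (erase_subset _ _)) (by simp)
      (hR 1) (hR 2), fun y hy hk => ?_⟩
    rcases hmem y hy with h | h | h | ⟨m, h⟩
    · omega
    · omega
    · exact h.1
    · omega
  · refine ⟨_, hwin (k + 2) (by omega), fun y hy hk => ?_⟩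
    rcases hmem y hy with h | h | h | ⟨m, h⟩
    · omega
    · omega
    · omega
    · obtain rfl : m = k + 2 := by omega
      exact h.2.1

/-- A vertex together with the other neighbors of one of its neighbors. -/
theorem Win.cluster (hT : T.IsTree) {w c e s : V} (hwc : T.Adj w c) (hwe : T.Adj w e)
    (hws : T.Adj w s) (hce : c ≠ e) (hsc : s ≠ c) (hse : s ≠ e) (hs : (nb T s).card ≤ 2) {n : ℕ}
    (hR : ∀ D, Win T n (sph T w (((nb T w).erase s).erase c) D)) :
    Win T (n + 2) ({w} ∪ (((nb T e).erase w : Finset V) : Set V)) := by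
  have hX : ∀ x ∈ closedNbhd T (((nb T e).erase w : Finset V) : Set V),
      x ∈ branch T w e := by
    intro x hx
    obtain ⟨z, hz, hzx⟩ := mem_closedNbhd.1 hx
    rw [mem_coe, mem_erase, mem_nb] at hz
    have hze : z ∈ branch T w e := branch_subset hT hwe hz.2 hz.1 (self_mem_branch hT hz.2)
    by_contra hxe
    rcases hzx with rfl | hzx
    · exact hxe hze
    · exact hz.2.ne' (eq_of_adj_of_mem_branch hT hwe hze hxe hzx).1
  have hsep : ∀ x ∈ branch T w e, x ∉ branch T w c := fun x hx hxc =>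
    hce (branch_unique hT hwc hwe hxc hx)
  refine Win.insert_center hT hwc hws hsc hs hR (fun x hx => ?_) fun k _ => ?_
  · have hxe := hX x hx
    by_cases hd : T.dist w x ≤ 1
    · rw [eq_of_mem_branch_of_dist_le_one hT hwe hxe hd]
      exact Or.inr (Or.inl hwe)
    · exact Or.inr (Or.inr ⟨hsep x hxe, by omega⟩)
  · refine ((hR k).mono (Nat.le_succ n)).anti fun x hx =>
      (⟨hx.2.2, e, ?_, hX x hx.1⟩ : x ∈ sph T w _ k)
    simp [hce.symm, hse.symm, hwe]

theorem Win.of_subset_branches (hT : T.IsTree) {w : V} {R : Finset V} (hR : R ⊆ nb T w) {n : ℕ}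
    (h : ∀ D, Win T n (sph T w R D)) {C : Set V} (hC : ∀ y ∈ C, ∃ c ∈ R, y ∈ branch T w c) :
    Win T (n + 1) C := by
  refine Win.probe w fun k => ?_
  rcases k with _ | k
  · refine ⟨_, Win.singleton w, fun y hy hk => ?_⟩
    exact ((hT.connected.dist_eq_zero_iff).1 hk).symm
  · refine ⟨_, h (k + 1), fun y hy hk => ?_⟩
    obtain ⟨x, hx, hxy⟩ := mem_closedNbhd.1 hy
    rcases mem_closedNbhd_branches hT hR (hC x hx) hxy with ⟨rfl, -⟩ | ⟨c, hc, -, hyc⟩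
    · simp at hk
    · exact ⟨hk, c, hc, hyc⟩

/-- One branch at distance `a + 1` against the others at distance `a - 1`: probe `c₂`. -/
theorem Win.two_levels (hT : T.IsTree) {w c₁ c₂ s : V} (hc₁ : T.Adj w c₁) (hc₂ : T.Adj w c₂)
    (hne : c₁ ≠ c₂) (hsc₁ : s ≠ c₁) (hsc₂ : s ≠ c₂) {n a : ℕ} (ha : 2 ≤ a)
    (hR₁ : ∀ D, Win T n (sph T w (((nb T w).erase s).erase c₁) D))
    (hR₂ : ∀ D, Win T n (sph T w (((nb T w).erase s).erase c₂) D))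
    (hcl : a = 2 → Win T n ({w} ∪ (((nb T c₂).erase w : Finset V) : Set V)))
    (hlev : 3 ≤ a → ∀ C : Set V,
      (∀ y ∈ C, ∃ c ∈ ((nb T w).erase s).erase c₁, y ∈ branch T w c) → Win T n C) :
    Win T (n + 1) (sph T w {c₁} (a + 1) ∪ sph T w (((nb T w).erase s).erase c₁) (a - 1)) := by
  set R := ((nb T w).erase s).erase c₁ with hR
  have hRs : R ⊆ nb T w := (erase_subset _ _).trans (erase_subset _ _)
  have hc₂R : c₂ ∈ R := by simp [hR, hne.symm, hsc₂.symm, hc₂]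
  have hmem : ∀ y ∈ closedNbhd T (sph T w {c₁} (a + 1) ∪ sph T w R (a - 1)),
      (y = w ∧ a = 2 ∧ T.dist c₂ y = 1) ∨
      (y ∈ branch T w c₂ ∧ a ≤ T.dist w y + 2 ∧ T.dist w y ≤ a ∧
        T.dist w y = T.dist c₂ y + 1) ∨
      (y ∈ branch T w c₁ ∧ a ≤ T.dist w y ∧ T.dist w y ≤ a + 2 ∧
        T.dist c₂ y = T.dist w y + 1) ∨
      ((∃ d ∈ R, d ≠ c₂ ∧ y ∈ branch T w d) ∧ 1 ≤ T.dist w y ∧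
        a ≤ T.dist w y + 2 ∧ T.dist w y ≤ a ∧ T.dist c₂ y = T.dist w y + 1) := by
    intro y hy
    rcases mem_closedNbhd_union.1 hy with hy | hy
    · rcases mem_closedNbhd_sph hT (by simpa using hc₁) hy with ⟨-, h⟩ | ⟨c, hc, hyc, h1, h2⟩
      · omega
      · rw [mem_singleton] at hc
        subst hc
        exact Or.inr (Or.inr (Or.inl ⟨hyc, by omega, by omega,
          dist_of_adj_branch hT hc₂ hc₁ hne.symm hyc⟩))
    · rcases mem_closedNbhd_sph hT hRs hy with ⟨rfl, h⟩ | ⟨c, hc, hyc, h1, h2⟩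
      · exact Or.inl ⟨rfl, by omega, SimpleGraph.dist_eq_one_iff_adj.2 hc₂.symm⟩
      · by_cases hcc : c = c₂
        · subst hcc
          exact Or.inr (Or.inl ⟨hyc, by omega, by omega, (mem_branch_iff hT hc₂).1 hyc⟩)
        · exact Or.inr (Or.inr (Or.inr ⟨⟨c, hc, hcc, hyc⟩, one_le_dist w hyc, by omega,
            by omega, dist_of_adj_branch hT hc₂ (mem_nb.1 (hRs hc)) (Ne.symm hcc) hyc⟩))
  refine Win.probe c₂ fun k => ?_
  by_cases hk1 : k + 2 ≤ a
  · refine ⟨_, hR₁ (k + 1), fun y hy hk => ?_⟩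
    rcases hmem y hy with h | h | h | h
    · omega
    · exact ⟨by omega, c₂, hc₂R, h.1⟩
    · omega
    · omega
  by_cases hk2 : a ≤ k
  · refine ⟨_, hR₂ (k - 1), fun y hy hk => ?_⟩
    rcases hmem y hy with h | h | h | h
    · omega
    · omega
    · exact ⟨by omega, c₁, by simp [hne, hsc₁.symm, hc₁], h.1⟩
    · obtain ⟨⟨d, hd, hdc, hyd⟩, h⟩ := h
      refine ⟨by omega, d, ?_, hyd⟩
      simp only [hR, mem_erase] at hd ⊢
      exact ⟨hdc, hd.2⟩
  by_cases ha2 : a = 2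
  · refine ⟨_, hcl ha2, fun y hy hk => ?_⟩
    rcases hmem y hy with h | h | h | h
    · exact Or.inl h.1
    · refine Or.inr ?_
      have : T.dist c₂ y = 1 := by omega
      rw [SimpleGraph.dist_eq_one_iff_adj] at this
      simp only [mem_coe, mem_erase, mem_nb]
      refine ⟨?_, this⟩
      rintro rfl
      exact self_notMem_branch _ _ h.1
    · omega
    · omega
  · refine ⟨_, hlev (by omega) {y ∈ closedNbhd T (sph T w {c₁} (a + 1) ∪ sph T w R (a - 1)) |
      T.dist c₂ y = k} (fun y hy => ?_), fun y hy hk => ⟨hy, hk⟩⟩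
    obtain ⟨hy, hk⟩ := hy
    rcases hmem y hy with h | h | h | h
    · omega
    · exact ⟨c₂, hc₂R, h.1⟩
    · omega
    · obtain ⟨⟨d, hd, -, hyd⟩, -⟩ := h
      exact ⟨d, hd, hyd⟩

/-- All branches but that of `s` at distance `a`, and some far candidates in the branch of `s`. -/
theorem Win.sph_union (hT : T.IsTree) {w c s : V} (hwc : T.Adj w c) (hws : T.Adj w s)
    (hsc : s ≠ c) {n a : ℕ} (ha : 1 ≤ a) {Z : Set V}
    (hZ : ∀ z ∈ closedNbhd T Z, z ∈ branch T w s ∧ a + 3 ≤ T.dist w z)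
    (hZw : ∀ k, Win T n {z ∈ closedNbhd T Z | T.dist w z = k})
    (hR : ∀ D, Win T n (sph T w (((nb T w).erase s).erase c) D))
    (hc : ∀ D, Win T n (sph T w {c} D))
    (hcl : a = 1 → Win T n ({w} ∪ (((nb T c).erase w : Finset V) : Set V)))
    (hlev : 2 ≤ a →
      Win T n (sph T w {c} (a + 1) ∪ sph T w (((nb T w).erase s).erase c) (a - 1))) :
    Win T (n + 1) (sph T w ((nb T w).erase s) a ∪ Z) := by
  set R := ((nb T w).erase s).erase c with hRdef
  have hRs : R ⊆ nb T w := (erase_subset _ _).trans (erase_subset _ _)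
  have hmem : ∀ y ∈ closedNbhd T (sph T w ((nb T w).erase s) a ∪ Z),
      (y = w ∧ a = 1 ∧ T.dist c y = 1) ∨
      (y ∈ branch T w c ∧ a ≤ T.dist w y + 1 ∧ T.dist w y ≤ a + 1 ∧
        T.dist w y = T.dist c y + 1) ∨
      ((∃ d ∈ R, y ∈ branch T w d) ∧ 1 ≤ T.dist w y ∧
        a ≤ T.dist w y + 1 ∧ T.dist w y ≤ a + 1 ∧ T.dist c y = T.dist w y + 1) ∨
      (y ∈ closedNbhd T Z ∧ a + 3 ≤ T.dist w y ∧ T.dist c y = T.dist w y + 1) := by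
    intro y hy
    rcases mem_closedNbhd_union.1 hy with hy | hy
    · rcases mem_closedNbhd_sph hT (erase_subset _ _) hy with ⟨rfl, h⟩ | ⟨e, he, hye, h1, h2⟩
      · exact Or.inl ⟨rfl, h, SimpleGraph.dist_eq_one_iff_adj.2 hwc.symm⟩
      · by_cases hec : e = c
        · subst hec
          exact Or.inr (Or.inl ⟨hye, by omega, by omega, (mem_branch_iff hT hwc).1 hye⟩)
        · have heR : e ∈ R := mem_erase.2 ⟨hec, he⟩
          exact Or.inr (Or.inr (Or.inl ⟨⟨e, heR, hye⟩, one_le_dist w hye, by omega,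
            by omega, dist_of_adj_branch hT hwc (mem_nb.1 (hRs heR)) (Ne.symm hec) hye⟩))
    · have h := hZ y hy
      exact Or.inr (Or.inr (Or.inr ⟨hy, h.2, dist_of_adj_branch hT hwc hws hsc.symm h.1⟩))
  refine Win.probe c fun k => ?_
  by_cases hk1 : k < a
  · refine ⟨_, hc (k + 1), fun y hy hk => ?_⟩
    rcases hmem y hy with h | h | h | h
    · omega
    · exact ⟨by omega, c, mem_singleton_self c, h.1⟩
    · omega
    · omega
  by_cases hk2 : k = a
  · by_cases ha1 : a = 1
    · refine ⟨_, hcl ha1, fun y hy hk => ?_⟩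
      rcases hmem y hy with h | h | h | h
      · exact Or.inl h.1
      · refine Or.inr ?_
        have : T.dist c y = 1 := by omega
        rw [SimpleGraph.dist_eq_one_iff_adj] at this
        simp only [mem_coe, mem_erase, mem_nb]
        refine ⟨?_, this⟩
        rintro rfl
        exact self_notMem_branch _ _ h.1
      · omega
      · omega
    · refine ⟨_, hlev (by omega), fun y hy hk => ?_⟩
      rcases hmem y hy with h | h | h | h
      · omega
      · exact Or.inl ⟨by omega, c, mem_singleton_self c, h.1⟩
      · exact Or.inr ⟨by omega, h.1⟩
      · omega
  by_cases hk3 : k ≤ a + 2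
  · refine ⟨_, hR (k - 1), fun y hy hk => ?_⟩
    rcases hmem y hy with h | h | h | h
    · omega
    · omega
    · exact ⟨by omega, h.1⟩
    · omega
  · refine ⟨_, hZw (k - 1), fun y hy hk => ?_⟩
    rcases hmem y hy with h | h | h | h
    · omega
    · omega
    · omega
    · exact ⟨h.1, by omega⟩

/-- The case of `Win.sph_union` where `c` carries just two paths and `a = 2`: probe the end of
one of these paths. -/
theorem Win.sph_union_two_paths (hT : T.IsTree) {w c s x z sx tx sz tz : V} {qx qz : ℕ}
    (hwc : T.Adj w c) (hws : T.Adj w s) (hsc : s ≠ c)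
    (hcx : T.Adj c x) (hcz : T.Adj c z) (hxz : x ≠ z) (hc : (nb T c).erase w = {x, z})
    (Hx : Chain T c x qx sx tx) (Hz : Chain T c z qz sz tz)
    (hx : (nb T tx).card = 1) (hz : (nb T tz).card = 1)
    {n : ℕ} {Z : Set V}
    (hZ : ∀ y ∈ closedNbhd T Z, y ∈ branch T w s ∧ 5 ≤ T.dist w y)
    (hZw : ∀ k, Win T (n + 1) {y ∈ closedNbhd T Z | T.dist w y = k})
    (hR : ∀ D, Win T n (sph T w (((nb T w).erase s).erase c) D)) :
    Win T (n + 2) (sph T w ((nb T w).erase s) 2 ∪ Z) := by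
  set R := ((nb T w).erase s).erase c with hRdef
  have hRs : R ⊆ nb T w := (erase_subset _ _).trans (erase_subset _ _)
  have hwx : w ≠ x ∧ w ≠ z := by
    have h1 : x ∈ (nb T c).erase w := by simp [hc]
    have h2 : z ∈ (nb T c).erase w := by simp [hc]
    exact ⟨(ne_of_mem_erase h1).symm, (ne_of_mem_erase h2).symm⟩
  have offx : ∀ y ∉ branch T w c, T.dist tx y = qx + 1 + T.dist w y := by
    intro y hy
    have h := (notMem_branch_iff hT hwc).1 hy
    rw [Hx.dist_off hT hcx, h]
    · ring
    · exact fun h' => hy (branch_subset hT hwc hcx hwx.1.symm h')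
  have offz : ∀ y ∉ branch T w c, T.dist tz y = qz + 1 + T.dist w y := by
    intro y hy
    have h := (notMem_branch_iff hT hwc).1 hy
    rw [Hz.dist_off hT hcz, h]
    · ring
    · exact fun h' => hy (branch_subset hT hwc hcz hwx.2.symm h')
  have sep : ∀ {d y}, T.Adj w d → d ≠ c → y ∈ branch T w d → y ∉ branch T w c :=
    fun hd hdc hy hyc => hdc (branch_unique hT hd hwc hy hyc)
  have sepR : ∀ {y}, (∃ d ∈ R, y ∈ branch T w d) → y ∉ branch T w c := by
    rintro y ⟨d, hd, hyd⟩
    exact sep (mem_nb.1 (hRs hd)) (ne_of_mem_erase hd) hyd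
  have hmem : ∀ y ∈ closedNbhd T (sph T w ((nb T w).erase s) 2 ∪ Z),
      (y = c ∧ T.dist tx y = qx) ∨
      (y ∈ branch T c x ∧ 1 ≤ T.dist c y ∧ T.dist tx y + T.dist c y = qx) ∨
      (y ∈ branch T c z ∧ 1 ≤ T.dist c y ∧ T.dist c y ≤ 2 ∧ T.dist tx y = qx + T.dist c y) ∨
      ((∃ d ∈ R, y ∈ branch T w d) ∧ 1 ≤ T.dist w y ∧ T.dist w y ≤ 3 ∧
        T.dist tx y = qx + 1 + T.dist w y) ∨
      (y ∈ closedNbhd T Z ∧ 5 ≤ T.dist w y ∧ T.dist tx y = qx + 1 + T.dist w y) := by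
    intro y hy
    rcases mem_closedNbhd_union.1 hy with hy | hy
    · rcases mem_closedNbhd_sph hT (erase_subset _ _) hy with ⟨rfl, h⟩ | ⟨e, he, hye, h1, h2⟩
      · omega
      · by_cases hec : e = c
        · subst hec
          have hd := (mem_branch_iff hT hwc).1 hye
          by_cases hyc : y = e
          · subst hyc
            refine Or.inl ⟨rfl, ?_⟩
            rw [Hx.dist_off hT hcx (self_notMem_branch _ _), SimpleGraph.dist_self, add_zero]
          obtain ⟨f, hf, hfw, hyf⟩ := exists_child_of_mem_branch hT hwc hye hyc
          have hf' : f ∈ (nb T e).erase w := by simp [hf, hfw]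
          have hpos := one_le_dist e hyf
          rw [hc, mem_insert, mem_singleton] at hf'
          rcases hf' with rfl | rfl
          · exact Or.inr (Or.inl ⟨hyf, hpos, Hx.dist_of_leaf hT hx hyf⟩)
          · refine Or.inr (Or.inr (Or.inl ⟨hyf, hpos, by omega, Hx.dist_off hT hcx fun h' => ?_⟩))
            exact hxz (branch_unique hT hcx hcz h' hyf)
        · have heR : ∃ d ∈ R, y ∈ branch T w d := ⟨e, mem_erase.2 ⟨hec, he⟩, hye⟩
          exact Or.inr (Or.inr (Or.inr (Or.inl ⟨heR, one_le_dist w hye, by omega,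
            offx y (sepR heR)⟩)))
    · have h := hZ y hy
      exact Or.inr (Or.inr (Or.inr (Or.inr ⟨hy, h.2, offx y (sep hws hsc h.1)⟩)))
  have hmid : Win T (n + 1) ((R : Set V) ∪ sph T c {z} 2) := by
    have hmem' : ∀ y ∈ closedNbhd T ((R : Set V) ∪ sph T c {z} 2),
        (y = w ∧ T.dist tz y = qz + 1) ∨
        ((∃ d ∈ R, y ∈ branch T w d) ∧ 1 ≤ T.dist w y ∧ T.dist tz y = qz + 1 + T.dist w y) ∨
        (y ∈ sph T c {z} (T.dist c y) ∧ 1 ≤ T.dist c y ∧ T.dist tz y + T.dist c y = qz) := by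
      intro y hy
      rcases mem_closedNbhd_union.1 hy with hy | hy
      · have hy' := closedNbhd_mono (coe_subset_sph hT hRs) hy
        rcases mem_closedNbhd_sph hT hRs hy' with ⟨rfl, -⟩ | ⟨e, he, hye, -, -⟩
        · refine Or.inl ⟨rfl, ?_⟩
          rw [offz _ (self_notMem_branch _ _), SimpleGraph.dist_self, add_zero]
        · exact Or.inr (Or.inl ⟨⟨e, he, hye⟩, one_le_dist w hye, offz y (sepR ⟨e, he, hye⟩)⟩)
      · rcases mem_closedNbhd_sph hT (by simpa using hcz) hy with ⟨-, h⟩ | ⟨e, he, hye, -, -⟩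
        · omega
        · rw [mem_singleton] at he
          subst he
          exact Or.inr (Or.inr ⟨⟨rfl, e, mem_singleton_self e, hye⟩, one_le_dist c hye,
            Hz.dist_of_leaf hT hz hye⟩)
    refine Win.probe tz fun k => ?_
    by_cases hk1 : k ≤ qz
    · refine ⟨_, Win.of_subsingleton (Hz.subsingleton (Nat.sub_le qz k)), fun y hy hk => ?_⟩
      rcases hmem' y hy with h | h | h
      · omega
      · omega
      · have : T.dist c y = qz - k := by omega
        exact this ▸ h.1
    by_cases hk2 : k = qz + 1
    · refine ⟨_, Win.singleton w, fun y hy hk => ?_⟩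
      rcases hmem' y hy with h | h | h
      · exact h.1
      · omega
      · omega
    · refine ⟨_, hR (k - (qz + 1)), fun y hy hk => ?_⟩
      rcases hmem' y hy with h | h | h
      · omega
      · exact ⟨by omega, h.1⟩
      · omega
  refine Win.probe tx fun k => ?_
  by_cases hk1 : k < qx
  · refine ⟨_, Win.of_subsingleton (Hx.subsingleton (Nat.sub_le qx k)), fun y hy hk => ?_⟩
    rcases hmem y hy with h | h | h | h | h
    · omega
    · exact ⟨by omega, x, mem_singleton_self x, h.1⟩
    all_goals omega
  by_cases hk2 : k = qx
  · refine ⟨_, Win.singleton c, fun y hy hk => ?_⟩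
    rcases hmem y hy with h | h | h | h | h
    · exact h.1
    all_goals omega
  by_cases hk3 : k = qx + 1
  · refine ⟨_, Win.of_subsingleton (Hz.subsingleton Hz.pos), fun y hy hk => ?_⟩
    rcases hmem y hy with h | h | h | h | h
    · omega
    · omega
    · exact ⟨by omega, z, mem_singleton_self z, h.1⟩
    all_goals omega
  by_cases hk4 : k = qx + 2
  · refine ⟨_, hmid, fun y hy hk => ?_⟩
    rcases hmem y hy with h | h | h | h | h
    · omega
    · omega
    · exact Or.inr ⟨by omega, z, mem_singleton_self z, h.1⟩
    · obtain ⟨⟨d, hd, hyd⟩, h⟩ := h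
      refine Or.inl ?_
      rw [eq_of_mem_branch_of_dist_le_one hT (mem_nb.1 (hRs hd)) hyd (by omega)]
      exact hd
    · omega
  by_cases hk5 : k ≤ qx + 4
  · refine ⟨_, (hR (k - (qx + 1))).mono (Nat.le_succ n), fun y hy hk => ?_⟩
    rcases hmem y hy with h | h | h | h | h
    · omega
    · omega
    · omega
    · exact ⟨by omega, h.1⟩
    · omega
  · refine ⟨_, hZw (k - (qx + 1)), fun y hy hk => ?_⟩
    rcases hmem y hy with h | h | h | h | h
    · omega
    · omega
    · omega
    · omega
    · exact ⟨h.1, by omega⟩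

end Strategies

section Induction

variable {V : Type*} [Fintype V] {T : SimpleGraph V}

/-- The members of `M` of degree at least three. -/
noncomputable def high (T : SimpleGraph V) (M : Finset V) : Finset V :=
  M.filter fun c => 3 ≤ (nb T c).card

/-- The number of leaves in the branches at `u` towards `M`. -/
noncomputable def weight (T : SimpleGraph V) (u : V) (M : Finset V) : ℕ :=
  ∑ c ∈ M, branchLeaves T u c

/-- Spheres in an incomplete family of branches of weight `n`, at most one of them rooted at a
high vertex, are won in `n - 1` rounds. -/
def IncompleteWin (T : SimpleGraph V) (n : ℕ) : Prop :=
  ∀ u M p D, M ⊆ nb T u → p ∈ nb T u → p ∉ M → 2 ≤ M.card → (high T M).card ≤ 1 →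
    weight T u M = n → Win T (n - 1) (sph T u M D)

/-- Spheres in all branches but one, of weight `n`, are won in `n` rounds. -/
def CompleteWin (T : SimpleGraph V) (n : ℕ) : Prop :=
  ∀ u p D, p ∈ nb T u → 2 ≤ ((nb T u).erase p).card → weight T u ((nb T u).erase p) = n →
    Win T n (sph T u ((nb T u).erase p) D)

/-- The path from `u` through `c` leads to a vertex with two high vertices behind it. -/
def LeadsToTwoHigh (T : SimpleGraph V) (u c : V) : Prop :=
  ∃ q s t, Chain T u c q s t ∧ 2 ≤ (high T ((nb T t).erase s)).card

theorem weight_erase {u c : V} {M : Finset V} (hc : c ∈ M) :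
    weight T u (M.erase c) + branchLeaves T u c = weight T u M :=
  Finset.sum_erase_add _ _ hc

theorem card_le_weight (hT : T.IsTree) {u : V} {M : Finset V} (hM : M ⊆ nb T u) :
    M.card ≤ weight T u M := card_le_sum_branchLeaves hT hM

theorem high_mono {M M' : Finset V} (h : M ⊆ M') : (high T M).card ≤ (high T M').card :=
  Finset.card_le_card (Finset.filter_subset_filter _ h)

theorem Chain.exit (hT : T.IsTree) {u c s t : V} {q : ℕ} (H : Chain T u c q s t) :
    s ∈ nb T t ∧ ((nb T t).erase s).card + 1 = (nb T t).card ∧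
      ((nb T t).card ≠ 1 → 2 ≤ ((nb T t).erase s).card ∧
        weight T t ((nb T t).erase s) = branchLeaves T u c) := by
  have hs : s ∈ nb T t := mem_nb.2 H.adj.symm
  have h1 := Finset.card_erase_add_one hs
  have h2 := H.card_ne
  refine ⟨hs, h1, fun h => ⟨by omega, ?_⟩⟩
  rw [← H.leaves, branchLeaves_eq_sum hT H.adj h, weight]

theorem Chain.sph_subset (hT : T.IsTree) {u c s t : V} {q D : ℕ} (H : Chain T u c q s t)
    (hD : q < D) : sph T u {c} D ⊆ sph T t ((nb T t).erase s) (D - q) := by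
  rintro y ⟨hy, e, he, hye⟩
  rw [mem_singleton] at he
  subst he
  have hyt : y ∈ branch T s t := by
    by_contra h
    have := H.near y hye h
    omega
  have hfar := H.far y hyt
  have hne : y ≠ t := by
    rintro rfl
    rw [SimpleGraph.dist_self] at hfar
    omega
  obtain ⟨f, hf, hfs, hyf⟩ := exists_child_of_mem_branch hT H.adj hyt hne
  exact ⟨by omega, f, by simp [hf, hfs], hyf⟩

theorem win_single_of (hT : T.IsTree) {u c s t : V} {q n : ℕ} (H : Chain T u c q s t)
    (h : (nb T t).card ≠ 1 → ∀ D, Win T n (sph T t ((nb T t).erase s) D)) (D : ℕ) :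
    Win T n (sph T u {c} D) := by
  by_cases hD : D ≤ q
  · exact Win.of_subsingleton (H.subsingleton hD)
  by_cases ht : (nb T t).card = 1
  · refine Win.of_subsingleton fun y hy => ?_
    have hd := hy.1
    obtain ⟨-, e, he, hye⟩ := hy
    rw [mem_singleton] at he
    subst he
    have := H.dist_of_leaf hT ht hye
    omega
  · exact (h ht (D - q)).anti (H.sph_subset hT (by omega))

theorem win_single_complete (hT : T.IsTree) {u c : V} (huc : T.Adj u c)
    (hc : CompleteWin T (branchLeaves T u c)) (D : ℕ) :
    Win T (branchLeaves T u c) (sph T u {c} D) := by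
  obtain ⟨q, s, t, H⟩ := exists_chain hT huc
  obtain ⟨h1, -, h2⟩ := H.exit hT
  exact win_single_of hT H (fun ht D => hc t s D h1 (h2 ht).1 (h2 ht).2) D

theorem win_single_incomplete (hT : T.IsTree) {u c : V} (huc : T.Adj u c)
    (hc : IncompleteWin T (branchLeaves T u c)) (hlow : ¬ LeadsToTwoHigh T u c) (D : ℕ) :
    Win T (branchLeaves T u c - 1) (sph T u {c} D) := by
  obtain ⟨q, s, t, H⟩ := exists_chain hT huc
  obtain ⟨h1, -, h2⟩ := H.exit hT
  refine win_single_of hT H (fun ht D => hc t _ s D (erase_subset _ _) h1 (notMem_erase _ _)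
    (h2 ht).1 ?_ (h2 ht).2) D
  by_contra! h
  exact hlow ⟨q, s, t, H, h⟩

/-- Incomplete families with at most one high root. -/
theorem win_incomplete (hT : T.IsTree) {n : ℕ} (hinc : ∀ m ≤ n, IncompleteWin T m)
    {u p : V} {M : Finset V} (hM : M ⊆ nb T u) (hp : p ∈ nb T u) (hpM : p ∉ M)
    (hhigh : (high T M).card ≤ 1) (hne : M.Nonempty) (hlow : ∀ c, M = {c} → ¬ LeadsToTwoHigh T u c)
    (hn : weight T u M ≤ n) (D : ℕ) : Win T (weight T u M - 1) (sph T u M D) := by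
  by_cases h2 : 2 ≤ M.card
  · exact hinc _ hn u M p D hM hp hpM h2 hhigh rfl
  obtain ⟨c, rfl⟩ : ∃ c, M = {c} := by
    rw [← Finset.card_eq_one]
    have := hne.card_pos
    omega
  have hw : weight T u {c} = branchLeaves T u c := Finset.sum_singleton _ _
  rw [hw] at hn ⊢
  exact win_single_incomplete hT (mem_nb.1 (hM (mem_singleton_self c))) (hinc _ hn)
    (hlow c rfl) D

theorem win_le (hT : T.IsTree) {n : ℕ} (hinc : ∀ m ≤ n, IncompleteWin T m)
    (hcom : ∀ m ≤ n, CompleteWin T m) {u p : V} {M : Finset V} (hM : M ⊆ nb T u)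
    (hp : p ∈ nb T u) (hpM : p ∉ M) (hhigh : (high T M).card ≤ 1) (hn : weight T u M ≤ n)
    (D : ℕ) : Win T (weight T u M) (sph T u M D) := by
  by_cases h2 : 2 ≤ M.card
  · exact (hinc _ hn u M p D hM hp hpM h2 hhigh rfl).mono (Nat.sub_le _ _)
  rcases M.eq_empty_or_nonempty with rfl | hne
  · rw [sph_empty]
    exact Win.of_subsingleton Set.subsingleton_empty
  obtain ⟨c, rfl⟩ : ∃ c, M = {c} := by
    rw [← Finset.card_eq_one]
    have := hne.card_pos
    omega
  have hw : weight T u {c} = branchLeaves T u c := Finset.sum_singleton _ _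
  rw [hw] at hn ⊢
  exact win_single_complete hT (mem_nb.1 (hM (mem_singleton_self c))) (hcom _ hn) D

theorem card_high_erase {M : Finset V} {c : V} (hc : c ∈ M) (h : 3 ≤ (nb T c).card) :
    (high T (M.erase c)).card + 1 = (high T M).card := by
  have : high T (M.erase c) = (high T M).erase c := by
    ext x
    simp [high, and_assoc]
  rw [this, Finset.card_erase_add_one]
  simp [high, hc, h]

/-- Behind a high vertex next to a high vertex there is at most one more. -/
theorem not_leadsToTwoHigh (hh : ∀ u, (high T (nb T u)).card ≤ 2) {u c : V} (huc : T.Adj u c)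
    (hu : 3 ≤ (nb T u).card) (hc : 3 ≤ (nb T c).card) : ¬ LeadsToTwoHigh T u c := by
  rintro ⟨q, s, t, H, h⟩
  obtain hq | hq : q = 1 ∨ 2 ≤ q := by
    have := H.pos
    omega
  · obtain ⟨rfl, rfl⟩ := H.eq_of_one hq
    have h1 := card_high_erase (mem_nb.2 huc.symm) hu
    have h2 := hh t
    omega
  · have := (H.card_of_two hq).1
    omega

theorem exists_two_high (hh : ∀ u, (high T (nb T u)).card ≤ 2) {w s : V} (hs : s ∈ nb T w)
    (h2 : 2 ≤ (high T ((nb T w).erase s)).card) :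
    ∃ c₁ c₂, T.Adj w c₁ ∧ T.Adj w c₂ ∧ c₁ ≠ c₂ ∧ s ≠ c₁ ∧ s ≠ c₂ ∧ 3 ≤ (nb T c₁).card ∧
      3 ≤ (nb T c₂).card ∧ 3 ≤ (nb T w).card ∧ (nb T s).card ≤ 2 := by
  obtain ⟨c₁, h₁, c₂, h₂, hne⟩ := Finset.one_lt_card.1 h2
  simp only [high, mem_filter, mem_erase, mem_nb] at h₁ h₂
  refine ⟨c₁, c₂, h₁.1.2, h₂.1.2, hne, h₁.1.1.symm, h₂.1.1.symm, h₁.2, h₂.2, ?_, ?_⟩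
  · have h1 : 2 ≤ ((nb T w).erase s).card := h2.trans (Finset.card_filter_le _ _)
    have h3 := Finset.card_erase_add_one hs
    omega
  · by_contra! h
    have h1 := card_high_erase hs h
    have h3 := hh w
    omega

/-- The branches at `w` other than those of `s` and of one of two high neighbors. -/
theorem win_rest (hT : T.IsTree) (hh : ∀ u, (high T (nb T u)).card ≤ 2) {w s c e : V}
    (hs : s ∈ nb T w) (hw : 3 ≤ (nb T w).card) (hwc : T.Adj w c) (hwe : T.Adj w e) (hce : c ≠ e)
    (hsc : s ≠ c) (hse : s ≠ e) (hc : 3 ≤ (nb T c).card) (he : 3 ≤ (nb T e).card)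
    (hinc : ∀ m < weight T w ((nb T w).erase s), IncompleteWin T m) :
    2 ≤ branchLeaves T w c ∧ 2 ≤ weight T w (((nb T w).erase s).erase c) ∧
      weight T w (((nb T w).erase s).erase c) + branchLeaves T w c =
        weight T w ((nb T w).erase s) ∧
      ∀ n D, weight T w (((nb T w).erase s).erase c) ≤ n + 1 →
        Win T n (sph T w (((nb T w).erase s).erase c) D) := by
  have hcM : c ∈ (nb T w).erase s := by simp [hwc, hsc.symm]
  have heR : e ∈ ((nb T w).erase s).erase c := by simp [hwe, hse.symm, hce.symm]
  have h1 := two_le_branchLeaves hT hwc hc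
  have h2 := two_le_branchLeaves hT hwe he
  have h3 := weight_erase (T := T) (u := w) hcM
  have h4 := weight_erase (T := T) (u := w) heR
  refine ⟨h1, by omega, h3, fun n D hn => ?_⟩
  refine (win_incomplete hT (n := weight T w (((nb T w).erase s).erase c))
    (fun m hm => hinc m (by omega)) ((erase_subset _ _).trans (erase_subset _ _)) hs (by simp) ?_
    ⟨e, heR⟩ ?_ le_rfl D).mono (by omega)
  · have h5 := card_high_erase hcM hc
    have h6 := hh w
    have h7 := high_mono (T := T) (erase_subset s (nb T w))
    omega
  · intro x hx
    rw [hx, mem_singleton] at heR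
    subst heR
    exact not_leadsToTwoHigh hh hwe hw he

theorem Chain.leaf_of_branchLeaves (hT : T.IsTree) {u c s t : V} {q : ℕ} (H : Chain T u c q s t)
    (h : branchLeaves T u c = 1) : (nb T t).card = 1 := by
  by_contra ht
  obtain ⟨-, -, h2⟩ := H.exit hT
  have h3 := card_le_weight hT (erase_subset s (nb T t))
  have := h2 ht
  omega

theorem win_two_high (hT : T.IsTree) (hh : ∀ u, (high T (nb T u)).card ≤ 2) {w s : V}
    (hs : s ∈ nb T w) (h2 : 2 ≤ (high T ((nb T w).erase s)).card)
    (hinc : ∀ m < weight T w ((nb T w).erase s), IncompleteWin T m)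
    (hcom : ∀ m < weight T w ((nb T w).erase s), CompleteWin T m) {n a : ℕ}
    (hn : weight T w ((nb T w).erase s) ≤ n + 1) (ha : 1 ≤ a) {Z : Set V}
    (hZ : ∀ z ∈ closedNbhd T Z, z ∈ branch T w s ∧ a + 3 ≤ T.dist w z)
    (hZw : ∀ k, Win T n {z ∈ closedNbhd T Z | T.dist w z = k}) :
    Win T (n + 1) (sph T w ((nb T w).erase s) a ∪ Z) := by
  obtain ⟨c₁, c₂, hc₁, hc₂, hne, hsc₁, hsc₂, h3c₁, h3c₂, hw, hlow⟩ := exists_two_high hh hs h2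
  obtain ⟨l₁, w₁, e₁, hR₁⟩ := win_rest hT hh hs hw hc₁ hc₂ hne hsc₁ hsc₂ h3c₁ h3c₂ hinc
  obtain ⟨l₂, w₂, e₂, hR₂⟩ := win_rest hT hh hs hw hc₂ hc₁ hne.symm hsc₂ hsc₁ h3c₂ h3c₁ hinc
  have hws : T.Adj w s := mem_nb.1 hs
  by_cases hsp : a = 2 ∧ branchLeaves T w c₁ = 2
  · obtain ⟨rfl, hl⟩ := hsp
    have hwn : w ∈ nb T c₁ := mem_nb.2 hc₁.symm
    have hsum : weight T c₁ ((nb T c₁).erase w) = 2 := by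
      rw [weight, ← branchLeaves_eq_sum hT hc₁ (by omega), hl]
    have hle := card_le_weight hT (erase_subset w (nb T c₁))
    have hcard := Finset.card_erase_add_one hwn
    obtain ⟨x, z, hxz, hM⟩ := Finset.card_eq_two.1 (by omega : ((nb T c₁).erase w).card = 2)
    have hx : T.Adj c₁ x := by
      have : x ∈ (nb T c₁).erase w := by simp [hM]
      exact mem_nb.1 (mem_of_mem_erase this)
    have hz : T.Adj c₁ z := by
      have : z ∈ (nb T c₁).erase w := by simp [hM]
      exact mem_nb.1 (mem_of_mem_erase this)
    have px := branchLeaves_pos hT hx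
    have pz := branchLeaves_pos hT hz
    rw [weight, hM, Finset.sum_pair hxz] at hsum
    obtain ⟨qx, sx, tx, Hx⟩ := exists_chain hT hx
    obtain ⟨qz, sz, tz, Hz⟩ := exists_chain hT hz
    obtain ⟨m, rfl⟩ : ∃ m, n = m + 1 := ⟨n - 1, by omega⟩
    exact Win.sph_union_two_paths hT hc₁ hws hsc₁ hx hz hxz hM Hx Hz
      (Hx.leaf_of_branchLeaves hT (by omega)) (Hz.leaf_of_branchLeaves hT (by omega)) hZ hZw
      fun D => hR₁ m D (by omega)
  · refine Win.sph_union hT hc₁ hws hsc₁ ha hZ hZw (fun D => hR₁ n D (by omega)) (fun D => ?_)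
      (fun _ => ?_) fun ha2 => ?_
    · exact (win_single_complete hT hc₁ (hcom _ (by omega)) D).mono (by omega)
    · exact (Win.cluster hT hc₂ hc₁ hws hne.symm hsc₂ hsc₁ hlow (n := n - 2)
        fun D => hR₂ _ D (by omega)).mono (by omega)
    · obtain ⟨m, rfl⟩ : ∃ m, n = m + 1 := ⟨n - 1, by omega⟩
      refine Win.two_levels hT hc₁ hc₂ hne hsc₁ hsc₂ ha2 (fun D => hR₁ m D (by omega))
        (fun D => hR₂ m D (by omega)) (fun ha3 => ?_) fun _ C hC => ?_
      · have : branchLeaves T w c₁ ≠ 2 := fun h => hsp ⟨ha3, h⟩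
        exact (Win.cluster hT hc₁ hc₂ hws hne hsc₁ hsc₂ hlow (n := m - 2)
          fun D => hR₁ _ D (by omega)).mono (by omega)
      · exact (Win.of_subset_branches hT ((erase_subset _ _).trans (erase_subset _ _))
          (n := m - 1) (fun D => hR₁ _ D (by omega)) hC).mono (by omega)

theorem win_two_high_center (hT : T.IsTree) (hh : ∀ u, (high T (nb T u)).card ≤ 2) {w s : V}
    (hs : s ∈ nb T w) (h2 : 2 ≤ (high T ((nb T w).erase s)).card)
    (hinc : ∀ m < weight T w ((nb T w).erase s), IncompleteWin T m) {n : ℕ}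
    (hn : weight T w ((nb T w).erase s) ≤ n + 1) {Z : Set V}
    (hZ : ∀ z ∈ closedNbhd T Z, z ∈ branch T w s ∧ 2 ≤ T.dist w z)
    (hZw : ∀ k, Win T n {z ∈ closedNbhd T Z | T.dist w z = k}) :
    Win T (n + 1) ({w} ∪ Z) := by
  obtain ⟨c₁, c₂, hc₁, hc₂, hne, hsc₁, hsc₂, h3c₁, h3c₂, hw, hlow⟩ := exists_two_high hh hs h2
  obtain ⟨l₁, w₁, e₁, hR₁⟩ := win_rest hT hh hs hw hc₁ hc₂ hne hsc₁ hsc₂ h3c₁ h3c₂ hinc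
  obtain ⟨m, rfl⟩ : ∃ m, n = m + 1 := ⟨n - 1, by omega⟩
  refine Win.insert_center hT hc₁ (mem_nb.1 hs) hsc₁ hlow (fun D => hR₁ m D (by omega))
    (fun x hx => Or.inr (Or.inr ⟨fun hxc => ?_, (hZ x hx).2⟩)) fun k _ => ?_
  · exact hsc₁ (branch_unique hT (mem_nb.1 hs) hc₁ (hZ x hx).1 hxc)
  · refine (hZw k).anti ?_
    rintro x ⟨hx, -, hxk⟩
    exact ⟨hx, hxk⟩

theorem win_leadsToTwoHigh (hT : T.IsTree) (hh : ∀ u, (high T (nb T u)).card ≤ 2) {u p c : V}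
    {M : Finset V} (hM : M ⊆ nb T u) (hp : p ∈ nb T u) (hpM : p ∉ M) (h2M : 2 ≤ M.card)
    (hhigh : (high T M).card ≤ 1) (hc : c ∈ M) (hlead : LeadsToTwoHigh T u c)
    (hinc : ∀ m < weight T u M, IncompleteWin T m)
    (hcom : ∀ m < weight T u M, CompleteWin T m) (D : ℕ) :
    Win T (weight T u M - 1) (sph T u M D) := by
  obtain ⟨q, s, t, H, h2⟩ := hlead
  have huc := mem_nb.1 (hM hc)
  have hu : 3 ≤ (nb T u).card := by
    have h1 : M ⊆ (nb T u).erase p := fun x hx => mem_erase.2 ⟨fun h => hpM (h ▸ hx), hM hx⟩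
    have h3 := Finset.card_le_card h1
    have h4 := Finset.card_erase_add_one hp
    omega
  obtain ⟨hs, hst, hexit⟩ := H.exit hT
  have hq : 2 ≤ q := by
    by_contra hq
    have hpos := H.pos
    obtain ⟨rfl, rfl⟩ := H.eq_of_one (by omega)
    have h1 := card_high_erase hs hu
    have h3 := hh t
    omega
  have ht : (nb T t).card ≠ 1 := by
    have : (high T ((nb T t).erase s)).card ≤ ((nb T t).erase s).card :=
      Finset.card_filter_le _ _
    omega
  obtain ⟨-, hwt⟩ := hexit ht
  obtain ⟨c₁, c₂, hc₁, hc₂, hne, hsc₁, hsc₂, h3c₁, h3c₂, hw, hlow⟩ := exists_two_high hh hs h2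
  have hsum := weight_erase (T := T) (u := u) hc
  have hcM : 1 ≤ weight T u (M.erase c) := by
    have h1 := card_le_weight hT ((erase_subset c M).trans hM)
    have h3 := Finset.card_erase_add_one hc
    omega
  have hL : 4 ≤ branchLeaves T u c := by
    obtain ⟨l₁, w₁, e₁, -⟩ := win_rest hT hh hs hw hc₁ hc₂ hne hsc₁ hsc₂ h3c₁ h3c₂
      fun m hm => hinc m (by omega)
    omega
  obtain ⟨n, hn⟩ : ∃ n, weight T u M = n + 2 := ⟨weight T u M - 2, by omega⟩
  have hoff : ∀ D', Win T n (sph T u (M.erase c) D') := fun D' =>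
    (win_le hT (n := weight T u (M.erase c)) (fun m hm => hinc m (by omega))
      (fun m hm => hcom m (by omega)) ((erase_subset _ _).trans hM) hp
      (fun h => hpM (mem_of_mem_erase h)) ((high_mono (erase_subset _ _)).trans hhigh) le_rfl
      D').mono (by omega)
  rw [hn]
  by_cases hDq : D < q
  · exact Win.of_chain hT huc H hM hc (Or.inl hq) (Or.inl hDq.ne) hoff fun D' hD' =>
      Win.of_subsingleton (H.subsingleton (by omega))
  have hZ : ∀ z ∈ closedNbhd T (sph T u (M.erase c) D), z ∈ branch T t s ∧
      (∃ e ∈ M.erase c, z ∈ branch T u e) ∧ D ≤ T.dist u z + 1 ∧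
      T.dist t z = q + T.dist u z := by
    intro z hz
    rcases mem_closedNbhd_sph hT ((erase_subset _ _).trans hM) hz with
      ⟨-, h⟩ | ⟨e, he, hze, h1, -⟩
    · omega
    have hzc : z ∉ branch T u c := fun hzc =>
      ne_of_mem_erase he (branch_unique hT (mem_nb.1 (hM (mem_of_mem_erase he))) huc hze hzc)
    exact ⟨(notMem_branch_symm hT H.adj).1 fun h => hzc (H.subset h), ⟨e, he, hze⟩, h1,
      H.dist_off hT huc hzc⟩
  have hZw : ∀ k, Win T n {z ∈ closedNbhd T (sph T u (M.erase c) D) | T.dist t z = k} :=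
    fun k => (hoff (k - q)).anti fun z hz => by
      obtain ⟨-, h1, -, h3⟩ := hZ z hz.1
      have := hz.2
      exact ⟨by omega, h1⟩
  have hsplit : sph T u M D ⊆ sph T u {c} D ∪ sph T u (M.erase c) D := by
    rintro y ⟨hy, e, he, hye⟩
    by_cases hec : e = c
    · exact Or.inl ⟨hy, e, mem_singleton.2 hec, hye⟩
    · exact Or.inr ⟨hy, e, mem_erase.2 ⟨hec, he⟩, hye⟩
  obtain rfl | hlt : D = q ∨ q < D := by omega
  · refine (win_two_high_center hT hh hs h2 (fun m hm => hinc m (by omega)) (by omega)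
      (fun z hz => ⟨(hZ z hz).1, ?_⟩) hZw).anti (hsplit.trans (Set.union_subset_union_left _ ?_))
    · have := hZ z hz
      omega
    · intro y hy
      have ht' := H.end_mem hT
      exact H.subsingleton le_rfl hy ⟨ht'.2, c, mem_singleton_self c, ht'.1⟩
  · refine (win_two_high hT hh hs h2 (fun m hm => hinc m (by omega))
      (fun m hm => hcom m (by omega)) (a := D - q) (by omega) (by omega)
      (fun z hz => ⟨(hZ z hz).1, ?_⟩) hZw).anti
      (hsplit.trans (Set.union_subset_union_left _ (H.sph_subset hT hlt)))
    have := hZ z hz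
    omega

theorem win_not_leadsToTwoHigh (hT : T.IsTree) {u p : V}
    {M : Finset V} (hM : M ⊆ nb T u) (hp : p ∈ nb T u) (hpM : p ∉ M) (h2M : 2 ≤ M.card)
    (hhigh : (high T M).card ≤ 1) (hlead : ∀ c ∈ M, ¬ LeadsToTwoHigh T u c)
    (hinc : ∀ m < weight T u M, IncompleteWin T m) (D : ℕ) :
    Win T (weight T u M - 1) (sph T u M D) := by
  obtain ⟨c, hc, hlow, hmin⟩ : ∃ c ∈ M, (nb T c).card ≤ 2 ∧
      (branchLeaves T u c ≠ 1 → ∀ e ∈ M, 2 ≤ branchLeaves T u e) := by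
    by_cases hex : ∃ c ∈ M, (nb T c).card ≤ 2 ∧ branchLeaves T u c = 1
    · obtain ⟨c, hc, h1, h2⟩ := hex
      exact ⟨c, hc, h1, fun h => absurd h2 h⟩
    · push Not at hex
      obtain ⟨c, hc, hlow⟩ : ∃ c ∈ M, (nb T c).card ≤ 2 := by
        by_contra! h
        have : high T M = M := Finset.filter_true_of_mem fun x hx => h x hx
        rw [this] at hhigh
        omega
      refine ⟨c, hc, hlow, fun _ e he => ?_⟩
      have hue := mem_nb.1 (hM he)
      by_cases hel : (nb T e).card ≤ 2
      · have h1 := hex e he hel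
        have h2 := branchLeaves_pos hT hue
        omega
      · exact two_le_branchLeaves hT hue (by omega)
  have huc := mem_nb.1 (hM hc)
  obtain ⟨q, s, t, H⟩ := exists_chain hT huc
  obtain ⟨hs, -, hexit⟩ := H.exit hT
  have hsum := weight_erase (T := T) (u := u) hc
  have hcard := Finset.card_erase_add_one hc
  have hcM := card_le_weight hT ((erase_subset c M).trans hM)
  have hpos := branchLeaves_pos hT huc
  have hq : 2 ≤ q ∨ (nb T t).card = 1 := by
    have hq1 := H.pos
    by_cases hq : q = 1
    · obtain ⟨rfl, rfl⟩ := H.eq_of_one hq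
      have := H.card_ne
      have : 0 < (nb T t).card := Finset.card_pos.2 ⟨s, hs⟩
      exact Or.inr (by omega)
    · exact Or.inl (by omega)
  obtain ⟨n, hn⟩ : ∃ n, weight T u M = n + 2 := ⟨weight T u M - 2, by omega⟩
  have hoff : ∀ D', Win T n (sph T u (M.erase c) D') := fun D' =>
    (win_incomplete hT (n := weight T u (M.erase c)) (fun m hm => hinc m (by omega))
      ((erase_subset _ _).trans hM) hp (fun h => hpM (mem_of_mem_erase h))
      ((high_mono (erase_subset _ _)).trans hhigh) (Finset.card_pos.1 (by omega))
      (fun e he => hlead e (mem_of_mem_erase (he ▸ mem_singleton_self e))) le_rfl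
      D').mono (by omega)
  rw [hn]
  by_cases hD : D ≠ q ∨ (nb T t).card = 1
  · exact Win.of_chain hT huc H hM hc hq hD hoff fun D' _ =>
      (win_single_incomplete hT huc (hinc _ (by omega)) (hlead c hc) D').mono (by omega)
  push Not at hD
  obtain ⟨rfl, ht⟩ := hD
  have hD2 : 2 ≤ D := hq.resolve_right ht
  obtain ⟨hR2, hwt⟩ := hexit ht
  have hmin2 : ∀ e ∈ M, 2 ≤ branchLeaves T u e := hmin fun h => ht (H.leaf_of_branchLeaves hT h)
  have hcM2 : 2 ≤ weight T u (M.erase c) := by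
    obtain ⟨e, he⟩ := Finset.card_pos.1 (by omega : 0 < (M.erase c).card)
    have h1 := hmin2 e (mem_of_mem_erase he)
    have h2 := weight_erase (T := T) (u := u) he
    omega
  have hR : ∀ k, Win T (branchLeaves T u c - 1) (sph T t ((nb T t).erase s) k) := fun k => by
    refine hinc _ (by omega) t _ s k (erase_subset _ _) hs (notMem_erase _ _) hR2 ?_ hwt
    by_contra! h
    exact hlead c hc ⟨D, s, t, H, h⟩
  have hmem : ∀ y ∈ closedNbhd T (sph T u M D),
      (y ∈ sph T u (M.erase c) (T.dist u y) ∧ 1 ≤ T.dist u y ∧ T.dist t y = D + T.dist u y) ∨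
      T.dist t y ≤ 1 := by
    intro y hy
    rcases mem_closedNbhd_sph hT hM hy with ⟨-, h1⟩ | ⟨e, he, hye, h1, h2⟩
    · omega
    by_cases hec : e = c
    · subst hec
      refine Or.inr ?_
      by_cases hyt : y ∈ branch T s t
      · have := H.far y hyt
        omega
      · have := H.near y hye hyt
        omega
    · refine Or.inl ⟨⟨rfl, e, mem_erase.2 ⟨hec, he⟩, hye⟩, one_le_dist u hye, ?_⟩
      exact H.dist_off hT huc fun hyc => hec (branch_unique hT (mem_nb.1 (hM he)) huc hye hyc)
  refine Win.probe t fun k => ?_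
  rcases k with _ | _ | k
  · exact ⟨_, Win.singleton t, fun y _ hk => ((hT.connected.dist_eq_zero_iff).1 hk).symm⟩
  · refine ⟨_, (Win.insert_low hT H.adj.symm (H.card_of_two hD2).2.le (erase_subset _ _)
      (notMem_erase _ _) (hR 1) (hR 2)).mono (by omega), fun y _ hk => ?_⟩
    have hty := SimpleGraph.dist_eq_one_iff_adj.1 hk
    by_cases hys : y = s
    · exact Or.inl hys
    · exact Or.inr (by simp [hys, hty])
  · refine ⟨_, hoff (k + 2 - D), fun y hy hk => ?_⟩
    rcases hmem y hy with h | h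
    · have : T.dist u y = k + 2 - D := by omega
      exact this ▸ h.1
    · omega

theorem incompleteWin_and_completeWin (hT : T.IsTree) (hh : ∀ u, (high T (nb T u)).card ≤ 2)
    (n : ℕ) : IncompleteWin T n ∧ CompleteWin T n := by
  induction n using Nat.strong_induction_on with
  | _ n ih =>
    have hinc : IncompleteWin T n := by
      rintro u M p D hM hp hpM h2 hhigh rfl
      by_cases hlead : ∃ c ∈ M, LeadsToTwoHigh T u c
      · obtain ⟨c, hc, hlead⟩ := hlead
        exact win_leadsToTwoHigh hT hh hM hp hpM h2 hhigh hc hlead (fun m hm => (ih m hm).1)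
          (fun m hm => (ih m hm).2) D
      · push Not at hlead
        exact win_not_leadsToTwoHigh hT hM hp hpM h2 hhigh hlead (fun m hm => (ih m hm).1) D
    refine ⟨hinc, ?_⟩
    rintro u p D hp h2 rfl
    by_cases hhigh : (high T ((nb T u).erase p)).card ≤ 1
    · exact (hinc u _ p D (erase_subset _ _) hp (notMem_erase _ _) h2 hhigh rfl).mono
        (Nat.sub_le _ _)
    rcases Nat.eq_zero_or_pos D with rfl | hD
    · refine Win.of_subsingleton ?_
      rintro y ⟨hy, e, -, hye⟩
      have := one_le_dist u hye
      omega
    have hle := card_le_weight hT (erase_subset p (nb T u))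
    obtain ⟨n, hn⟩ : ∃ n, weight T u ((nb T u).erase p) = n + 1 :=
      ⟨weight T u ((nb T u).erase p) - 1, by omega⟩
    have hempty : closedNbhd T (∅ : Set V) = ∅ := by
      ext y
      simp [closedNbhd]
    have := win_two_high hT hh hp (by omega) (fun m hm => (ih m hm).1)
      (fun m hm => (ih m hm).2) hn.le hD (Z := ∅) (by simp [hempty])
      (fun k => Win.of_subsingleton (by simp [hempty]))
    rw [hn]
    simpa using this

end Induction

end LocalizationTree

/-- If `T` is a finite tree with at least two vertices that does not contain a copy of
`T_{3,3}`, then `capt_1(T, V(T), ℓ(T))` holds; in particular `lcapt_1(T) ≤ ℓ(T)`. -/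
theorem stmt_0 {V : Type*} [Fintype V] (T : SimpleGraph V) (hT : T.IsTree)
    (hcard : 2 ≤ Fintype.card V) (hfree : ¬ ContainsCopyT33 T) :
    capt T 1 (numLeaves T) Set.univ ∧ lcaptK T 1 ≤ numLeaves T := by
  have key : capt T 1 (numLeaves T) Set.univ := by
    obtain ⟨r, s, hr⟩ := LocalizationTree.exists_nb_eq_singleton hT hcard
    have hrs : T.Adj r s := by rw [← LocalizationTree.mem_nb, hr, Finset.mem_singleton]
    rw [LocalizationTree.numLeaves_eq hT hr]
    refine LocalizationTree.capt_of_probe r fun k => ?_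
    by_cases hk : k = 0
    · subst hk
      exact ⟨_, LocalizationTree.Win.singleton r, fun y _ hy =>
        ((hT.connected.dist_eq_zero_iff).1 hy).symm⟩
    refine ⟨_, LocalizationTree.win_single_complete hT hrs
      (LocalizationTree.incompleteWin_and_completeWin hT
        (LocalizationTree.card_le_two_of_not_containsCopyT33 hT hfree) _).2 k, fun y _ hy => ?_⟩
    have hne : y ≠ r := by
      rintro rfl
      exact hk (hy ▸ SimpleGraph.dist_self)
    obtain ⟨c, hc, hyc⟩ := LocalizationTree.exists_mem_branch hT hne
    rw [← LocalizationTree.mem_nb, hr] at hc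
    exact ⟨hy, c, hc, hyc⟩
  exact ⟨key, Nat.sInf_le key⟩
end

section
/- If T is a finite tree that contains a copy of T_{3,3}, then capt_2(T, V(T), ⌊ℓ(T)/2⌋ − 1) holds; in particular the 2-localization capture time satisfies lcapt_2(T) ≤ ⌊ℓ(T)/2⌋ − 1. -/
namespace SimpleGraph

variable {V : Type*} {G : SimpleGraph V}

theorem IsTree.eq_of_adj_of_dist_add_one (hG : G.IsTree) {u v w w' : V} (h : G.Adj w v)
    (h' : G.Adj w' v) (hd : G.dist u v = G.dist u w + 1) (hd' : G.dist u v = G.dist u w' + 1) :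
    w = w' := by
  obtain ⟨p, hp⟩ := hG.connected.exists_walk_length_eq_dist u w
  obtain ⟨p', hp'⟩ := hG.connected.exists_walk_length_eq_dist u w'
  have hP := (p.concat h).isPath_of_length_eq_dist (by simp [hp, hd])
  have hP' := (p'.concat h').isPath_of_length_eq_dist (by simp [hp', hd'])
  have := congrArg Subtype.val
    ((hG.isAcyclic.subsingleton_path u v).elim ⟨_, hP⟩ ⟨_, hP'⟩)
  simpa using congrArg Walk.penultimate this

theorem Connected.exists_adj_of_ne (hG : G.Connected) {u v : V} (h : u ≠ v) :
    ∃ w, G.Adj w v ∧ G.dist u v = G.dist u w + 1 := by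
  obtain ⟨p, hp⟩ := hG.exists_walk_length_eq_dist v u
  cases p with
  | nil => exact absurd rfl h
  | cons hadj q =>
    rename_i w
    refine ⟨w, hadj.symm, ?_⟩
    have h1 := dist_le q
    have h2 := hG.dist_triangle (u := u) (v := w) (w := v)
    rw [dist_eq_one_iff_adj.2 hadj.symm] at h2
    rw [Walk.length_cons] at hp
    rw [G.dist_comm (u := u) (v := v), G.dist_comm (u := u) (v := w)] at *
    omega

/-- Three vertices `r`, `u`, `v` of a tree have a median. -/
theorem IsTree.exists_median (hG : G.IsTree) (r u v : V) :
    ∃ m, G.dist r u = G.dist r m + G.dist m u ∧ G.dist r v = G.dist r m + G.dist m v ∧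
      G.dist u v = G.dist m u + G.dist m v := by
  induction hn : G.dist r v generalizing v with
  | zero =>
    obtain rfl := hG.connected.dist_eq_zero_iff.1 hn
    exact ⟨r, by simp [G.dist_comm]⟩
  | succ n ih =>
    have hne : r ≠ v := by rintro rfl; simp at hn
    obtain ⟨w, hwv, hw⟩ := hG.connected.exists_adj_of_ne hne
    obtain ⟨m, h1, h2, h3⟩ := ih w (by omega)
    have hdm := hG.dist_eq_dist_add_one_of_adj m hwv
    have hdu := hG.dist_eq_dist_add_one_of_adj u hwv
    have t1 := hG.connected.dist_triangle (u := r) (v := m) (w := v)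
    have t2 := hG.connected.dist_triangle (u := u) (v := m) (w := v)
    rw [G.dist_comm (u := u) (v := m)] at t2
    rcases hdu with hdu | hdu
    · by_cases hmw : m = w
      · subst hmw
        refine ⟨v, ?_, by simp [hn], by simp [G.dist_comm]⟩
        have e := G.dist_comm (u := m) (v := u)
        have e' := G.dist_comm (u := v) (v := u)
        simp only [dist_self] at *
        omega
      · exfalso
        obtain ⟨x, hxw, hx⟩ := hG.connected.exists_adj_of_ne hmw
        have t3 := hG.connected.dist_triangle (u := u) (v := m) (w := x)
        have t4 := hG.connected.dist_triangle (u := r) (v := m) (w := x)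
        have hdx := hG.dist_eq_dist_add_one_of_adj u hxw
        rw [G.dist_comm (u := u) (v := m)] at t3
        have : x = v := hG.eq_of_adj_of_dist_add_one (u := u) hxw hwv.symm (by omega) (by omega)
        subst this
        omega
    · exact ⟨m, by omega, by omega, by omega⟩

/-- On a geodesic from `r` to `v`, the vertex nearer to `r` lies on every geodesic from `r` to the
farther one. -/
theorem IsTree.dist_eq_add_of_geodesic (hG : G.IsTree) {r a b v : V}
    (ha : G.dist r v = G.dist r a + G.dist a v) (hb : G.dist r v = G.dist r b + G.dist b v)
    (hab : G.dist r a ≤ G.dist r b) : G.dist r b = G.dist r a + G.dist a b := by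
  induction hn : G.dist b v generalizing v with
  | zero =>
    obtain rfl := hG.connected.dist_eq_zero_iff.1 hn
    exact ha
  | succ n ih =>
    have hbv : b ≠ v := by rintro rfl; simp at hn
    have hav : a ≠ v := by rintro rfl; simp at ha; omega
    obtain ⟨w, hwv, hw⟩ := hG.connected.exists_adj_of_ne hbv
    obtain ⟨x, hxv, hx⟩ := hG.connected.exists_adj_of_ne hav
    have t1 := hG.connected.dist_triangle (u := r) (v := b) (w := w)
    have t2 := hG.connected.dist_triangle (u := r) (v := a) (w := x)
    have hdw := hG.dist_eq_dist_add_one_of_adj r hwv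
    have hdx := hG.dist_eq_dist_add_one_of_adj r hxv
    obtain rfl : w = x :=
      hG.eq_of_adj_of_dist_add_one (u := r) hwv hxv (by omega) (by omega)
    exact ih (v := w) (by omega) (by omega) (by omega)

/-- The Gromov product of `u` and `v` based at `r`; in a tree rooted at `r`, the depth of the
deepest common ancestor of `u` and `v`. -/
noncomputable def gromovProd (G : SimpleGraph V) (r u v : V) : ℕ :=
  (G.dist r u + G.dist r v - G.dist u v) / 2

theorem gromovProd_comm (r u v : V) : G.gromovProd r u v = G.gromovProd r v u := by
  rw [gromovProd, gromovProd, G.dist_comm (u := u), add_comm]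

@[simp]
theorem gromovProd_self (r u : V) : G.gromovProd r u u = G.dist r u := by
  simp [gromovProd]; omega

theorem IsTree.two_mul_gromovProd (hG : G.IsTree) (r u v : V) :
    2 * G.gromovProd r u v + G.dist u v = G.dist r u + G.dist r v := by
  obtain ⟨m, h1, h2, h3⟩ := hG.exists_median r u v
  rw [gromovProd]
  omega

theorem IsTree.gromovProd_le_left (hG : G.IsTree) (r u v : V) :
    G.gromovProd r u v ≤ G.dist r u := by
  have h1 := hG.two_mul_gromovProd r u v
  have h2 := hG.connected.dist_triangle (u := r) (v := u) (w := v)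
  omega

theorem IsTree.gromovProd_le_right (hG : G.IsTree) (r u v : V) :
    G.gromovProd r u v ≤ G.dist r v := by
  rw [gromovProd_comm]
  exact hG.gromovProd_le_left r v u

/-- Trees are `0`-hyperbolic. -/
theorem IsTree.le_gromovProd_of_le (hG : G.IsTree) {r u v w : V} {k : ℕ}
    (huv : k ≤ G.gromovProd r u v) (hvw : k ≤ G.gromovProd r v w) :
    k ≤ G.gromovProd r u w := by
  obtain ⟨m, h1, h2, h3⟩ := hG.exists_median r u v
  obtain ⟨n, h4, h5, h6⟩ := hG.exists_median r v w
  have e1 := hG.two_mul_gromovProd r u v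
  have e2 := hG.two_mul_gromovProd r v w
  have e3 := hG.two_mul_gromovProd r u w
  rcases le_total (G.dist r m) (G.dist r n) with hmn | hmn
  · have h7 := hG.dist_eq_add_of_geodesic h2 h4 hmn
    have t1 := hG.connected.dist_triangle (u := m) (v := n) (w := w)
    have t2 := hG.connected.dist_triangle (u := u) (v := m) (w := w)
    rw [G.dist_comm (u := u) (v := m)] at t2
    omega
  · have h7 := hG.dist_eq_add_of_geodesic h4 h2 hmn
    have t1 := hG.connected.dist_triangle (u := n) (v := m) (w := u)
    have t2 := hG.connected.dist_triangle (u := u) (v := n) (w := w)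
    rw [G.dist_comm (u := u) (v := n)] at t2
    omega

theorem IsTree.eq_of_dist_le_gromovProd (hG : G.IsTree) {r u v : V}
    (hu : G.dist r u ≤ G.gromovProd r u v) (hv : G.dist r v ≤ G.gromovProd r u v) : u = v := by
  have h := hG.two_mul_gromovProd r u v
  exact hG.connected.dist_eq_zero_iff.1 (by omega)

theorem IsTree.gromovProd_of_adj (hG : G.IsTree) (r : V) {u v : V} (h : G.Adj u v) :
    G.gromovProd r u v = min (G.dist r u) (G.dist r v) := by
  have h1 := hG.two_mul_gromovProd r u v
  rw [dist_eq_one_iff_adj.2 h] at h1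
  have h2 := hG.dist_eq_dist_add_one_of_adj r h
  omega

/-- Below every vertex of a finite nontrivial tree rooted at `r` there is a vertex of degree
one. -/
theorem IsTree.exists_leaf_below [Finite V] [Nontrivial V] (hG : G.IsTree) (r v : V) :
    ∃ l, (G.neighborSet l).ncard = 1 ∧ G.dist r v ≤ G.gromovProd r l v := by
  obtain ⟨l, hl, hmax⟩ := Set.exists_max_image {l | G.dist r v ≤ G.gromovProd r l v} (G.dist r)
    (Set.toFinite _) ⟨v, by simp⟩
  refine ⟨l, ?_, hl⟩
  have hup : ∀ w, G.Adj l w → G.dist r l = G.dist r w + 1 := by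
    intro w hw
    refine (hG.dist_eq_dist_add_one_of_adj r hw).resolve_right fun hlt => ?_
    have hwl : G.gromovProd r w l = G.dist r l := by
      rw [hG.gromovProd_of_adj r hw.symm]; omega
    have := hmax w (hG.le_gromovProd_of_le
      (hwl ▸ (le_trans hl (hG.gromovProd_le_left r l v)) : G.dist r v ≤ _) hl)
    omega
  obtain ⟨w, hw⟩ := hG.connected.preconnected.exists_adj_of_nontrivial l
  refine Set.ncard_eq_one.2 ⟨w, Set.eq_singleton_iff_unique_mem.2 ⟨hw, fun x hx => ?_⟩⟩
  exact hG.eq_of_adj_of_dist_add_one (u := r) (SimpleGraph.Adj.symm hx) hw.symm (hup x hx) (hup w hw)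

/-- The leaves which have, in the tree rooted at `r`, a common ancestor of depth more than `h` with
an element of `C`. -/
def leavesNear (G : SimpleGraph V) (r : V) (h : ℕ) (C : Set V) : Set V :=
  {l | (G.neighborSet l).ncard = 1 ∧ ∃ c ∈ C, h < G.gromovProd r l c}

/-- Probing two vertices `p` and `q` determines the depth of a vertex below their deepest common
ancestor, and the depths at which it branches off from `p` and `q`. -/
theorem IsTree.gromovProd_eq_of_dist_eq (hG : G.IsTree) {r p q u v : V}
    (hup : G.gromovProd r p q ≤ G.gromovProd r u p) (huq : G.gromovProd r p q ≤ G.gromovProd r u q)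
    (hvp : G.gromovProd r p q ≤ G.gromovProd r v p) (hvq : G.gromovProd r p q ≤ G.gromovProd r v q)
    (hp : G.dist u p = G.dist v p) (hq : G.dist u q = G.dist v q) :
    G.dist r u = G.dist r v ∧ G.gromovProd r u p = G.gromovProd r v p ∧
      G.gromovProd r u q = G.gromovProd r v q := by
  have key : ∀ x, min (G.gromovProd r x p) (G.gromovProd r x q) ≤ G.gromovProd r p q := fun x =>
    hG.le_gromovProd_of_le (v := x) (by rw [gromovProd_comm]; omega) (by omega)
  have hu := key u
  have hv := key v
  have e1 := hG.two_mul_gromovProd r u p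
  have e2 := hG.two_mul_gromovProd r u q
  have e3 := hG.two_mul_gromovProd r v p
  have e4 := hG.two_mul_gromovProd r v q
  omega

theorem leavesNear_mono {r : V} {h : ℕ} {C D : Set V} (hCD : C ⊆ D) :
    G.leavesNear r h C ⊆ G.leavesNear r h D :=
  fun _ ⟨hl, c, hc, hlc⟩ => ⟨hl, c, hCD hc, hlc⟩

/-- A probe at `p` and `q` wins in `k + 1` rounds if every fiber is won in `k` rounds because few
leaves are left near it. -/
theorem IsTree.capt_succ_of_probe [Finite V] (hG : G.IsTree) {r p q : V} {k : ℕ} {S : Set V}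
    (ih : ∀ (h d : ℕ) (C : Set V), (∀ c ∈ C, G.dist r c = d) →
      (∀ c ∈ C, ∀ c' ∈ C, h ≤ G.gromovProd r c c') →
      (G.leavesNear r h C).ncard ≤ 2 * k + 1 → C.Subsingleton ∨ capt G 2 k (closedNbhd G C))
    (hp : ∀ u ∈ S, G.gromovProd r p q ≤ G.gromovProd r u p)
    (hq : ∀ u ∈ S, G.gromovProd r p q ≤ G.gromovProd r u q)
    (hcard : ∀ v ∈ S, (G.leavesNear r (max (G.gromovProd r v p) (G.gromovProd r v q))
      {u ∈ S | G.gromovProd r u p = G.gromovProd r v p ∧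
        G.gromovProd r u q = G.gromovProd r v q}).ncard ≤ 2 * k + 1) :
    capt G 2 (k + 1) S := by
  classical
  refine ⟨{p, q}, Finset.card_le_two, fun v hv => ?_⟩
  have key : ∀ u ∈ {u ∈ S | ∀ x ∈ ({p, q} : Finset V), G.dist u x = G.dist v x},
      G.dist r u = G.dist r v ∧ G.gromovProd r u p = G.gromovProd r v p ∧
        G.gromovProd r u q = G.gromovProd r v q := fun u hu =>
    hG.gromovProd_eq_of_dist_eq (hp u hu.1) (hq u hu.1) (hp v hv) (hq v hv)
      (hu.2 p (by simp)) (hu.2 q (by simp))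
  refine ih (max (G.gromovProd r v p) (G.gromovProd r v q)) (G.dist r v) _
    (fun c hc => (key c hc).1) (fun c hc c' hc' => ?_) ?_
  · obtain ⟨-, h1, h2⟩ := key c hc
    obtain ⟨-, h3, h4⟩ := key c' hc'
    refine max_le (hG.le_gromovProd_of_le (v := p) h1.ge ?_)
      (hG.le_gromovProd_of_le (v := q) h2.ge ?_)
    · rw [gromovProd_comm r p]; exact h3.ge
    · rw [gromovProd_comm r q]; exact h4.ge
  · exact (Set.ncard_le_ncard (leavesNear_mono fun u hu => Set.mem_sep hu.1 (key u hu).2)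
      (Set.toFinite _)).trans (hcard v hv)

/-- Two leaves below different elements of a level set `C`, chosen to separate `C` as near to the
root as possible. -/
theorem IsTree.exists_probe [Finite V] (hG : G.IsTree) {r : V} {h d : ℕ} {C : Set V}
    (hd : ∀ c ∈ C, G.dist r c = d) (hC : ∀ c ∈ C, ∀ c' ∈ C, h ≤ G.gromovProd r c c')
    (hns : ¬ C.Subsingleton) :
    ∃ p ∈ G.leavesNear r h C, ∃ q ∈ G.leavesNear r h C, p ≠ q ∧ h ≤ G.gromovProd r p q ∧
      G.gromovProd r p q < d ∧ ∀ u ∈ closedNbhd G C,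
        G.gromovProd r p q ≤ G.gromovProd r u p ∧ G.gromovProd r p q ≤ G.gromovProd r u q := by
  have hne : C.offDiag.Nonempty := by
    rw [Set.not_subsingleton_iff] at hns
    obtain ⟨x, hx, y, hy, hxy⟩ := hns
    exact ⟨(x, y), hx, hy, hxy⟩
  obtain ⟨⟨a, b⟩, ⟨ha, hb, hab⟩, hmin⟩ := Set.exists_min_image C.offDiag
    (fun x => G.gromovProd r x.1 x.2) (Set.toFinite _) hne
  simp only at ha hb hab hmin
  have : Nontrivial V := ⟨a, b, hab⟩
  have hlt : G.gromovProd r a b < d := by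
    by_contra hge
    exact hab (hG.eq_of_dist_le_gromovProd (r := r) (by rw [hd a ha]; omega)
      (by rw [hd b hb]; omega))
  have hhle := hC a ha b hb
  obtain ⟨p, hpl, hpa⟩ := hG.exists_leaf_below r a
  obtain ⟨q, hql, hqb⟩ := hG.exists_leaf_below r b
  rw [hd a ha] at hpa
  rw [hd b hb] at hqb
  have hap : d ≤ G.gromovProd r a p := by rwa [gromovProd_comm]
  have hbq : d ≤ G.gromovProd r b q := by rwa [gromovProd_comm]
  have hpq : G.gromovProd r p q = G.gromovProd r a b := by
    refine le_antisymm ?_ (hG.le_gromovProd_of_le (v := a) (by omega)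
      (hG.le_gromovProd_of_le (v := b) le_rfl (by omega)))
    by_contra hgt
    have : G.gromovProd r a b + 1 ≤ G.gromovProd r a b :=
      hG.le_gromovProd_of_le (v := p) (by omega)
        (hG.le_gromovProd_of_le (v := q) (by omega) (by omega))
    omega
  have hclose : ∀ u ∈ closedNbhd G C, ∃ c ∈ C, G.gromovProd r a b ≤ G.gromovProd r u c := by
    rintro u (hu | ⟨c, hc, hcu⟩)
    · exact ⟨u, hu, by rw [gromovProd_self, hd u hu]; omega⟩
    · refine ⟨c, hc, ?_⟩
      rw [hG.gromovProd_of_adj r hcu.symm, hd c hc]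
      have h1 := hG.dist_eq_dist_add_one_of_adj r hcu
      rw [hd c hc] at h1
      omega
  have hall : ∀ c ∈ C, ∀ c' ∈ C, G.gromovProd r a b ≤ G.gromovProd r c c' := by
    intro c hc c' hc'
    by_cases hcc : c = c'
    · subst hcc
      rw [gromovProd_self, hd c hc]; omega
    · exact hmin (c, c') ⟨hc, hc', hcc⟩
  refine ⟨p, ⟨hpl, a, ha, by omega⟩, q, ⟨hql, b, hb, by omega⟩, ?_, by omega, by omega, ?_⟩
  · rintro rfl
    rw [gromovProd_self] at hpq
    have := hG.gromovProd_le_left r p a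
    omega
  · intro u hu
    obtain ⟨c, hc, huc⟩ := hclose u hu
    rw [hpq]
    exact ⟨hG.le_gromovProd_of_le huc (hG.le_gromovProd_of_le (hall c hc a ha) (by omega)),
      hG.le_gromovProd_of_le huc (hG.le_gromovProd_of_le (hall c hc b hb) (by omega))⟩

/-- A robber known to be in a level set `C` below a vertex of depth `h` is caught by two cops in
`k` further rounds if at most `2 * k + 1` leaves are near `C`. -/
theorem IsTree.subsingleton_or_capt [Finite V] (hG : G.IsTree) (r : V) (k : ℕ) :
    ∀ (h d : ℕ) (C : Set V), (∀ c ∈ C, G.dist r c = d) →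
      (∀ c ∈ C, ∀ c' ∈ C, h ≤ G.gromovProd r c c') →
      (G.leavesNear r h C).ncard ≤ 2 * k + 1 → C.Subsingleton ∨ capt G 2 k (closedNbhd G C) := by
  induction k with
  | zero =>
    refine fun h d C hd hC hcard => Or.inl ?_
    by_contra hns
    obtain ⟨p, hp, q, hq, hpq, -⟩ := hG.exists_probe hd hC hns
    exact hpq ((Set.ncard_le_one (Set.toFinite _)).1 hcard p hp q hq)
  | succ k ih =>
    refine fun h d C hd hC hcard => or_iff_not_imp_left.2 fun hns => ?_
    obtain ⟨p, hp, q, hq, hpq, hh, hlt, hclose⟩ := hG.exists_probe hd hC hns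
    refine hG.capt_succ_of_probe ih (fun u hu => (hclose u hu).1) (fun u hu => (hclose u hu).2)
      fun v hv => ?_
    have hsub : G.leavesNear r (max (G.gromovProd r v p) (G.gromovProd r v q))
        {u ∈ closedNbhd G C | G.gromovProd r u p = G.gromovProd r v p ∧
          G.gromovProd r u q = G.gromovProd r v q} ⊆ G.leavesNear r h C \ {p, q} := by
      rintro l ⟨hl, u, ⟨hu, hup, huq⟩, hlu⟩
      have hv' := hclose v hv
      have hul := hG.gromovProd_le_right r l u
      refine ⟨⟨hl, ?_⟩, ?_⟩
      · rcases hu with hu | ⟨c, hc, hcu⟩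
        · exact ⟨u, hu, by omega⟩
        · refine ⟨c, hc, hG.le_gromovProd_of_le (v := u) (by omega) ?_⟩
          rw [hG.gromovProd_of_adj r hcu.symm, hd c hc]
          omega
      · rw [gromovProd_comm r l u] at hlu
        rintro (rfl | rfl) <;> omega
    have h1 := Set.ncard_le_ncard hsub (Set.toFinite _)
    have hpq2 : ({p, q} : Set V) ⊆ G.leavesNear r h C := by
      rintro x (rfl | rfl) <;> assumption
    rw [Set.ncard_sdiff hpq2 (Set.toFinite _), Set.ncard_pair hpq] at h1
    omega

theorem IsTree.capt_univ_of_containsCopyT33 [Finite V] (hG : G.IsTree) (hcopy : ContainsCopyT33 G) :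
    capt G 2 (numLeaves G / 2 - 1) Set.univ := by
  classical
  obtain ⟨f, hf, hadj⟩ := hcopy
  set r := f 0
  have : Nontrivial V := ⟨f 0, f 1, hf.ne (by decide)⟩
  let par : Fin 10 → Fin 10 := ![0, 0, 0, 0, 1, 1, 2, 2, 3, 3]
  have hy : ∀ i : Fin 10, i = 1 ∨ i = 2 ∨ i = 3 → G.dist r (f i) = 1 := by
    rintro i (rfl | rfl | rfl) <;> exact dist_eq_one_iff_adj.2 (hadj _ _ (by simp [T33]))
  have hpar : ∀ i : Fin 10, 4 ≤ i → G.Adj (f (par i)) (f i) := by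
    intro i hi
    refine hadj _ _ ?_
    fin_cases i <;> simp [T33, par] at hi ⊢
  have hpar' : ∀ i : Fin 10, 4 ≤ i → par i = 1 ∨ par i = 2 ∨ par i = 3 := by decide
  have hx : ∀ i : Fin 10, 4 ≤ i → G.dist r (f i) = 2 := by
    intro i hi
    have h1 := hG.dist_eq_dist_add_one_of_adj r (hpar i hi)
    rw [hy _ (hpar' i hi)] at h1
    have h2 : G.dist r (f i) ≠ 0 := by
      rw [Ne, hG.connected.dist_eq_zero_iff]
      exact hf.ne (by rintro rfl; simp at hi)
    omega
  choose L hL hLbelow using hG.exists_leaf_below r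
  have hinj : ∀ i j : Fin 10, 4 ≤ i → 4 ≤ j → L (f i) = L (f j) → i = j := by
    intro i j hi hj hij
    have h1 := hLbelow (f i)
    have h2 := hLbelow (f j)
    rw [hx i hi, gromovProd_comm] at h1
    rw [hx j hj, ← hij] at h2
    have := hG.le_gromovProd_of_le h1 h2
    exact hf (hG.eq_of_dist_le_gromovProd (r := r) (by rwa [hx i hi]) (by rwa [hx j hj]))
  have hLpar : ∀ i : Fin 10, 4 ≤ i → 1 ≤ G.gromovProd r (L (f i)) (f (par i)) := by
    intro i hi
    have h1 := hLbelow (f i)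
    rw [hx i hi] at h1
    refine hG.le_gromovProd_of_le (v := f i) (by omega) ?_
    rw [hG.gromovProd_of_adj r (hpar i hi).symm, hx i hi, hy _ (hpar' i hi)]
    omega
  have hsep : ∀ i j : Fin 10, 4 ≤ i → 4 ≤ j → ∀ v, 1 ≤ G.gromovProd r v (L (f i)) →
      1 ≤ G.gromovProd r v (L (f j)) → par i = par j := by
    intro i j hi hj v hvi hvj
    rw [gromovProd_comm] at hvi
    have h1 := hG.le_gromovProd_of_le hvi (hG.le_gromovProd_of_le hvj (hLpar j hj))
    have h2 := hLpar i hi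
    rw [gromovProd_comm] at h2
    have h3 := hG.le_gromovProd_of_le h2 h1
    exact hf (hG.eq_of_dist_le_gromovProd (r := r) (by rwa [hy _ (hpar' i hi)])
      (by rwa [hy _ (hpar' j hj)]))
  have hsib : ∀ i j : Fin 10, 4 ≤ i → 4 ≤ j → par i = par j → ∀ v,
      1 ≤ G.gromovProd r (L (f i)) v → 1 ≤ G.gromovProd r v (L (f j)) := by
    intro i j hi hj hij v hv
    have h1 := hLpar i hi
    have h2 := hLpar j hj
    rw [gromovProd_comm] at hv h2
    exact hG.le_gromovProd_of_le hv (hG.le_gromovProd_of_le h1 (hij ▸ h2))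
  have hcount : ∀ (t : Finset (Fin 10)) (A : Set V), (∀ i ∈ t, 4 ≤ i) →
      (∀ l ∈ A, (G.neighborSet l).ncard = 1) → (∀ i ∈ t, L (f i) ∉ A) →
      A.ncard + t.card ≤ numLeaves G := by
    intro t A ht hA hdisj
    have hcard : (t.image (L ∘ f)).card = t.card :=
      Finset.card_image_of_injOn fun i hi j hj hij => hinj i j (ht i hi) (ht j hj) hij
    rw [← hcard, ← Set.ncard_coe_finset, ← Set.ncard_union_eq _ (Set.toFinite _) (Set.toFinite _)]
    · refine Set.ncard_le_ncard ?_ (Set.toFinite _)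
      rintro l (hl | hl)
      · exact hA l hl
      · simp only [Finset.coe_image, Set.mem_image] at hl
        obtain ⟨i, -, rfl⟩ := hl
        exact hL _
    · rw [Set.disjoint_right]
      intro l hl
      simp only [Finset.coe_image, Set.mem_image] at hl
      obtain ⟨i, hi, rfl⟩ := hl
      exact hdisj i hi
  have h4 : 4 ≤ numLeaves G := by
    simpa using hcount {4, 5, 6, 7} ∅ (by decide) (by simp) (by simp)
  obtain ⟨k, hk⟩ : ∃ k, numLeaves G / 2 - 1 = k + 1 := ⟨numLeaves G / 2 - 2, by omega⟩
  have hpq : G.gromovProd r (L (f 4)) (L (f 6)) = 0 := by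
    by_contra h0
    have h1 := hLbelow (f 4)
    rw [hx 4 le_rfl] at h1
    exact absurd (hsep 4 6 (by decide) (by decide) (L (f 4))
      (by have := hG.gromovProd_le_left r (L (f 4)) (f 4); rw [gromovProd_self]; omega)
      (by omega)) (by decide)
  rw [hk]
  refine hG.capt_succ_of_probe (p := L (f 4)) (q := L (f 6)) (hG.subsingleton_or_capt r k)
    (by simp [hpq]) (by simp [hpq]) fun v _ => ?_
  suffices ∃ t : Finset (Fin 10), t.card = 4 ∧ (∀ i ∈ t, 4 ≤ i) ∧ ∀ i ∈ t, ∀ u,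
      G.gromovProd r u (L (f 4)) = G.gromovProd r v (L (f 4)) →
      G.gromovProd r u (L (f 6)) = G.gromovProd r v (L (f 6)) →
      ¬ max (G.gromovProd r v (L (f 4))) (G.gromovProd r v (L (f 6))) <
        G.gromovProd r (L (f i)) u by
    obtain ⟨t, ht4, ht, hdisj⟩ := this
    suffices h : _ + t.card ≤ numLeaves G by
      rw [ht4] at h
      exact (Nat.le_sub_of_add_le h).trans (by omega)
    exact hcount t _ ht (fun l hl => hl.1)
      (fun i hi ⟨_, u, ⟨_, h1, h2⟩, h3⟩ => hdisj i hi u h1 h2 h3)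
  by_cases hv4 : 1 ≤ G.gromovProd r v (L (f 4))
  · refine ⟨{6, 7, 8, 9}, by decide, by decide, fun i hi u h1 h2 h3 => ?_⟩
    have hi4 : 4 ≤ i ∧ par 4 ≠ par i := by clear h3; revert i; decide
    rw [gromovProd_comm r (L (f i))] at h3
    exact hi4.2 (hsep 4 i le_rfl hi4.1 u (by omega) (by omega))
  by_cases hv6 : 1 ≤ G.gromovProd r v (L (f 6))
  · refine ⟨{4, 5, 8, 9}, by decide, by decide, fun i hi u h1 h2 h3 => ?_⟩
    have hi4 : 4 ≤ i ∧ par 6 ≠ par i := by clear h3; revert i; decide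
    rw [gromovProd_comm r (L (f i))] at h3
    exact hi4.2 (hsep 6 i (by decide) hi4.1 u (by omega) (by omega))
  · refine ⟨{4, 5, 6, 7}, by decide, by decide, fun i hi u h1 h2 h3 => ?_⟩
    have hi4 : 4 ≤ i ∧ (par i = par 4 ∨ par i = par 6) := by clear h3; revert i; decide
    rcases hi4.2 with hi' | hi'
    · have := hsib i 4 hi4.1 le_rfl hi' u (by omega)
      omega
    · have := hsib i 6 hi4.1 (by decide) hi' u (by omega)
      omega

end SimpleGraph

/-- If `T` is a finite tree that contains a copy of `T_{3,3}`, then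
`capt_2(T, V(T), ⌊ℓ(T)/2⌋ − 1)` holds; in particular `lcapt_2(T) ≤ ⌊ℓ(T)/2⌋ − 1`. -/
theorem stmt_1 {V : Type*} [Fintype V] (T : SimpleGraph V) (hT : T.IsTree)
    (hcopy : ContainsCopyT33 T) :
    capt T 2 (numLeaves T / 2 - 1) Set.univ ∧ lcaptK T 2 ≤ numLeaves T / 2 - 1 :=
  ⟨hT.capt_univ_of_containsCopyT33 hcopy, Nat.sInf_le (hT.capt_univ_of_containsCopyT33 hcopy)⟩
end

section
/- If T is a tree on n ≥ 2 vertices with localization number ζ(T) = 1, then lcapt(T) ≤ n − 1. -/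
namespace LocalizationGame

open SimpleGraph Set

variable {V : Type*} {T : SimpleGraph V}

/-- The vertices strictly closer to `w` than to `v`: for an edge `vw` of a tree, the component
of `w` after the edge is removed. -/
def side (T : SimpleGraph V) (v w : V) : Set V := {y | T.dist y v = T.dist y w + 1}

/-- A vertex is light if it has at most two neighbors. -/
def Light (T : SimpleGraph V) (w : V) : Prop :=
  ∀ x y z, T.Adj w x → T.Adj w y → T.Adj w z → x = y ∨ y = z ∨ x = z

/-- The union of the sides at `v` in the directions `X`. -/
def reg (T : SimpleGraph V) (v : V) (X : Set V) : Set V := {y | ∃ x ∈ X, y ∈ side T v x}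

/-- All vertices of `D` have the same distance from `R`. -/
def Equidistant (T : SimpleGraph V) (D : Set V) (R : V) : Prop :=
  ∀ y ∈ D, ∀ y' ∈ D, T.dist y R = T.dist y' R

/-- One cop who knows that the robber is in `D`, before the robber's move, wins within `t`
further probes. -/
def Wins (T : SimpleGraph V) (t : ℕ) (D : Set V) : Prop :=
  D.Subsingleton ∨ capt T 1 t (closedNbhd T D)

theorem mem_side {v w y : V} : y ∈ side T v w ↔ T.dist y v = T.dist y w + 1 := Iff.rfl

theorem dist_add_of_mem_support (hT : T.IsTree) {y z x : V} (p : T.Walk y z)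
    (hp : p.length = T.dist y z) (hx : x ∈ p.support) :
    T.dist y z = T.dist y x + T.dist x z := by
  classical
  have h := congrArg Walk.length (p.take_spec hx)
  rw [Walk.length_append] at h
  have h1 := dist_le (p.takeUntil x hx)
  have h2 := dist_le (p.dropUntil x hx)
  have h3 := hT.1.dist_triangle (u := y) (v := x) (w := z)
  omega

theorem mem_edges_of_walk (hT : T.IsTree) {v w : V} (h : T.Adj v w) (p : T.Walk v w) :
    s(v, w) ∈ p.edges :=
  isBridge_iff_forall_walk_mem_edges.mp (isAcyclic_iff_forall_adj_isBridge.mp hT.2 h) p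

theorem dist_adj (hT : T.IsTree) {v w : V} (h : T.Adj v w) (y : V) :
    T.dist y w = T.dist y v + 1 ∨ T.dist y v = T.dist y w + 1 := by
  obtain ⟨p, hp⟩ := hT.1.exists_walk_length_eq_dist v y
  obtain ⟨q, hq⟩ := hT.1.exists_walk_length_eq_dist y w
  have hm := mem_edges_of_walk hT h (p.append q)
  rw [Walk.edges_append, List.mem_append] at hm
  have hvw : T.dist v w = 1 := dist_eq_one_iff_adj.mpr h
  rcases hm with hm | hm
  · have := dist_add_of_mem_support hT p hp (p.snd_mem_support_of_mem_edges hm)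
    rw [dist_comm (u := v) (v := y), dist_comm (u := w) (v := y)] at this
    omega
  · have := dist_add_of_mem_support hT q hq (q.fst_mem_support_of_mem_edges hm)
    omega

theorem notMem_side (hT : T.IsTree) {v w : V} (h : T.Adj v w) {y : V} :
    y ∉ side T v w ↔ T.dist y w = T.dist y v + 1 := by
  have := dist_adj hT h y
  rw [mem_side]
  omega

/-- Distances across an edge `vw` of a tree add up. -/
theorem dist_across (hT : T.IsTree) {v w : V} (h : T.Adj v w) {y z : V}
    (hy : y ∈ side T v w) (hz : z ∉ side T v w) :
    T.dist y z = T.dist y w + 1 + T.dist z v := by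
  rw [notMem_side hT h] at hz
  rw [mem_side] at hy
  obtain ⟨p, hp⟩ := hT.1.exists_walk_length_eq_dist v z
  obtain ⟨q, hq⟩ := hT.1.exists_walk_length_eq_dist y z
  obtain ⟨r, hr⟩ := hT.1.exists_walk_length_eq_dist y w
  have hm := mem_edges_of_walk hT h (p.append (q.reverse.append r))
  rw [Walk.edges_append, Walk.edges_append, List.mem_append, List.mem_append,
    Walk.edges_reverse, List.mem_reverse] at hm
  have hvw : T.dist v w = 1 := dist_eq_one_iff_adj.mpr h
  rcases hm with hm | hm | hm
  · have := dist_add_of_mem_support hT p hp (p.snd_mem_support_of_mem_edges hm)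
    rw [dist_comm (u := v) (v := z), dist_comm (u := w) (v := z)] at this
    omega
  · have := dist_add_of_mem_support hT q hq (q.fst_mem_support_of_mem_edges hm)
    rw [dist_comm (u := v) (v := z)] at this
    omega
  · have := dist_add_of_mem_support hT r hr (r.fst_mem_support_of_mem_edges hm)
    omega

theorem self_mem_side {v w : V} (h : T.Adj v w) : w ∈ side T v w := by
  rw [mem_side, dist_self, dist_eq_one_iff_adj.mpr h.symm]

theorem self_notMem_side {v w : V} : v ∉ side T v w := by
  rw [mem_side, dist_self]
  omega

theorem side_symm (hT : T.IsTree) {v w : V} (h : T.Adj v w) {y : V} :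
    y ∈ side T w v ↔ y ∉ side T v w := by
  rw [notMem_side hT h, mem_side]

theorem eq_of_dist_eq_zero (hT : T.IsTree) {x y : V} (h : T.dist x y = 0) : x = y :=
  hT.1.dist_eq_zero_iff.mp h

theorem exists_side (hT : T.IsTree) {v y : V} (h : y ≠ v) : ∃ w, T.Adj v w ∧ y ∈ side T v w := by
  obtain ⟨p, hp⟩ := hT.1.exists_walk_length_eq_dist v y
  cases p with
  | nil => exact absurd rfl h
  | @cons _ w _ hvw q =>
    refine ⟨w, hvw, ?_⟩
    have h1 := dist_le q
    have h2 := dist_adj hT hvw y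
    rw [Walk.length_cons] at hp
    rw [mem_side, dist_comm (u := y) (v := v), dist_comm (u := y) (v := w)] at *
    omega

theorem side_unique (hT : T.IsTree) {v w w' y : V} (h : T.Adj v w) (h' : T.Adj v w')
    (hy : y ∈ side T v w) (hy' : y ∈ side T v w') : w = w' := by
  by_contra hne
  have h1 : T.dist w' v = 1 := dist_eq_one_iff_adj.mpr h'.symm
  have h2 : w' ∉ side T v w := by
    rw [mem_side]
    intro h3
    exact hne (eq_of_dist_eq_zero hT (by omega)).symm
  have := dist_across hT h hy h2
  rw [mem_side] at hy hy'
  omega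

theorem eq_of_adj_of_mem_side (hT : T.IsTree) {v w x : V} (h : T.Adj v w) (hx : T.Adj v x)
    (hxw : x ∈ side T v w) : x = w :=
  (side_unique hT h hx hxw (self_mem_side hx)).symm

/-- The only way to leave a side is along its edge. -/
theorem eq_of_leave_side (hT : T.IsTree) {v w y y' : V} (h : T.Adj v w) (hy : y ∈ side T v w)
    (hadj : T.Adj y y') (hy' : y' ∉ side T v w) : y = w ∧ y' = v := by
  have h1 := dist_across hT h hy hy'
  have h2 : T.dist y y' = 1 := dist_eq_one_iff_adj.mpr hadj
  exact ⟨eq_of_dist_eq_zero hT (by omega), eq_of_dist_eq_zero hT (by omega)⟩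

theorem dist_le_of_mem_closedNbhd {D : Set V} {y : V} (hy : y ∈ closedNbhd T D) :
    ∃ s ∈ D, T.dist y s ≤ 1 := by
  rcases hy with hy | ⟨s, hs, hadj⟩
  · exact ⟨y, hy, by simp⟩
  · exact ⟨s, hs, (dist_eq_one_iff_adj.mpr hadj.symm).le⟩

/-- Moving from `D` changes the distance to any vertex by at most one. -/
theorem dist_move (hT : T.IsTree) {D : Set V} {y : V} (hy : y ∈ closedNbhd T D) :
    ∃ s ∈ D, ∀ R, T.dist y R ≤ T.dist s R + 1 ∧ T.dist s R ≤ T.dist y R + 1 := by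
  obtain ⟨s, hs, h⟩ := dist_le_of_mem_closedNbhd hy
  refine ⟨s, hs, fun R => ?_⟩
  have h1 := hT.1.dist_triangle (u := y) (v := s) (w := R)
  have h2 := hT.1.dist_triangle (u := s) (v := y) (w := R)
  rw [dist_comm (u := s) (v := y)] at h2
  omega

theorem closedNbhd_mono {D D' : Set V} (h : D ⊆ D') : closedNbhd T D ⊆ closedNbhd T D' := by
  rintro y (hy | ⟨s, hs, hadj⟩)
  · exact Or.inl (h hy)
  · exact Or.inr ⟨s, h hs, hadj⟩

theorem subset_closedNbhd {D : Set V} : D ⊆ closedNbhd T D := fun _ h => Or.inl h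

theorem capt_anti {k t : ℕ} {S S' : Set V} (h : S' ⊆ S) (hS : capt T k t S) :
    capt T k t S' := by
  induction t generalizing S S' with
  | zero => exact hS
  | succ t ih =>
    obtain ⟨P, hP, hf⟩ := hS
    refine ⟨P, hP, fun v hv => ?_⟩
    have hsub : {u ∈ S' | ∀ p ∈ P, T.dist u p = T.dist v p} ⊆
        {u ∈ S | ∀ p ∈ P, T.dist u p = T.dist v p} := fun u hu => ⟨h hu.1, hu.2⟩
    rcases hf v (h hv) with h1 | h1
    · exact Or.inl (h1.anti hsub)
    · exact Or.inr (ih (closedNbhd_mono hsub) h1)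

theorem Wins.anti {t : ℕ} {D D' : Set V} (hD : Wins T t D) (h : D' ⊆ D) : Wins T t D' :=
  hD.imp (fun h1 => h1.anti h) (capt_anti (closedNbhd_mono h))

theorem capt_of_probe {t : ℕ} {S : Set V} (x : V)
    (h : ∀ E ⊆ S, Equidistant T E x → Wins T t E) : capt T 1 (t + 1) S := by
  refine ⟨{x}, by simp, fun v _ => h _ (fun u hu => hu.1) ?_⟩
  intro y hy y' hy'
  rw [hy.2 x (by simp), hy'.2 x (by simp)]

theorem wins_of_probe {t : ℕ} {D : Set V} (x : V)
    (h : ∀ E ⊆ closedNbhd T D, Equidistant T E x → Wins T t E) : Wins T (t + 1) D :=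
  Or.inr (capt_of_probe x h)

theorem Equidistant.subsingleton (hT : T.IsTree) {E : Set V} {R : V} (h : Equidistant T E R)
    (hR : R ∈ E) : E.Subsingleton := by
  have key : ∀ y ∈ E, y = R := fun y hy =>
    eq_of_dist_eq_zero hT (by rw [h y hy R hR, dist_self])
  intro y hy y' hy'
  rw [key y hy, key y' hy']

/-- Inside a side, distances to a vertex outside are determined by distances to the edge. -/
theorem Equidistant.enter (hT : T.IsTree) {E : Set V} {v w R : V} (h : T.Adj v w)
    (hE : Equidistant T E R) (hs : E ⊆ side T v w) (hR : R ∉ side T v w) :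
    Equidistant T E w := by
  intro y hy y' hy'
  have h1 := dist_across hT h (hs hy) hR
  have h2 := dist_across hT h (hs hy') hR
  have h3 := hE y hy y' hy'
  omega

theorem closedNbhd_side (hT : T.IsTree) {v w : V} (h : T.Adj v w) {D : Set V}
    (hD : D ⊆ side T v w) : closedNbhd T D ⊆ insert v (side T v w) := by
  rintro y (hy | ⟨s, hs, hadj⟩)
  · exact Or.inr (hD hy)
  · by_cases hy : y ∈ side T v w
    · exact Or.inr hy
    · exact Or.inl (eq_of_leave_side hT h (hD hs) hadj hy).2

theorem closedNbhd_reg (hT : T.IsTree) {v : V} {X D : Set V} (hX : ∀ x ∈ X, T.Adj v x)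
    (hD : D ⊆ reg T v X) : closedNbhd T D ⊆ insert v (reg T v X) := by
  rintro y (hy | ⟨s, hs, hadj⟩)
  · exact Or.inr (hD hy)
  · obtain ⟨x, hx, hsx⟩ := hD hs
    rcases closedNbhd_side hT (hX x hx) subset_rfl (Or.inr ⟨s, hsx, hadj⟩) with h | h
    · exact Or.inl h
    · exact Or.inr ⟨x, hx, h⟩

theorem side_eq (hT : T.IsTree) {v w y : V} (h : T.Adj v w) (hy : y ∈ side T v w)
    (hne : y ≠ w) : ∃ x, T.Adj w x ∧ x ≠ v ∧ y ∈ side T w x := by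
  obtain ⟨x, hx, hyx⟩ := exists_side hT hne
  refine ⟨x, hx, ?_, hyx⟩
  rintro rfl
  exact (side_symm hT h).mp hyx hy

theorem side_subset (hT : T.IsTree) {v w x : V} (h : T.Adj v w) (hx : T.Adj w x) (hne : x ≠ v) :
    side T w x ⊆ side T v w := by
  intro y hy
  by_contra hyv
  exact hne (side_unique hT hx h.symm hy ((side_symm hT h).mpr hyv))

theorem Light.eq_or {w x x' y : V} (hw : Light T w) (hx : T.Adj w x) (hx' : T.Adj w x')
    (hne : x' ≠ x) (hy : T.Adj w y) : y = x ∨ y = x' := by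
  rcases hw x x' y hx hx' hy with h | h | h
  · exact absurd h.symm hne
  · exact Or.inr h.symm
  · exact Or.inl h.symm

theorem exists_two_of_not_light {x r : V} (hx : ¬ Light T x) :
    ∃ b c, T.Adj x b ∧ T.Adj x c ∧ b ≠ c ∧ b ≠ r ∧ c ≠ r := by
  unfold Light at hx
  push Not at hx
  obtain ⟨p, q, s, hp, hq, hs, h1, h2, h3⟩ := hx
  by_cases hpr : p = r
  · exact ⟨q, s, hq, hs, h2, fun h => h1 (hpr.trans h.symm), fun h => h3 (hpr.trans h.symm)⟩
  · by_cases hqr : q = r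
    · exact ⟨p, s, hp, hs, h3, hpr, fun h => h2 (hqr.trans h.symm)⟩
    · exact ⟨p, q, hp, hq, h1, hpr, hqr⟩

theorem exists_probe_of_capt [Nonempty V] {t : ℕ} {S : Set V} (h : capt T 1 (t + 1) S) :
    ∃ x, ∀ v ∈ S, Wins T t {u ∈ S | T.dist u x = T.dist v x} := by
  obtain ⟨P, hP, hf⟩ := h
  obtain ⟨x, hx⟩ := Finset.card_le_one_iff_subset_singleton.mp hP
  refine ⟨x, fun v hv => Wins.anti (hf v hv) fun u hu => ⟨hu.1, fun p hp => ?_⟩⟩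
  rw [Finset.mem_singleton.mp (hx hp), hu.2]

/-- If some vertex has three heavy neighbors, the robber evades a single cop. -/
theorem not_capt_of_three_heavy (hT : T.IsTree) {r a b c : V} (ha : T.Adj r a) (hb : T.Adj r b)
    (hc : T.Adj r c) (hab : a ≠ b) (hbc : b ≠ c) (hac : a ≠ c) (hla : ¬ Light T a)
    (hlb : ¬ Light T b) (hlc : ¬ Light T c) (t : ℕ) (S : Set V)
    (hS : (∀ x, x = a ∨ x = b ∨ x = c → x ∈ S) ∨ ∃ x y, (x = a ∨ x = b ∨ x = c) ∧
      (y = a ∨ y = b ∨ y = c) ∧ x ≠ y ∧ closedNbhd T {x, y} ⊆ S) : ¬ capt T 1 t S := by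
  have hadj : ∀ x, x = a ∨ x = b ∨ x = c → T.Adj r x := by
    rintro x (rfl | rfl | rfl) <;> assumption
  have hheavy : ∀ x, x = a ∨ x = b ∨ x = c → ¬ Light T x := by
    rintro x (rfl | rfl | rfl) <;> assumption
  induction t generalizing S with
  | zero => exact fun h => h
  | succ t ih =>
    intro hcapt
    have : Nonempty V := ⟨r⟩
    obtain ⟨p, hp⟩ := exists_probe_of_capt hcapt
    have two : ∀ x y, (x = a ∨ x = b ∨ x = c) → (y = a ∨ y = b ∨ y = c) → x ≠ y → x ∈ S →
        y ∈ S → p ∉ side T r x → p ∉ side T r y → False := by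
      intro x y hx hy hxy hxS hyS hpx hpy
      rw [notMem_side hT (hadj x hx)] at hpx
      rw [notMem_side hT (hadj y hy)] at hpy
      rcases hp x hxS with h | h
      · refine hxy (h ⟨hxS, rfl⟩ ⟨hyS, ?_⟩)
        rw [dist_comm, hpy, dist_comm (u := x), hpx]
      · refine ih _ (Or.inr ⟨x, y, hx, hy, hxy, closedNbhd_mono ?_⟩) h
        rintro z (rfl | rfl)
        · exact ⟨hxS, rfl⟩
        · refine ⟨hyS, ?_⟩
          rw [dist_comm, hpy, dist_comm (u := x), hpx]
    rcases hS with hS | ⟨x, y, hx, hy, hxy, hS⟩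
    · by_cases h1 : p ∈ side T r a
      · exact two b c (by simp) (by simp) hbc (hS b (by simp)) (hS c (by simp))
          (fun h => hab (side_unique hT ha hb h1 h)) (fun h => hac (side_unique hT ha hc h1 h))
      · by_cases h2 : p ∈ side T r b
        · exact two a c (by simp) (by simp) hac (hS a (by simp)) (hS c (by simp))
            h1 (fun h => hbc (side_unique hT hb hc h2 h))
        · exact two a b (by simp) (by simp) hab (hS a (by simp)) (hS b (by simp)) h1 h2
    · have key : ∀ x, (x = a ∨ x = b ∨ x = c) → closedNbhd T {x} ⊆ S → p ∉ side T r x := by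
        intro x hx hxS hpx
        obtain ⟨d, e, hd, he, hde, hdr, her⟩ := exists_two_of_not_light (r := r) (hheavy x hx)
        have hpr : T.dist p r = T.dist p x + 1 := hpx
        have : ∃ d, T.Adj x d ∧ d ≠ r ∧ p ∉ side T x d := by
          by_cases h1 : p ∈ side T x d
          · exact ⟨e, he, her, fun h => hde (side_unique hT hd he h1 h)⟩
          · exact ⟨d, hd, hdr, h1⟩
        obtain ⟨d, hd, hdr, hpd⟩ := this
        rw [notMem_side hT hd] at hpd
        have hdS : d ∈ S := hxS (Or.inr ⟨x, rfl, hd⟩)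
        have hrS : r ∈ S := hxS (Or.inr ⟨x, rfl, (hadj x hx).symm⟩)
        have hrd : T.dist r p = T.dist d p := by
          rw [dist_comm, hpr, dist_comm (u := d), hpd]
        rcases hp d hdS with h | h
        · exact hdr (h ⟨hdS, rfl⟩ ⟨hrS, hrd⟩)
        · exact ih _ (Or.inl fun z hz => Or.inr ⟨r, ⟨hrS, hrd⟩, hadj z hz⟩) h
      exact two x y hx hy hxy (hS (subset_closedNbhd (by simp)))
        (hS (subset_closedNbhd (by simp))) (key x hx ((closedNbhd_mono (by simp)).trans hS))
        (key y hy ((closedNbhd_mono (by simp)).trans hS))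

/-- No vertex has three heavy neighbors. -/
def NoThreeHeavy (T : SimpleGraph V) : Prop :=
  ∀ r x y z, T.Adj r x → T.Adj r y → T.Adj r z → ¬ Light T x → ¬ Light T y → ¬ Light T z →
    x = y ∨ y = z ∨ x = z

theorem noThreeHeavy_of_capt (hT : T.IsTree) {t : ℕ} (h : capt T 1 t univ) : NoThreeHeavy T := by
  intro r x y z hx hy hz lx ly lz
  by_contra! hne
  exact not_capt_of_three_heavy hT hx hy hz hne.1 hne.2.1 hne.2.2 lx ly lz t univ
    (Or.inl fun _ _ => mem_univ _) h

/-- A probe beyond a light neighbor `w` of `v` tells whether the robber is on the side of `w`,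
provided that his distance from a vertex not on that side was known before his move. -/
theorem exists_probe_light (hT : T.IsTree) {v w R : V} (h : T.Adj v w) (hw : Light T w)
    {D : Set V} (hD : Equidistant T D R) (hR : R ∉ side T v w) :
    ∃ x, ∀ E ⊆ closedNbhd T D, Equidistant T E x →
      E ⊆ side T v w ∨ (Disjoint E (side T v w) ∧ Equidistant T E v) := by
  have finish : ∀ x ∈ side T v w, (∀ E ⊆ closedNbhd T D, Equidistant T E x →
      ∀ y ∈ E, ∀ y' ∈ E, y ∈ side T v w → y' ∉ side T v w → False) →
      ∀ E ⊆ closedNbhd T D, Equidistant T E x →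
        E ⊆ side T v w ∨ (Disjoint E (side T v w) ∧ Equidistant T E v) := by
    intro x hx key E hE hEx
    by_cases hs : E ⊆ side T v w
    · exact Or.inl hs
    · obtain ⟨y', hy', hys'⟩ := not_subset.mp hs
      have hdis : ∀ y ∈ E, y ∉ side T v w :=
        fun y hy hys => key E hE hEx y hy y' hy' hys hys'
      refine Or.inr ⟨disjoint_left.mpr hdis, fun y hy z hz => ?_⟩
      have h1 := dist_across hT h hx (hdis y hy)
      have h2 := dist_across hT h hx (hdis z hz)
      have h3 := hEx y hy z hz
      rw [dist_comm (u := y), dist_comm (u := z)] at h3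
      omega
  by_cases hleaf : ∃ w', T.Adj w w' ∧ w' ≠ v
  · obtain ⟨w', hw', hne⟩ := hleaf
    have hx : w' ∈ side T v w := side_subset hT h hw' hne (self_mem_side hw')
    refine ⟨w', finish w' hx ?_⟩
    intro E hE hEx y hy y' hy' hys hys'
    have hww : T.dist w' w = 1 := dist_eq_one_iff_adj.mpr hw'.symm
    have h1 := dist_across hT h hx hys'
    have h2 := hEx y hy y' hy'
    rw [dist_comm (u := w'), hww] at h1
    by_cases hyw : y = w
    · rw [hyw, dist_comm (u := w), hww] at h2
      omega
    obtain ⟨z, hz, hzv, hyz⟩ := side_eq hT h hys hyw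
    have hzw : z = w' := (hw.eq_or h.symm hw' hne hz).resolve_left hzv
    rw [hzw, mem_side] at hyz
    have h3 := dist_across hT h hys hR
    have h4 := hT.1.dist_triangle (u := y') (v := v) (w := R)
    rw [dist_comm (u := v)] at h4
    obtain ⟨s, hs, hsd⟩ := dist_move hT (hE hy)
    obtain ⟨s', hs', hsd'⟩ := dist_move hT (hE hy')
    have h5 := hD s hs s' hs'
    have h6 := hsd R
    have h7 := hsd' R
    omega
  · push Not at hleaf
    refine ⟨w, finish w (self_mem_side h) ?_⟩
    intro E hE hEx y hy y' hy' hys hys'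
    have hyw : y = w := by
      by_contra hne
      obtain ⟨z, hz, hzv, _⟩ := side_eq hT h hys hne
      exact hzv (hleaf z hz)
    have h2 := hEx y hy y' hy'
    rw [hyw, dist_self] at h2
    rw [eq_of_dist_eq_zero hT h2.symm] at hys'
    exact hys' (self_mem_side h)

/-- The budget claim for the side of `u` at a light vertex `a`. -/
def SideWins (T : SimpleGraph V) (a u : V) : Prop :=
  ∀ D ⊆ side T a u, Equidistant T D a → ∀ t, (side T a u).ncard ≤ t + 1 → Wins T t D

theorem ncard_side_pos [Finite V] {v w : V} (h : T.Adj v w) : 0 < (side T v w).ncard :=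
  (ncard_pos (toFinite _)).mpr ⟨w, self_mem_side h⟩

/-- A robber known to be on the side of a light vertex `w` is caught within the size of the
side, without any information on his distance. -/
theorem wins_of_subset_side [Finite V] (hT : T.IsTree) {v w : V} (h : T.Adj v w)
    (hw : Light T w)
    (ih : ∀ w', T.Adj w w' → (side T w w').ncard < (side T v w).ncard → SideWins T w w')
    {D : Set V} (hD : D ⊆ side T v w) {t : ℕ} (ht : (side T v w).ncard ≤ t + 1) :
    Wins T t D := by
  by_cases hleaf : ∃ w', T.Adj w w' ∧ w' ≠ v
  · obtain ⟨w', hw', hne⟩ := hleaf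
    have hlt : (side T w w').ncard < (side T v w).ncard :=
      ncard_lt_ncard ((ssubset_iff_of_subset (side_subset hT h hw' hne)).mpr
        ⟨w, self_mem_side h, self_notMem_side⟩) (toFinite _)
    have hpos := ncard_side_pos hw'
    obtain ⟨t, rfl⟩ : ∃ s, t = s + 1 := ⟨t - 1, by omega⟩
    refine wins_of_probe v fun E hE hEv => ?_
    by_cases hv : v ∈ E
    · exact Or.inl (hEv.subsingleton hT hv)
    have hs : E ⊆ side T v w := fun y hy =>
      (closedNbhd_side hT h hD (hE hy)).resolve_left fun hyv => hv (hyv ▸ hy)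
    have hEw : Equidistant T E w := hEv.enter hT h hs self_notMem_side
    by_cases hwE : w ∈ E
    · exact Or.inl (hEw.subsingleton hT hwE)
    refine ih w' hw' hlt E (fun y hy => ?_) hEw t (by omega)
    obtain ⟨z, hz, hzv, hyz⟩ := side_eq hT h (hs hy) fun hyw => hwE (hyw ▸ hy)
    rwa [(hw.eq_or h.symm hw' hne hz).resolve_left hzv] at hyz
  · push Not at hleaf
    have key : ∀ y ∈ D, y = w := by
      intro y hy
      by_contra hne
      obtain ⟨z, hz, hzv, _⟩ := side_eq hT h (hD hy) hne
      exact hzv (hleaf z hz)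
    exact Or.inl fun y hy y' hy' => (key y hy).trans (key y' hy').symm

theorem side_subset_reg {v x : V} {X : Set V} (hx : x ∈ X) : side T v x ⊆ reg T v X :=
  fun _ hy => ⟨x, hx, hy⟩

theorem reg_mono {v : V} {X Y : Set V} (h : X ⊆ Y) : reg T v X ⊆ reg T v Y :=
  fun _ ⟨x, hx, hy⟩ => ⟨x, h hx, hy⟩

theorem self_notMem_reg {v : V} {X : Set V} : v ∉ reg T v X :=
  fun ⟨_, _, hy⟩ => self_notMem_side hy

theorem mem_reg_diff {v x y : V} {X : Set V} (hy : y ∈ reg T v X) (hyx : y ∉ side T v x) :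
    y ∈ reg T v (X \ {x}) := by
  obtain ⟨z, hz, hyz⟩ := hy
  refine ⟨z, ⟨hz, ?_⟩, hyz⟩
  rintro rfl
  exact hyx hyz

theorem notMem_reg_diff (hT : T.IsTree) {v x y : V} {X : Set V} (hX : ∀ x ∈ X, T.Adj v x)
    (hx : T.Adj v x) (hy : y ∈ side T v x) : y ∉ reg T v (X \ {x}) :=
  fun ⟨z, hz, hyz⟩ => hz.2 (side_unique hT (hX z hz.1) hx hyz hy)

/-- The robber is in one of the directions `X` at a heavy vertex `v`, at most one of which is
heavy, and his distance from `v` is known. -/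
theorem wins_of_subset_reg [Finite V] (hT : T.IsTree) (hN : NoThreeHeavy T) {n : ℕ}
    (ih : ∀ a u, Light T a → T.Adj a u → (side T a u).ncard < n → SideWins T a u)
    (k : ℕ) (hk : k ≤ n) (v : V) (X D : Set V) (t : ℕ) (hv : ¬ Light T v)
    (hX : ∀ x ∈ X, T.Adj v x)
    (hX1 : ∀ x ∈ X, ∀ y ∈ X, ¬ Light T x → ¬ Light T y → x = y)
    (hcard : (reg T v X).ncard ≤ k) (hD : D ⊆ reg T v X) (hDv : Equidistant T D v)
    (ht : (reg T v X).ncard ≤ t + 1) : Wins T t D := by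
  induction k generalizing v X D t with
  | zero =>
    rw [Nat.le_zero, ncard_eq_zero] at hcard
    rw [hcard, subset_empty_iff] at hD
    exact Or.inl (hD ▸ subsingleton_empty)
  | succ k IH =>
    by_cases hz : ∃ z ∈ X, Light T z
    · obtain ⟨z, hz, hlz⟩ := hz
      have hvz := hX z hz
      have hle : (side T v z).ncard ≤ (reg T v X).ncard :=
        ncard_le_ncard (side_subset_reg hz) (toFinite _)
      have hin : ∀ {E : Set V} {s : ℕ}, E ⊆ side T v z → (side T v z).ncard ≤ s + 1 →
          Wins T s E := fun hE hs =>
        wins_of_subset_side hT hvz hlz (fun w' hw' hlt => ih z w' hlz hw' (by omega)) hE hs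
      by_cases hx : ∃ x ∈ X, x ≠ z
      · obtain ⟨x, hx, hxz⟩ := hx
        have hlt : (side T v z).ncard < (reg T v X).ncard :=
          ncard_lt_ncard ((ssubset_iff_of_subset (side_subset_reg hz)).mpr
            ⟨x, ⟨x, hx, self_mem_side (hX x hx)⟩, fun h =>
              hxz (eq_of_adj_of_mem_side hT hvz (hX x hx) h)⟩) (toFinite _)
        have hlt' : (reg T v (X \ {z})).ncard < (reg T v X).ncard :=
          ncard_lt_ncard ((ssubset_iff_of_subset (reg_mono sdiff_subset)).mpr
            ⟨z, ⟨z, hz, self_mem_side hvz⟩, notMem_reg_diff hT hX hvz (self_mem_side hvz)⟩)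
            (toFinite _)
        have hpos := ncard_side_pos hvz
        obtain ⟨t, rfl⟩ : ∃ s, t = s + 1 := ⟨t - 1, by omega⟩
        obtain ⟨p, hp⟩ := exists_probe_light hT hvz hlz hDv self_notMem_side
        refine wins_of_probe p fun E hE hEp => ?_
        rcases hp E hE hEp with h | ⟨h, hEv⟩
        · exact hin h (by omega)
        by_cases hvE : v ∈ E
        · exact Or.inl (hEv.subsingleton hT hvE)
        refine IH (by omega) v (X \ {z}) E t hv (fun x hx => hX x hx.1)
          (fun x hx y hy => hX1 x hx.1 y hy.1) (by omega) (fun y hy => ?_) hEv (by omega)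
        refine mem_reg_diff ((closedNbhd_reg hT hX hD (hE hy)).resolve_left ?_)
          (disjoint_left.mp h hy)
        rintro rfl
        exact hvE hy
      · push Not at hx
        refine hin (fun y hy => ?_) (by omega)
        obtain ⟨x, hxX, hyx⟩ := hD hy
        exact hx x hxX ▸ hyx
    · push Not at hz
      rcases X.eq_empty_or_nonempty with rfl | ⟨h, hhX⟩
      · refine Or.inl fun y hy => ?_
        obtain ⟨x, hx, _⟩ := hD hy
        exact absurd hx (notMem_empty x)
      have hvh := hX h hhX
      have hDh : D ⊆ side T v h := by
        intro y hy
        obtain ⟨x, hxX, hyx⟩ := hD hy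
        exact hX1 x hxX h hhX (hz x hxX) (hz h hhX) ▸ hyx
      have hDe : Equidistant T D h := hDv.enter hT hvh hDh self_notMem_side
      by_cases hhD : h ∈ D
      · exact Or.inl (hDe.subsingleton hT hhD)
      have hsub : reg T h {x | T.Adj h x ∧ x ≠ v} ⊆ reg T v X := by
        rintro y ⟨x, ⟨hx, hxv⟩, hyx⟩
        exact ⟨h, hhX, side_subset hT hvh hx hxv hyx⟩
      have hlt : (reg T h {x | T.Adj h x ∧ x ≠ v}).ncard < (reg T v X).ncard :=
        ncard_lt_ncard ((ssubset_iff_of_subset hsub).mpr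
          ⟨h, ⟨h, hhX, self_mem_side hvh⟩, self_notMem_reg⟩) (toFinite _)
      refine IH (by omega) h {x | T.Adj h x ∧ x ≠ v} D t (hz h hhX) (fun x hx => hx.1)
        ?_ (by omega) (fun y hy => ?_) hDe (by omega)
      · intro x hx y hy hlx hly
        rcases hN h v x y hvh.symm hx.1 hy.1 hv hlx hly with h1 | h1 | h1
        · exact absurd h1.symm hx.2
        · exact h1
        · exact absurd h1.symm hy.2
      · obtain ⟨x, hx, hxv, hyx⟩ := side_eq hT hvh (hDh hy) fun hyh => hhD (hyh ▸ hy)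
        exact ⟨x, ⟨hx, hxv⟩, hyx⟩

/-- The exit check: if the robber is on the side of `u` at the light vertex `a`, or at `a`, then
one probe either locates him or returns him to that side at a known distance. -/
theorem exists_probe_exit (hT : T.IsTree) {a u : V} (ha : Light T a) (hau : T.Adj a u)
    {D : Set V} (hD : D ⊆ insert a (side T a u)) :
    ∃ x, ∀ E ⊆ closedNbhd T D, Equidistant T E x →
      E.Subsingleton ∨ (E ⊆ side T a u ∧ Equidistant T E a) := by
  by_cases hleaf : ∃ p, T.Adj a p ∧ p ≠ u
  · obtain ⟨p, hap, hpu⟩ := hleaf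
    have hpside : p ∉ side T a u := fun h => hpu (eq_of_adj_of_mem_side hT hau hap h)
    refine ⟨p, fun E hE hEp => ?_⟩
    have hsub : E ⊆ insert p (insert a (side T a u)) := by
      intro y hy
      rcases hE hy with h | ⟨s, hs, hadj⟩
      · exact Or.inr (hD h)
      rcases hD hs with rfl | hs
      · rcases ha.eq_or hau hap hpu hadj with rfl | rfl
        · exact Or.inr (Or.inr (self_mem_side hau))
        · exact Or.inl rfl
      · exact Or.inr (closedNbhd_side hT hau subset_rfl (Or.inr ⟨s, hs, hadj⟩))
    by_cases hpE : p ∈ E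
    · exact Or.inl (hEp.subsingleton hT hpE)
    have hs : E ⊆ side T p a := by
      intro y hy
      rcases hsub hy with rfl | rfl | h
      · exact absurd hy hpE
      · exact self_mem_side hap.symm
      · exact side_subset hT hap.symm hau hpu.symm h
    have hEa := hEp.enter hT hap.symm hs self_notMem_side
    by_cases haE : a ∈ E
    · exact Or.inl (hEa.subsingleton hT haE)
    refine Or.inr ⟨fun y hy => ?_, hEa⟩
    rcases hsub hy with rfl | rfl | h
    · exact absurd hy hpE
    · exact absurd hy haE
    · exact h
  · push Not at hleaf
    refine ⟨a, fun E hE hEa => ?_⟩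
    by_cases haE : a ∈ E
    · exact Or.inl (hEa.subsingleton hT haE)
    refine Or.inr ⟨fun y hy => ?_, hEa⟩
    rcases hE hy with h | ⟨s, hs, hadj⟩
    · exact (hD h).resolve_left fun h1 => haE (h1 ▸ hy)
    rcases hD hs with rfl | hs
    · rw [hleaf y hadj]
      exact self_mem_side hau
    · exact (closedNbhd_side hT hau subset_rfl (Or.inr ⟨s, hs, hadj⟩)).resolve_left
        fun h1 => haE (h1 ▸ hy)

/-- Handing over to `wins_of_subset_reg` at the vertex `u`, entered from `v`, once the exit `a`
is excluded. -/
theorem wins_at_exit_vertex [Finite V] (hT : T.IsTree) (hN : NoThreeHeavy T) {n : ℕ}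
    (ih : ∀ a u, Light T a → T.Adj a u → (side T a u).ncard < n → SideWins T a u)
    {a u v : V} (hau : T.Adj a u) (hu : ¬ Light T u) (hv : ¬ Light T v) (hvu : T.Adj v u)
    {F : Set V} {t : ℕ} (hFv : F ⊆ side T v u) (hFa : F ⊆ side T a u) (huF : u ∉ F)
    (hFu : Equidistant T F u) (hn : (side T v u ∩ side T a u).ncard ≤ n)
    (ht : (side T v u ∩ side T a u).ncard ≤ t + 2) : Wins T t F := by
  have hsub : reg T u {x | T.Adj u x ∧ x ≠ v ∧ x ≠ a} ⊆ side T v u ∩ side T a u := by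
    rintro y ⟨x, ⟨hx, hxv, hxa⟩, hyx⟩
    exact ⟨side_subset hT hvu hx hxv hyx, side_subset hT hau hx hxa hyx⟩
  have hlt : (reg T u {x | T.Adj u x ∧ x ≠ v ∧ x ≠ a}).ncard <
      (side T v u ∩ side T a u).ncard :=
    ncard_lt_ncard ((ssubset_iff_of_subset hsub).mpr
      ⟨u, ⟨self_mem_side hvu, self_mem_side hau⟩, self_notMem_reg⟩) (toFinite _)
  refine wins_of_subset_reg hT hN ih _ hn u {x | T.Adj u x ∧ x ≠ v ∧ x ≠ a} F t hu
    (fun x hx => hx.1) ?_ hlt.le (fun y hy => ?_) hFu (by omega)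
  · intro x hx y hy hlx hly
    rcases hN u v x y hvu.symm hx.1 hy.1 hv hlx hly with h1 | h1 | h1
    · exact absurd h1.symm hx.2.1
    · exact h1
    · exact absurd h1.symm hy.2.1
  · have hne : y ≠ u := fun h => huF (h ▸ hy)
    obtain ⟨x, hx, hxv, hyx⟩ := side_eq hT hvu (hFv hy) hne
    obtain ⟨x', hx', hxa, hyx'⟩ := side_eq hT hau (hFa hy) hne
    rw [side_unique hT hx' hx hyx' hyx] at hxa
    exact ⟨x, ⟨hx, hxv, hxa⟩, hyx⟩

/-- The robber is on the side of `u` at the light vertex `a`; the cop explores directions at a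
vertex `v` joined to `u` by a path of heavy vertices starting with `h`, and must not let the
robber escape through `a`. -/
theorem wins_toward_exit [Finite V] (hT : T.IsTree) (hN : NoThreeHeavy T) {n : ℕ}
    (ih : ∀ a u, Light T a → T.Adj a u → (side T a u).ncard < n → SideWins T a u)
    {a u : V} (ha : Light T a) (hau : T.Adj a u)
    (k : ℕ) (hk : k ≤ n) (v h : V) (X D : Set V) (t : ℕ)
    (hvh : T.Adj v h) (huh : u ∈ side T v h) (hva : v ∈ side T a u)
    (hgeo : ∀ y, T.dist y v + T.dist y u = T.dist u v → ¬ Light T y)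
    (hhX : h ∈ X) (hX : ∀ x ∈ X, T.Adj v x) (hXl : ∀ x ∈ X, x ≠ h → Light T x)
    (hcard : (reg T v X ∩ side T a u).ncard ≤ k)
    (hDa : D ⊆ side T a u) (hD : D ⊆ reg T v X)
    (hmode : Equidistant T D v ∨
      (Equidistant T D a ∧ ∀ y ∈ D, T.dist y v + T.dist y u ≠ T.dist u v))
    (ht : (reg T v X ∩ side T a u).ncard ≤ t + 1) : Wins T t D := by
  induction k generalizing v h X D t with
  | zero =>
    rw [Nat.le_zero, ncard_eq_zero] at hcard
    have : D ⊆ ∅ := hcard ▸ subset_inter hD hDa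
    rw [subset_empty_iff] at this
    exact Or.inl (this ▸ subsingleton_empty)
  | succ k IH =>
    have huv : T.dist u v = T.dist u h + 1 := huh
    have hva' : T.dist v a = T.dist v u + 1 := hva
    have hvh1 : T.dist h v = 1 := dist_eq_one_iff_adj.mpr hvh.symm
    have hlu : ¬ Light T u := hgeo u (by rw [dist_self, add_zero])
    have hlv : ¬ Light T v := hgeo v (by rw [dist_self, zero_add, dist_comm])
    have hlh : ¬ Light T h := hgeo h (by rw [hvh1, dist_comm, huv, add_comm])
    have hah : a ∈ side T v h := by
      by_contra hah
      have h1 := dist_across hT hvh huh hah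
      have h2 : T.dist u a = 1 := dist_eq_one_iff_adj.mpr hau.symm
      rw [dist_comm] at hva'
      omega
    by_cases hmiss : ∃ z ∈ X, z ≠ h ∧ Disjoint D (side T v z)
    · obtain ⟨z, hzX, hzh, hdis⟩ := hmiss
      have hvz := hX z hzX
      have hza : z ∈ side T a u := by
        by_contra hza
        have h1 := eq_of_leave_side hT hau hva hvz hza
        exact hzh (eq_of_adj_of_mem_side hT hvh hvz (h1.2 ▸ hah))
      have hlt : (reg T v (X \ {z}) ∩ side T a u).ncard < (reg T v X ∩ side T a u).ncard :=
        ncard_lt_ncard ((ssubset_iff_of_subset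
          (inter_subset_inter_left _ (reg_mono sdiff_subset))).mpr
          ⟨z, ⟨⟨z, hzX, self_mem_side hvz⟩, hza⟩,
            fun h => notMem_reg_diff hT hX hvz (self_mem_side hvz) h.1⟩) (toFinite _)
      exact IH (by omega) v h (X \ {z}) D t hvh huh hva hgeo ⟨hhX, fun h1 => hzh h1.symm⟩
        (fun x hx => hX x hx.1) (fun x hx => hXl x hx.1) (by omega) hDa
        (fun y hy => mem_reg_diff (hD hy) (disjoint_left.mp hdis hy)) hmode (by omega)
    push Not at hmiss
    by_cases hz : ∃ z ∈ X, z ≠ h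
    · obtain ⟨z, hzX, hzh, hcase⟩ : ∃ z ∈ X, z ≠ h ∧
          (2 ≤ (side T v z).ncard ∨ ∀ x ∈ X, x ≠ h → side T v x = {x}) := by
        by_cases hbig : ∃ z ∈ X, z ≠ h ∧ 2 ≤ (side T v z).ncard
        · obtain ⟨z, h1, h2, h3⟩ := hbig
          exact ⟨z, h1, h2, Or.inl h3⟩
        · push Not at hbig
          obtain ⟨z, h1, h2⟩ := hz
          refine ⟨z, h1, h2, Or.inr fun x hx hxh => ?_⟩
          have h3 := ncard_side_pos (hX x hx)
          have h4 := hbig x hx hxh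
          obtain ⟨b, hb⟩ := ncard_eq_one.mp (by omega : (side T v x).ncard = 1)
          have : x ∈ side T v x := self_mem_side (hX x hx)
          rw [hb, mem_singleton_iff] at this
          rw [hb, this]
      have hvz := hX z hzX
      have hlz := hXl z hzX hzh
      have haz : a ∉ side T v z := fun h1 => hzh (side_unique hT hvz hvh h1 hah)
      have huz : u ∉ side T v z := fun h1 => hzh (side_unique hT hvz hvh h1 huh)
      have hza : side T v z ⊆ side T a u := by
        intro y hy
        have h1 := dist_across hT hvz hy haz
        have h2 := dist_across hT hvz hy huz
        rw [mem_side]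
        rw [dist_comm, dist_comm (u := v)] at hva'
        omega
      have hsum : (reg T v (X \ {z}) ∩ side T a u).ncard + (side T v z).ncard ≤
          (reg T v X ∩ side T a u).ncard := by
        rw [← ncard_union_eq _ (toFinite _) (toFinite _)]
        · refine ncard_le_ncard (union_subset (inter_subset_inter_left _
            (reg_mono sdiff_subset)) (subset_inter (side_subset_reg hzX) hza)) (toFinite _)
        · exact disjoint_right.mpr fun y hy h1 => notMem_reg_diff hT hX hvz hy h1.1
      have huS : u ∈ reg T v (X \ {z}) ∩ side T a u :=
        ⟨⟨h, ⟨hhX, fun h1 => hzh h1.symm⟩, huh⟩, self_mem_side hau⟩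
      have hupos : 0 < (reg T v (X \ {z}) ∩ side T a u).ncard :=
        (ncard_pos (toFinite _)).mpr ⟨u, huS⟩
      have hzpos := ncard_side_pos hvz
      obtain ⟨t, rfl⟩ : ∃ s, t = s + 1 := ⟨t - 1, by omega⟩
      obtain ⟨R, hRz, hDR⟩ : ∃ R, R ∉ side T v z ∧ Equidistant T D R :=
        hmode.elim (fun h1 => ⟨v, self_notMem_side, h1⟩) fun h1 => ⟨a, haz, h1.1⟩
      obtain ⟨p, hp⟩ := exists_probe_light hT hvz hlz hDR hRz
      refine wins_of_probe p fun E hE hEp => ?_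
      rcases hp E hE hEp with hEz | ⟨hEz, hEv⟩
      · exact wins_of_subset_side hT hvz hlz
          (fun w' hw' hlt => ih z w' hlz hw' (by omega)) hEz (by omega)
      by_cases hvE : v ∈ E
      · exact Or.inl (hEv.subsingleton hT hvE)
      have hEX : E ⊆ reg T v (X \ {z}) := fun y hy =>
        mem_reg_diff ((closedNbhd_reg hT hX hD (hE hy)).resolve_left fun h1 => hvE (h1 ▸ hy))
          (disjoint_left.mp hEz hy)
      have hEa : E ⊆ insert a (side T a u) := hE.trans (closedNbhd_side hT hau hDa)
      by_cases haE : a ∈ E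
      swap
      · exact IH (by omega) v h (X \ {z}) E t hvh huh hva hgeo ⟨hhX, fun h1 => hzh h1.symm⟩
          (fun x hx => hX x hx.1) (fun x hx => hXl x hx.1) (by omega)
          (fun y hy => (hEa hy).resolve_left fun h1 => haE (h1 ▸ hy)) hEX (Or.inl hEv) (by omega)
      have huD : u ∈ D := by
        rcases hE haE with h1 | ⟨s, hs, hsa⟩
        · exact absurd (hDa h1) self_notMem_side
        · exact (eq_of_leave_side hT hau (hDa hs) hsa self_notMem_side).1 ▸ hs
      have hDv : Equidistant T D v :=
        hmode.resolve_right fun h1 => h1.2 u huD (by rw [dist_self, add_zero])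
      have hEd : ∀ y ∈ E, T.dist y v = T.dist u v + 1 := by
        intro y hy
        rw [hEv y hy a haE, dist_comm, hva', dist_comm]
      have hbig : 1 ≤ t ∧ (2 ≤ (side T v z).ncard ∨
          (u = h ∧ ∀ x ∈ X, x ≠ h → side T v x = {x})) := by
        rcases hcase with h1 | h1
        · exact ⟨by omega, Or.inl h1⟩
        · obtain ⟨y, hyD, hyz⟩ := not_disjoint_iff.mp (hmiss z hzX hzh)
          rw [h1 z hzX hzh, mem_singleton_iff] at hyz
          have h2 := hDv y hyD u huD
          rw [hyz, dist_eq_one_iff_adj.mpr hvz.symm] at h2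
          have hu : u = h := eq_of_dist_eq_zero hT (by omega)
          obtain ⟨b, hb, hbv, hba⟩ : ∃ b, T.Adj u b ∧ b ≠ v ∧ b ≠ a := by
            obtain ⟨b, c, hb, hc, hbc, hbv, hcv⟩ := exists_two_of_not_light (r := v) hlu
            by_cases hba : b = a
            · exact ⟨c, hc, hcv, fun h3 => hbc (hba.trans h3.symm)⟩
            · exact ⟨b, hb, hbv, hba⟩
          have hvu : T.Adj v u := hu ▸ hvh
          have hbS : b ∈ reg T v (X \ {z}) ∩ side T a u :=
            ⟨⟨u, ⟨hu ▸ hhX, fun h3 => hzh (h3.symm.trans hu)⟩,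
              side_subset hT hvu hb hbv (self_mem_side hb)⟩,
              side_subset hT hau hb hba (self_mem_side hb)⟩
          have h4 : 1 < (reg T v (X \ {z}) ∩ side T a u).ncard :=
            (one_lt_ncard (toFinite _)).mpr ⟨u, huS, b, hbS, hb.ne⟩
          exact ⟨by omega, Or.inr ⟨hu, h1⟩⟩
      obtain ⟨t, rfl⟩ : ∃ s, t = s + 1 := ⟨t - 1, by omega⟩
      obtain ⟨q, hq⟩ := exists_probe_exit hT ha hau hEa
      refine wins_of_probe q fun F hF hFq => ?_
      rcases hq F hF hFq with h1 | ⟨hFa, hFe⟩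
      · exact Or.inl h1
      have hFu : Equidistant T F u := hFe.enter hT hau hFa self_notMem_side
      by_cases huF : u ∈ F
      · exact Or.inl (hFu.subsingleton hT huF)
      have hFd : ∀ y ∈ F, T.dist u v ≤ T.dist y v := by
        intro y hy
        obtain ⟨s, hs, hsd⟩ := dist_move hT (hF hy)
        have h1 := hEd s hs
        have h2 := hsd v
        omega
      have hvF : v ∉ F := by
        intro h1
        have h2 := hFd v h1
        rw [dist_self] at h2
        omega
      rcases hbig.2 with h1 | ⟨hu, h1⟩
      · refine IH (by omega) v h (X \ {z}) F t hvh huh hva hgeo ⟨hhX, fun h1 => hzh h1.symm⟩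
          (fun x hx => hX x hx.1) (fun x hx => hXl x hx.1) (by omega) hFa (fun y hy => ?_)
          (Or.inr ⟨hFe, fun y hy h2 => ?_⟩) (by omega)
        · exact (closedNbhd_reg hT (fun x hx => hX x hx.1) hEX (hF hy)).resolve_left
            fun h1 => hvF (h1 ▸ hy)
        · have h3 := hFd y hy
          exact huF (eq_of_dist_eq_zero hT (by omega : T.dist y u = 0) ▸ hy)
      · have hvu : T.Adj v u := hu ▸ hvh
        have hEu : E ⊆ side T v u := by
          intro y hy
          obtain ⟨x, hx, hyx⟩ := hEX hy
          by_cases hxh : x = h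
          · rwa [hxh, ← hu] at hyx
          · rw [h1 x hx.1 hxh, mem_singleton_iff] at hyx
            have h2 := hEd y hy
            rw [hyx, dist_eq_one_iff_adj.mpr (hX x hx.1).symm] at h2
            omega
        have hle : (side T v u ∩ side T a u).ncard ≤
            (reg T v (X \ {z}) ∩ side T a u).ncard :=
          ncard_le_ncard (inter_subset_inter_left _
            (side_subset_reg ⟨hu ▸ hhX, fun h3 => hzh (h3.symm.trans hu)⟩)) (toFinite _)
        refine wins_at_exit_vertex hT hN ih hau hlu hlv hvu (fun y hy => ?_) hFa huF hFu
          (by omega) (by omega)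
        exact (closedNbhd_side hT hvu hEu (hF hy)).resolve_left fun h1 => hvF (h1 ▸ hy)
    · push Not at hz
      have hDh : D ⊆ side T v h := by
        intro y hy
        obtain ⟨x, hx, hyx⟩ := hD hy
        exact hz x hx ▸ hyx
      by_cases hhD : h ∈ D
      · rcases hmode with h1 | h1
        · exact Or.inl ((h1.enter hT hvh hDh self_notMem_side).subsingleton hT hhD)
        · exact absurd (by rw [hvh1, dist_comm, huv, add_comm]) (h1.2 h hhD)
      by_cases hu : u = h
      · have hvu : T.Adj v u := hu ▸ hvh
        have hDvu : D ⊆ side T v u := hu ▸ hDh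
        have hle : (side T v u ∩ side T a u).ncard ≤ (reg T v X ∩ side T a u).ncard :=
          ncard_le_ncard (inter_subset_inter_left _ (side_subset_reg (hu ▸ hhX))) (toFinite _)
        exact wins_at_exit_vertex hT hN ih hau hlu hlv hvu hDvu hDa (hu ▸ hhD)
          (hmode.elim (fun h1 => h1.enter hT hvu hDvu self_notMem_side)
            fun h1 => h1.1.enter hT hau hDa self_notMem_side) (by omega) (by omega)
      obtain ⟨h', hhh', hv', huh'⟩ := side_eq hT hvh huh hu
      have hha : h ∈ side T a u := by
        by_contra h1
        have h2 := (eq_of_leave_side hT hau hva hvh h1).1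
        rw [h2] at huh
        exact self_notMem_side huh
      have hpath : ∀ y, T.dist y h + T.dist y u = T.dist u h →
          T.dist y v + T.dist y u = T.dist u v := by
        intro y hy
        have h1 := dist_adj hT hvh y
        have h2 := hT.1.dist_triangle (u := u) (v := y) (w := v)
        rw [dist_comm (u := u) (v := y)] at h2
        omega
      have huh'' : T.dist u h = T.dist u h' + 1 := huh'
      have hh1 : T.dist h' h = 1 := dist_eq_one_iff_adj.mpr hhh'.symm
      have hlh' : ¬ Light T h' :=
        hgeo h' (hpath h' (by rw [hh1, dist_comm, huh'', add_comm]))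
      set Y : Set V := {x | T.Adj h x ∧ x ≠ v ∧ (x ≠ h' → Light T x)}
      have hsub : reg T h Y ∩ side T a u ⊆ reg T v X ∩ side T a u := by
        rintro y ⟨⟨x, hx, hyx⟩, hya⟩
        exact ⟨⟨h, hhX, side_subset hT hvh hx.1 hx.2.1 hyx⟩, hya⟩
      have hlt : (reg T h Y ∩ side T a u).ncard < (reg T v X ∩ side T a u).ncard :=
        ncard_lt_ncard ((ssubset_iff_of_subset hsub).mpr
          ⟨h, ⟨⟨h, hhX, self_mem_side hvh⟩, hha⟩, fun h1 => self_notMem_reg h1.1⟩) (toFinite _)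
      refine IH (by omega) h h' Y D t hhh' huh' hha (fun y hy => hgeo y (hpath y hy))
        ⟨hhh', hv', fun h1 => absurd rfl h1⟩ (fun x hx => hx.1) (fun x hx => hx.2.2) (by omega)
        hDa (fun y hy => ?_) ?_ (by omega)
      · obtain ⟨x, hx, hxv, hyx⟩ := side_eq hT hvh (hDh hy) fun h1 => hhD (h1 ▸ hy)
        refine ⟨x, ⟨hx, hxv, fun hxh => ?_⟩, hyx⟩
        by_contra hlx
        rcases hN h v x h' hvh.symm hx hhh' hlv hlx hlh' with h1 | h1 | h1
        · exact hxv h1.symm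
        · exact hxh h1
        · exact hv' h1.symm
      · exact hmode.imp (fun h1 => h1.enter hT hvh hDh self_notMem_side)
          fun h1 => ⟨h1.1, fun y hy h2 => h1.2 y hy (hpath y h2)⟩

/-- The heavy component of a heavy vertex `u` with a heavy neighbor contains a vertex `r ≠ u` all
of whose neighbors but the one towards `u` are light. -/
theorem exists_heavy_end [Finite V] (hT : T.IsTree) {u b : V} (hu : ¬ Light T u)
    (hub : T.Adj u b) (hb : ¬ Light T b) :
    ∃ r h, T.Adj r h ∧ u ∈ side T r h ∧
      (∀ z, T.dist z r + T.dist z u = T.dist u r → ¬ Light T z) ∧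
      ∀ x, T.Adj r x → x ≠ h → Light T x := by
  have hub1 : T.dist u b = 1 := dist_eq_one_iff_adj.mpr hub
  have hbS : b ∈ {y | ∀ z, T.dist z y + T.dist z u = T.dist u y → ¬ Light T z} := by
    intro z hz
    rw [hub1] at hz
    by_cases h0 : T.dist z b = 0
    · exact eq_of_dist_eq_zero hT h0 ▸ hb
    · exact eq_of_dist_eq_zero hT (by omega : T.dist z u = 0) ▸ hu
  obtain ⟨r, hr, hmax⟩ := exists_max_image _ (fun y => T.dist u y) (toFinite _) ⟨b, hbS⟩
  have hru : u ≠ r := by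
    rintro rfl
    have := hmax b hbS
    rw [dist_self] at this
    omega
  obtain ⟨h, hrh, huh⟩ := exists_side hT hru
  refine ⟨r, h, hrh, huh, hr, fun x hx hxh => ?_⟩
  by_contra hlx
  have hux : u ∉ side T r x := fun h1 => hxh (side_unique hT hx hrh h1 huh)
  have hdx := (notMem_side hT hx).mp hux
  have hxS : x ∈ {y | ∀ z, T.dist z y + T.dist z u = T.dist u y → ¬ Light T z} := by
    intro z hz
    by_cases hzx : z ∈ side T r x
    · have h1 := dist_across hT hx hzx hux
      exact eq_of_dist_eq_zero hT (by omega : T.dist z x = 0) ▸ hlx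
    · have h1 := (notMem_side hT hx).mp hzx
      exact hr z (by omega)
  have := hmax x hxS
  omega

/-- A robber on one side of a light vertex, at a known distance, is caught within the size of
the side. -/
theorem sideWins [Finite V] (hT : T.IsTree) (hN : NoThreeHeavy T) (n : ℕ) (a u : V)
    (ha : Light T a) (hau : T.Adj a u) (hn : (side T a u).ncard = n) : SideWins T a u := by
  induction n using Nat.strong_induction_on generalizing a u with
  | _ n IH =>
  have ih : ∀ a u, Light T a → T.Adj a u → (side T a u).ncard < n → SideWins T a u :=
    fun a u ha hau hlt => IH _ hlt a u ha hau rfl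
  intro D hD hDa t ht
  have hDu : Equidistant T D u := hDa.enter hT hau hD self_notMem_side
  by_cases huD : u ∈ D
  · exact Or.inl (hDu.subsingleton hT huD)
  by_cases hu : Light T u
  · exact wins_of_subset_side hT hau hu
      (fun w' hw' hlt => ih u w' hu hw' (by omega)) hD ht
  by_cases hheavy : ∃ b, T.Adj u b ∧ ¬ Light T b
  swap
  · push Not at hheavy
    have hsub : reg T u {x | T.Adj u x ∧ x ≠ a} ⊆ side T a u := by
      rintro y ⟨x, ⟨hx, hxa⟩, hyx⟩
      exact side_subset hT hau hx hxa hyx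
    have hle := ncard_le_ncard hsub (toFinite _)
    refine wins_of_subset_reg hT hN ih n le_rfl u {x | T.Adj u x ∧ x ≠ a} D t hu
      (fun x hx => hx.1) (fun x hx _ _ hlx _ => absurd (hheavy x hx.1) hlx) (by omega)
      (fun y hy => ?_) hDu (by omega)
    obtain ⟨x, hx, hxa, hyx⟩ := side_eq hT hau (hD hy) fun h => huD (h ▸ hy)
    exact ⟨x, ⟨hx, hxa⟩, hyx⟩
  obtain ⟨b, hub, hb⟩ := hheavy
  obtain ⟨r, h, hrh, huh, hgeo, hl⟩ := exists_heavy_end hT hu hub hb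
  have hra : r ∈ side T a u := by
    by_contra hra
    have h1 := dist_across hT hau (self_mem_side hau) hra
    rw [dist_self, zero_add] at h1
    exact hgeo a (by rw [h1, dist_eq_one_iff_adj.mpr hau, dist_comm, add_comm]) ha
  have hru : r ≠ u := by
    rintro rfl
    exact self_notMem_side huh
  have htwo : 1 < (side T a u).ncard :=
    (one_lt_ncard (toFinite _)).mpr ⟨r, hra, u, self_mem_side hau, hru⟩
  obtain ⟨t, rfl⟩ : ∃ s, t = s + 1 := ⟨t - 1, by omega⟩
  refine wins_of_probe r fun E hE hEr => ?_
  by_cases hrE : r ∈ E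
  · exact Or.inl (hEr.subsingleton hT hrE)
  have hEa : E ⊆ side T a u := by
    intro y hy
    by_contra hya
    rcases hE hy with h1 | ⟨s, hs, hadj⟩
    · exact hya (hD h1)
    · exact huD ((eq_of_leave_side hT hau (hD hs) hadj hya).1 ▸ hs)
  have hlt : (reg T r {x | T.Adj r x} ∩ side T a u).ncard < (side T a u).ncard :=
    ncard_lt_ncard ((ssubset_iff_of_subset inter_subset_right).mpr
      ⟨r, hra, fun h1 => self_notMem_reg h1.1⟩) (toFinite _)
  exact wins_toward_exit hT hN ih ha hau n le_rfl r h {x | T.Adj r x} E t hrh huh hra hgeo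
    hrh (fun x hx => hx) (fun x hx => hl x hx) (by omega) hEa
    (fun y hy => exists_side hT fun h1 => hrE (h1 ▸ hy)) (Or.inl hEr) (by omega)

theorem capt_univ [Fintype V] (hT : T.IsTree) (hcard : 2 ≤ Fintype.card V)
    (hN : NoThreeHeavy T) : capt T 1 (Fintype.card V - 1) univ := by
  classical
  have : Nontrivial V := Fintype.one_lt_card_iff_nontrivial.mp hcard
  obtain ⟨a, ha⟩ := hT.exists_vert_degree_one_of_nontrivial
  obtain ⟨u, hau, huniq⟩ := (degree_eq_one_iff_existsUnique_adj).mp ha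
  have hla : Light T a := fun x y z hx hy _ => Or.inl ((huniq x hx).trans (huniq y hy).symm)
  have hside : side T a u = {a}ᶜ := by
    ext y
    refine ⟨fun hy hya => ?_, fun hy => ?_⟩
    · rw [mem_singleton_iff] at hya
      exact self_notMem_side (hya ▸ hy)
    · obtain ⟨w, hw, hyw⟩ := exists_side hT hy
      exact huniq w hw ▸ hyw
  have hn : (side T a u).ncard = Fintype.card V - 1 := by
    rw [hside, ncard_compl, ncard_singleton, Nat.card_eq_fintype_card]
  obtain ⟨s, hs⟩ : ∃ s, Fintype.card V - 1 = s + 1 := ⟨Fintype.card V - 2, by omega⟩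
  rw [hs]
  refine capt_of_probe a fun E _ hEa => ?_
  by_cases haE : a ∈ E
  · exact Or.inl (hEa.subsingleton hT haE)
  refine sideWins hT hN _ a u hla hau rfl E (fun y hy => ?_) hEa s (by omega)
  rw [hside]
  exact fun h => haE (mem_singleton_iff.mp h ▸ hy)

end LocalizationGame

/-- If `T` is a tree on `n ≥ 2` vertices with localization number `ζ(T) = 1`,
then `lcapt(T) ≤ n − 1`. -/
theorem stmt_2 {V : Type*} [Fintype V] (T : SimpleGraph V) (hT : T.IsTree)
    (hcard : 2 ≤ Fintype.card V) (hzeta : zeta T = 1) :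
    lcapt T ≤ Fintype.card V - 1 := by
  have hmem := Nat.sInf_mem (Nat.nonempty_of_sInf_eq_succ (k := 0) hzeta)
  rw [show sInf _ = 1 from hzeta] at hmem
  obtain ⟨t, ht⟩ := hmem
  unfold lcapt lcaptK
  rw [hzeta]
  exact Nat.sInf_le (LocalizationGame.capt_univ hT hcard
    (LocalizationGame.noThreeHeavy_of_capt hT ht))
end
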